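/- arXiv:1612.02988 — 5 statements merged into one kernel-verified Lean document; each statement's English description precedes it below -/
import Mathlib

section
/- Let G be a finite connected cubic vertex-transitive graph of girth 4 in which no two quadrangles are adjacent, and suppose G is not isomorphic to T_m for any integer m ≥ 2 (with either choice of the matching M). Then G is super cyclically edge-connected; that is, for every minimum cyclic edge-cut F of G, some component of G − F is a cycle of length 4. -/
open SimpleGraph

/-- A simple graph is vertex-transitive if any vertex can be mapped to any other
by a graph automorphism. -/
def IsVertexTransitive {V : Type*} (G : SimpleGraph V) : Prop :=
  ∀ x y : V, ∃ φ : G ≃g G, φ x = y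

/-- A graph `G` with at least `2*n+2` vertices is `n`-extendable if it has a matching
of size `n` and every matching of size `n` extends to a perfect matching. -/
def IsNExtendable {V : Type*} [Fintype V] (G : SimpleGraph V) (n : ℕ) : Prop :=
  2 * n + 2 ≤ Fintype.card V ∧
    (∃ M : G.Subgraph, M.IsMatching ∧ M.edgeSet.ncard = n) ∧
    ∀ M : G.Subgraph, M.IsMatching → M.edgeSet.ncard = n →
      ∃ P : G.Subgraph, P.IsPerfectMatching ∧ M.edgeSet ⊆ P.edgeSet

/-- `F` is an edge-cut of `G`: a set of edges of `G` whose removal disconnects `G`. -/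
def IsEdgeCut {V : Type*} (G : SimpleGraph V) (F : Set (Sym2 V)) : Prop :=
  F ⊆ G.edgeSet ∧ ¬ (G.deleteEdges F).Connected

/-- `F` is a cyclic edge-cut of `G`: a set of edges of `G` such that `G - F` has at least
two components containing cycles. -/
def IsCyclicEdgeCut {V : Type*} (G : SimpleGraph V) (F : Set (Sym2 V)) : Prop :=
  F ⊆ G.edgeSet ∧
    ∃ (u v : V) (c : (G.deleteEdges F).Walk u u) (c' : (G.deleteEdges F).Walk v v),
      c.IsCycle ∧ c'.IsCycle ∧ ¬ (G.deleteEdges F).Reachable u v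

/-- Some connected component of `H` is a cycle of length `n`: there is a cycle `c`
of length `n` such that the component of its base vertex has exactly the vertices and
edges of `c`. -/
def HasCycleComponentOfLength {V : Type*} (H : SimpleGraph V) (n : ℕ) : Prop :=
  ∃ (u : V) (c : H.Walk u u), c.IsCycle ∧ c.length = n ∧
    (∀ w, H.Reachable u w → w ∈ c.support) ∧
    (∀ e ∈ H.edgeSet, (∃ w, w ∈ e ∧ H.Reachable u w) → e ∈ c.edges)

/-- The graph `T_m`. Vertex `(i, t)` represents `x_{i', t+1}` where `i' ∈ {1,2,3,4}`
is congruent to `i` modulo 4 (so `x_4` corresponds to `i = 0`), and columns are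
indexed `0, …, m-1` (0-based). The Boolean `Mc` selects which of the two possible
matchings `M` is used. -/
def TmGraph (m : ℕ) (Mc : Bool) : SimpleGraph (ZMod 4 × Fin m) :=
  SimpleGraph.fromRel fun p q =>
    -- quadrangle edges x_{i,j} x_{i+1,j}
    (q.1 = p.1 + 1 ∧ q.2 = p.2) ∨
    -- edges x_{1,2j-1} x_{1,2j} and x_{3,2j-1} x_{3,2j}
    ((p.1 = 1 ∨ p.1 = 3) ∧ q.1 = p.1 ∧ (p.2 : ℕ) % 2 = 0 ∧ (q.2 : ℕ) = (p.2 : ℕ) + 1) ∨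
    -- edges x_{2,2j} x_{2,2j+1} and x_{4,2j} x_{4,2j+1}
    ((p.1 = 2 ∨ p.1 = 0) ∧ q.1 = p.1 ∧ (p.2 : ℕ) % 2 = 1 ∧ (q.2 : ℕ) = (p.2 : ℕ) + 1) ∨
    -- the matching M, odd m
    (m % 2 = 1 ∧ (p.2 : ℕ) = m - 1 ∧ (q.2 : ℕ) = 0 ∧
      ((Mc = true ∧ ((p.1 = 1 ∧ q.1 = 2) ∨ (p.1 = 3 ∧ q.1 = 0))) ∨
        (Mc = false ∧ ((p.1 = 1 ∧ q.1 = 0) ∨ (p.1 = 3 ∧ q.1 = 2))))) ∨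
    -- the matching M, even m
    (m % 2 = 0 ∧ (p.2 : ℕ) = m - 1 ∧ (q.2 : ℕ) = 0 ∧
      ((Mc = true ∧ ((p.1 = 2 ∧ q.1 = 2) ∨ (p.1 = 0 ∧ q.1 = 0))) ∨
        (Mc = false ∧ ((p.1 = 2 ∧ q.1 = 0) ∨ (p.1 = 0 ∧ q.1 = 2)))))

set_option linter.unusedSectionVars false
set_option linter.unusedSimpArgs false
set_option linter.unusedVariables false
set_option linter.flexible false
section QSec
open Classical

/-- four-cycle -/
def Quad4 {V : Type*} (G : SimpleGraph V) (a b c d : V) : Prop :=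
  G.Adj a b ∧ G.Adj b c ∧ G.Adj c d ∧ G.Adj d a ∧ a ≠ c ∧ b ≠ d

/-- quadrangle structure -/
structure QS {V : Type*} (G : SimpleGraph V) where
  s : V → V
  u : V → V
  s4 : ∀ v, s (s (s (s v))) = v
  u2 : ∀ v, u (u v) = v
  adj : ∀ v w, G.Adj v w ↔ w = s v ∨ w = s (s (s v)) ∨ w = u v
  s2 : ∀ v, s (s v) ≠ v
  us0 : ∀ v, u v ≠ v
  us1 : ∀ v, u v ≠ s v
  us2 : ∀ v, u v ≠ s (s v)
  us3 : ∀ v, u v ≠ s (s (s v))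
  nq1 : ∀ v, u (s v) ≠ s (u v)
  nq3 : ∀ v, u (s v) ≠ s (s (s (u v)))
  aut : ∀ x y, ∃ f : V ≃ V, f x = y ∧ (∀ v, f (u v) = u (f v)) ∧
    ∀ v, f (s v) = s (f v) ∨ f (s v) = s (s (s (f v)))

namespace QS
variable {V : Type*} [Fintype V] {G : SimpleGraph V} (Q : QS G)

theorem s_inj {a b : V} (h : Q.s a = Q.s b) : a = b := by
  rw [← Q.s4 a, ← Q.s4 b, h]

theorem u_inj {a b : V} (h : Q.u a = Q.u b) : a = b := by
  rw [← Q.u2 a, ← Q.u2 b, h]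

theorem s1 (v : V) : Q.s v ≠ v := by
  have := (Q.adj v (Q.s v)).2 (Or.inl rfl)
  exact this.ne'

theorem s3 (v : V) : Q.s (Q.s (Q.s v)) ≠ v := by
  have := (Q.adj v (Q.s (Q.s (Q.s v)))).2 (Or.inr (Or.inl rfl))
  exact this.ne'

/-- the quad through a vertex -/
noncomputable def C (v : V) : Finset V := {v, Q.s v, Q.s (Q.s v), Q.s (Q.s (Q.s v))}

theorem mem_C {v w : V} : w ∈ Q.C v ↔
    w = v ∨ w = Q.s v ∨ w = Q.s (Q.s v) ∨ w = Q.s (Q.s (Q.s v)) := by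
  simp [C]

theorem C_self (v : V) : v ∈ Q.C v := by simp [C]

theorem C_s (v : V) : Q.C (Q.s v) = Q.C v := by
  ext w; simp only [mem_C, Q.s4]; tauto

theorem C_eq {v w : V} (h : w ∈ Q.C v) : Q.C w = Q.C v := by
  rcases Q.mem_C.1 h with h | h | h | h <;> subst h <;> simp [C_s]

theorem C_card (v : V) : (Q.C v).card = 4 := by
  have h1 := Q.s1
  have h2 := Q.s2
  have h3 := Q.s3
  rw [C, Finset.card_eq_succ]
  refine ⟨v, {Q.s v, Q.s (Q.s v), Q.s (Q.s (Q.s v))}, ?_, rfl, ?_⟩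
  · simp [(h1 v).symm, (h2 v).symm, (h3 v).symm]
  · rw [Finset.card_eq_three]
    exact ⟨_, _, _, (h1 _).symm, (h2 _).symm, (h1 _).symm, rfl⟩

theorem u_not_C (v : V) : Q.u v ∉ Q.C v := by
  rw [mem_C]
  have := Q.us0 v; have := Q.us1 v; have := Q.us2 v; have := Q.us3 v
  tauto

theorem u_not_C' {v w : V} (h : w ∈ Q.C v) : Q.u w ∉ Q.C v := by
  rw [← Q.C_eq h]; exact Q.u_not_C w

/-- number of ordered adjacent pairs -/
noncomputable def ee (G : SimpleGraph V) (A B : Finset V) : ℕ :=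
  ∑ v, ∑ w, if v ∈ A ∧ w ∈ B ∧ G.Adj v w then 1 else 0

/-- size of edge boundary -/
noncomputable def dd (G : SimpleGraph V) (S : Finset V) : ℕ := ee G S Sᶜ

theorem ee_comm (A B : Finset V) : ee G A B = ee G B A := by
  unfold ee
  rw [Finset.sum_comm]
  refine Finset.sum_congr rfl fun v _ => Finset.sum_congr rfl fun w _ => ?_
  have := G.adj_comm v w
  congr 1
  simp only [this, eq_iff_iff]; tauto

theorem dd_compl (S : Finset V) : dd G Sᶜ = dd G S := by
  unfold dd; rw [compl_compl, ee_comm]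

theorem dd_submod (X Y : Finset V) :
    dd G (X ∩ Y) + dd G (X ∪ Y) ≤ dd G X + dd G Y := by
  unfold dd ee
  simp only [← Finset.sum_add_distrib]
  refine Finset.sum_le_sum fun v _ => Finset.sum_le_sum fun w _ => ?_
  simp only [Finset.mem_inter, Finset.mem_union, Finset.mem_compl]
  by_cases v ∈ X <;> by_cases v ∈ Y <;> by_cases w ∈ X <;> by_cases w ∈ Y <;>
    by_cases G.Adj v w <;> simp [*]

theorem dd_diff (X Y : Finset V) :
    dd G (X \ Y) + dd G (Y \ X) ≤ dd G X + dd G Y := by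
  have h := dd_submod (G := G) X Yᶜ
  rw [dd_compl] at h
  have e1 : X ∩ Yᶜ = X \ Y := by ext; simp
  have e2 : X ∪ Yᶜ = (Y \ X)ᶜ := by ext; simp; tauto
  rw [e1, e2, dd_compl] at h
  exact h

theorem dd_union (A B : Finset V) (h : Disjoint A B) :
    dd G (A ∪ B) + 2 * ee G A B = dd G A + dd G B := by
  have : 2 * ee G A B = ee G A B + ee G B A := by rw [ee_comm B A]; ring
  rw [this]
  unfold dd ee
  simp only [← Finset.sum_add_distrib]
  refine Finset.sum_congr rfl fun v _ => Finset.sum_congr rfl fun w _ => ?_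
  have hv : v ∈ A → v ∉ B := fun h1 h2 => Finset.disjoint_left.1 h h1 h2
  have hw : w ∈ A → w ∉ B := fun h1 h2 => Finset.disjoint_left.1 h h1 h2
  simp only [Finset.mem_union, Finset.mem_compl]
  by_cases v ∈ A <;> by_cases v ∈ B <;> by_cases w ∈ A <;> by_cases w ∈ B <;>
    by_cases G.Adj v w <;> simp_all

/-- indicator -/
noncomputable def ind (p : Prop) : ℕ := if p then 1 else 0

theorem ind_t {p : Prop} (h : p) : ind p = 1 := if_pos h
theorem ind_f {p : Prop} (h : ¬ p) : ind p = 0 := if_neg h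

/-- number of neighbours in `B` -/
noncomputable def nb (B : Finset V) (v : V) : ℕ :=
  ind (Q.s v ∈ B) + ind (Q.s (Q.s (Q.s v)) ∈ B) + ind (Q.u v ∈ B)

theorem ee_eq (A B : Finset V) : ee G A B = ∑ v ∈ A, Q.nb B v := by
  unfold ee
  rw [← Finset.sum_filter_add_sum_filter_not Finset.univ (fun v => v ∈ A)]
  have : ∑ v with v ∉ A, (∑ w, if v ∈ A ∧ w ∈ B ∧ G.Adj v w then 1 else 0) = 0 := by
    refine Finset.sum_eq_zero fun v hv => ?_
    simp at hv
    simp [hv]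
  rw [this, add_zero, Finset.filter_univ_mem]
  refine Finset.sum_congr rfl fun v hv => ?_
  have h1 : Q.s v ≠ Q.s (Q.s (Q.s v)) := (Q.s2 _).symm
  have h2 := Q.us1 v
  have h3 := Q.us3 v
  have : ∀ w, (if v ∈ A ∧ w ∈ B ∧ G.Adj v w then 1 else 0) =
     (if w = Q.s v then ind (w ∈ B) else 0) + (if w = Q.s (Q.s (Q.s v)) then ind (w ∈ B) else 0)
      + (if w = Q.u v then ind (w ∈ B) else 0) := by
    intro w
    rw [Q.adj]
    by_cases hw : w ∈ B
    · rw [ind_t hw]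
      by_cases a1 : w = Q.s v
      · subst a1; simp [hv, hw, h1, h2.symm]
      · by_cases a2 : w = Q.s (Q.s (Q.s v))
        · subst a2; simp [hv, hw, h1.symm, h3.symm]
        · simp [hv, hw, a1, a2]
    · simp [ind, hw]
  simp only [this, Finset.sum_add_distrib, Finset.sum_ite_eq', Finset.sum_ite_eq, Finset.mem_univ,
    if_true]
  rfl

theorem dd_eq (S : Finset V) : dd G S = ∑ v ∈ S, Q.nb Sᶜ v := Q.ee_eq _ _

/-- union of quads -/
def Sat (S : Finset V) : Prop := ∀ v ∈ S, Q.s v ∈ S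

theorem Sat.C_sub {Q : QS G} {S : Finset V} (h : Q.Sat S) {v : V} (hv : v ∈ S) : Q.C v ⊆ S := by
  intro w hw
  rcases Q.mem_C.1 hw with h' | h' | h' | h' <;> subst h'
  exacts [hv, h _ hv, h _ (h _ hv), h _ (h _ (h _ hv))]

theorem Sat.iff {Q : QS G} {S : Finset V} (h : Q.Sat S) {v : V} : Q.s v ∈ S ↔ v ∈ S := by
  refine ⟨fun h' => ?_, h v⟩
  rw [← Q.s4 v]; exact h _ (h _ (h _ h'))

theorem Sat.compl {Q : QS G} {S : Finset V} (h : Q.Sat S) : Q.Sat Sᶜ := by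
  intro v hv; simp only [Finset.mem_compl, h.iff] at *; exact hv

theorem Sat.inter {Q : QS G} {S T : Finset V} (h : Q.Sat S) (h' : Q.Sat T) : Q.Sat (S ∩ T) := by
  intro v hv; simp only [Finset.mem_inter] at *; exact ⟨h _ hv.1, h' _ hv.2⟩

theorem Sat.union {Q : QS G} {S T : Finset V} (h : Q.Sat S) (h' : Q.Sat T) : Q.Sat (S ∪ T) := by
  intro v hv; simp only [Finset.mem_union] at *
  exact hv.imp (h _) (h' _)

theorem Sat.sdiff {Q : QS G} {S T : Finset V} (h : Q.Sat S) (h' : Q.Sat T) : Q.Sat (S \ T) := by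
  rw [Finset.sdiff_eq_inter_compl]; exact h.inter h'.compl

theorem Sat_C (v : V) : Q.Sat (Q.C v) := by
  intro w hw
  rw [← Q.C_eq hw, ← Q.C_s]; exact Q.C_self _

theorem Sat.card_ge {Q : QS G} {S : Finset V} (h : Q.Sat S) (hn : S.Nonempty) : 4 ≤ S.card := by
  obtain ⟨v, hv⟩ := hn
  rw [← Q.C_card v]; exact Finset.card_le_card (h.C_sub hv)

theorem Sat.quad {Q : QS G} {S : Finset V} (h : Q.Sat S) (hn : S.Nonempty) (hc : S.card < 8) :
    ∃ v ∈ S, S = Q.C v := by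
  obtain ⟨v, hv⟩ := hn
  refine ⟨v, hv, ?_⟩
  by_contra hne
  have hsub := h.C_sub hv
  have hd := h.sdiff (Q.Sat_C v)
  have hne2 : (S \ Q.C v).Nonempty := by
    rw [Finset.sdiff_nonempty]; intro h'; exact hne (Finset.Subset.antisymm h' hsub)
  have := hd.card_ge hne2
  have h3 := Finset.card_sdiff_add_card_eq_card hsub
  rw [C_card] at h3
  omega

theorem dd_C (v : V) : dd G (Q.C v) = 4 := by
  rw [Q.dd_eq, ← Q.C_card v, Finset.card_eq_sum_ones]
  refine Finset.sum_congr rfl fun w hw => ?_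
  have h1 : Q.s w ∈ Q.C v := Q.Sat_C v _ hw
  have h2 : Q.s (Q.s (Q.s w)) ∈ Q.C v := Q.Sat_C v _ (Q.Sat_C v _ h1)
  have h3 := Q.u_not_C' hw
  simp [nb, ind, h1, h2, h3]

/-- automorphisms of the structure -/
def IsA (f : V ≃ V) : Prop := (∀ v, f (Q.u v) = Q.u (f v)) ∧
    ∀ v, f (Q.s v) = Q.s (f v) ∨ f (Q.s v) = Q.s (Q.s (Q.s (f v)))

theorem IsA.ss {Q : QS G} {f : V ≃ V} (h : Q.IsA f) (v : V) :
    f (Q.s (Q.s v)) = Q.s (Q.s (f v)) := by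
  have h0 : f (Q.s (Q.s v)) ≠ f v := fun h' => Q.s2 v (f.injective h')
  rcases h.2 (Q.s v) with h1 | h1 <;> rcases h.2 v with h2 | h2 <;> rw [h2] at h1 <;>
    rw [h1] at h0 ⊢ <;> simp only [Q.s4] at h0 ⊢ <;> simp at h0

theorem IsA.nb_map {Q : QS G} {f : V ≃ V} (h : Q.IsA f) (B : Finset V) (v : V) :
    Q.nb (B.map f.toEmbedding) (f v) = Q.nb B v := by
  have key : ∀ w, f w ∈ B.map f.toEmbedding ↔ w ∈ B := by simp
  have h1 : f (Q.s (Q.s (Q.s v))) = Q.s (Q.s (f (Q.s v))) := h.ss _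
  unfold nb
  rw [← h.1, ← key (Q.s v), ← key (Q.u v), ← key (Q.s (Q.s (Q.s v))), h1]
  rcases h.2 v with h2 | h2 <;> rw [h2]
  rw [Q.s4]; ring

theorem IsA.dd_map {Q : QS G} {f : V ≃ V} (h : Q.IsA f) (S : Finset V) :
    dd G (S.map f.toEmbedding) = dd G S := by
  rw [Q.dd_eq, Q.dd_eq, Finset.sum_map]
  refine Finset.sum_congr rfl fun v _ => ?_
  have : (S.map f.toEmbedding)ᶜ = Sᶜ.map f.toEmbedding := by
    ext w; simp
  rw [this]; exact h.nb_map _ _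

theorem IsA.sat_map {Q : QS G} {f : V ≃ V} (h : Q.IsA f) {S : Finset V} (hS : Q.Sat S) :
    Q.Sat (S.map f.toEmbedding) := by
  intro v hv
  obtain ⟨w, hw, rfl⟩ := Finset.mem_map.1 hv
  simp only [Equiv.toEmbedding_apply] at *
  rcases h.2 w with h1 | h1
  · rw [← h1]; simpa using hS _ hw
  · have : Q.s (f w) = f (Q.s (Q.s (Q.s w))) := by
      rw [h.ss, h1, Q.s4]
    rw [this]; simpa using hS _ (hS _ (hS _ hw))

/-- Blocks. -/
theorem block {X : Finset V} (hb : ∀ f : V ≃ V, Q.IsA f → (X ∩ X.map f.toEmbedding).Nonempty →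
    X.map f.toEmbedding = X) : X.card ∣ dd G X := by
  rcases X.eq_empty_or_nonempty with rfl | ⟨x, hx⟩
  · simp [dd, ee]
  · rw [Q.dd_eq]
    rw [Finset.sum_congr rfl (g := fun _ => Q.nb Xᶜ x), Finset.sum_const]
    · exact ⟨_, rfl⟩
    · intro y hy
      obtain ⟨f, hf, h1, h2⟩ := Q.aut x y
      have hA : Q.IsA f := ⟨h1, h2⟩
      have hm := hb f hA ⟨y, by simp only [Finset.mem_inter, Finset.mem_map]; exact ⟨hy, x, hx, hf⟩⟩
      have := hA.nb_map Xᶜ x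
      have h3 : Xᶜ.map f.toEmbedding = Xᶜ := by
        conv_rhs => rw [← hm]
        ext w; simp
      rw [h3, hf] at this
      exact this

theorem dd_pos (hconn : G.Connected) {S : Finset V} (h1 : S.Nonempty) (h2 : Sᶜ.Nonempty) :
    dd G S ≠ 0 := by
  intro h0
  obtain ⟨a, ha⟩ := h1
  obtain ⟨b, hb⟩ := h2
  have key : ∀ v w, v ∈ S → G.Adj v w → w ∈ S := by
    intro v w hv hvw
    by_contra hw
    have h3 := (Finset.sum_eq_zero_iff.1 h0) v (Finset.mem_univ _)
    have h4 := (Finset.sum_eq_zero_iff.1 h3) w (Finset.mem_univ _)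
    simp [hv, hw, hvw] at h4
  obtain ⟨p⟩ := hconn.preconnected a b
  have : b ∈ S := by
    induction p with
    | nil => exact ha
    | cons h p ih => exact ih (key _ _ ha h) hb
  simp at hb; exact hb this

/-- Lemma A -/
theorem lemA (hconn : G.Connected) {R : Finset V} (hR : Q.Sat R) (h1 : R.Nonempty)
    (h2 : Rᶜ.Nonempty) : 4 ≤ dd G R := by
  by_contra hlt
  let P : Finset (Finset V) := Finset.univ.filter fun X => Q.Sat X ∧ X.Nonempty ∧ Xᶜ.Nonempty
  have hP : P.Nonempty := ⟨R, by simp only [P, Finset.mem_filter]; exact ⟨Finset.mem_univ _, hR, h1, h2⟩⟩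
  obtain ⟨X, hX, hmin⟩ := P.exists_min_image
    (fun X => toLex (dd G X, X.card)) hP
  simp only [P, Finset.mem_filter, Finset.mem_univ, true_and] at hX hmin
  obtain ⟨hS, hn, hc⟩ := hX
  have hmin' : ∀ Y, Q.Sat Y → Y.Nonempty → Yᶜ.Nonempty →
      dd G X < dd G Y ∨ (dd G X = dd G Y ∧ X.card ≤ Y.card) := by
    intro Y a b c
    have := hmin Y ⟨a, b, c⟩
    rw [Prod.Lex.toLex_le_toLex] at this
    exact this
  have hX3 : dd G X < 4 := by
    rcases hmin' R hR h1 h2 with h | h <;> omega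
  have hle : X.card ≤ Xᶜ.card := by
    rcases hmin' Xᶜ hS.compl hc (by simpa using hn) with h | h
    · rw [dd_compl] at h; omega
    · exact h.2
  have hdiv : X.card ∣ dd G X := by
    apply Q.block
    intro f hf hne
    by_contra hXY
    set Y := X.map f.toEmbedding with hY
    have hYc : Y.card = X.card := by simp [Y]
    have hYd : dd G Y = dd G X := hf.dd_map X
    have hYS : Q.Sat Y := hf.sat_map hS
    have hlt2 : (X ∩ Y).card < X.card := by
      apply Finset.card_lt_card
      rw [Finset.ssubset_iff_subset_ne]
      refine ⟨Finset.inter_subset_left, fun h => hXY ?_⟩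
      exact (Finset.eq_of_subset_of_card_le (Finset.inter_eq_left.1 h) hYc.le).symm
    have hcu := Finset.card_union_add_card_inter X Y
    have hpos := hne.card_pos
    have hcc := Finset.card_add_card_compl X
    have hun : (X ∪ Y)ᶜ.Nonempty := by
      rw [← Finset.card_pos]
      have := Finset.card_add_card_compl (X ∪ Y)
      omega
    have hin : (X ∩ Y)ᶜ.Nonempty := by
      refine hun.mono ?_
      intro w; simp; tauto
    have a1 := hmin' _ (hS.inter hYS) hne hin
    have a2 := hmin' _ (hS.union hYS) (hn.mono Finset.subset_union_left) hun
    have a3 := dd_submod (G := G) X Y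
    omega
  have h4 := hS.card_ge hn
  have h0 := dd_pos hconn hn hc
  have := Nat.le_of_dvd (Nat.pos_of_ne_zero h0) hdiv
  omega

/-- Lemma C -/
theorem lemC (hconn : G.Connected) {R : Finset V} (hR : Q.Sat R) (h1 : 8 ≤ R.card)
    (h2 : 8 ≤ Rᶜ.card) (hd : dd G R = 4) :
    ∃ a b, b ∉ Q.C a ∧ ee G (Q.C a) (Q.C b) = 2 := by
  let P : Finset (Finset V) := Finset.univ.filter fun X =>
    Q.Sat X ∧ 8 ≤ X.card ∧ 8 ≤ Xᶜ.card ∧ dd G X = 4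
  have hP : P.Nonempty := ⟨R, by
    simp only [P, Finset.mem_filter]; exact ⟨Finset.mem_univ _, hR, h1, h2, hd⟩⟩
  obtain ⟨X, hX, hmin⟩ := P.exists_min_image Finset.card hP
  simp only [P, Finset.mem_filter, Finset.mem_univ, true_and] at hX hmin
  obtain ⟨hS, hX8, hXc8, hX4⟩ := hX
  have hn : X.Nonempty := by rw [← Finset.card_pos]; omega
  have hle : X.card ≤ Xᶜ.card := hmin Xᶜ ⟨hS.compl, hXc8, by rwa [compl_compl], by rwa [dd_compl]⟩
  have hex : ¬ ∀ f : V ≃ V, Q.IsA f → (X ∩ X.map f.toEmbedding).Nonempty →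
      X.map f.toEmbedding = X := by
    intro h
    have := Q.block h
    have := Nat.le_of_dvd (by omega) this
    omega
  push Not at hex
  obtain ⟨f, hf, hne, hXY⟩ := hex
  set Y := X.map f.toEmbedding with hY
  have hYc : Y.card = X.card := by simp [Y]
  have hYd : dd G Y = dd G X := hf.dd_map X
  have hYS : Q.Sat Y := hf.sat_map hS
  have hlt2 : (X ∩ Y).card < X.card := by
    apply Finset.card_lt_card
    rw [Finset.ssubset_iff_subset_ne]
    refine ⟨Finset.inter_subset_left, fun h => hXY ?_⟩
    exact (Finset.eq_of_subset_of_card_le (Finset.inter_eq_left.1 h) hYc.le).symm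
  have hcu := Finset.card_union_add_card_inter X Y
  have hpos := hne.card_pos
  have hcc := Finset.card_add_card_compl X
  have hun : (X ∪ Y)ᶜ.Nonempty := by
    rw [← Finset.card_pos]
    have := Finset.card_add_card_compl (X ∪ Y)
    omega
  have hin : (X ∩ Y)ᶜ.Nonempty := by
    refine hun.mono ?_
    intro w; simp; tauto
  have s1 := Finset.card_sdiff_add_card_inter X Y
  have s2 := Finset.card_sdiff_add_card_inter Y X
  rw [Finset.inter_comm Y X] at s2
  have n1 : (X \ Y).Nonempty := by rw [← Finset.card_pos]; omega
  have n2 : (Y \ X).Nonempty := by rw [← Finset.card_pos]; omega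
  have n3 : (X \ Y)ᶜ.Nonempty := by
    refine n2.mono ?_
    intro w; simp; tauto
  have n4 : (Y \ X)ᶜ.Nonempty := by
    refine n1.mono ?_
    intro w; simp; tauto
  have a1 := Q.lemA hconn (hS.inter hYS) hne hin
  have a2 := Q.lemA hconn (hS.union hYS) (hn.mono Finset.subset_union_left) hun
  have a3 := dd_submod (G := G) X Y
  have b1 := Q.lemA hconn (hS.sdiff hYS) n1 n3
  have b2 := Q.lemA hconn (hYS.sdiff hS) n2 n4
  have b3 := dd_diff (G := G) X Y
  have small : ∀ Z, Q.Sat Z → Z.Nonempty → Z ⊆ X → Z.card < X.card → dd G Z = 4 →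
      ∃ v ∈ Z, Z = Q.C v := by
    intro Z hZ hZn hZX hlt hZ4
    refine hZ.quad hZn ?_
    by_contra h8
    have hZc := Finset.card_add_card_compl Z
    have := hmin Z ⟨hZ, by omega, by omega, hZ4⟩
    omega
  obtain ⟨a, ha, hCa⟩ := small _ (hS.inter hYS) hne Finset.inter_subset_left hlt2 (by omega)
  obtain ⟨b, hb, hCb⟩ := small _ (hS.sdiff hYS) n1 Finset.sdiff_subset (by omega) (by omega)
  have hdis : Disjoint (X ∩ Y) (X \ Y) := by
    rw [Finset.disjoint_left]; intro w; simp; tauto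
  have hu := dd_union (G := G) _ _ hdis
  have he : X ∩ Y ∪ X \ Y = X := by ext w; simp; tauto
  rw [he] at hu
  refine ⟨a, b, ?_, ?_⟩
  · rw [← hCa]; exact fun h => Finset.disjoint_left.1 hdis h hb
  · rw [← hCa, ← hCb]; omega

end QS
end QSec
section QSec
open Classical
namespace QS
variable {V : Type*} [Fintype V] {G : SimpleGraph V} (Q : QS G)

theorem dd3 (z : V) : 5 ≤ dd G {z, Q.s z, Q.s (Q.s z)} := by
  have h1 := Q.s1
  have h2 := Q.s2
  have h3 := Q.s3
  have k : ∀ w ∈ Q.C z, Q.u w ≠ z ∧ Q.u w ≠ Q.s z ∧ Q.u w ≠ Q.s (Q.s z) := by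
    intro w hw
    have := Q.u_not_C' hw
    rw [mem_C] at this; tauto
  have k0 := k z (by simp [mem_C])
  have k1 := k (Q.s z) (by simp [mem_C])
  have k2 := k (Q.s (Q.s z)) (by simp [mem_C])
  rw [Q.dd_eq, Finset.sum_insert (by simp [(h1 z).symm, (h2 z).symm]),
    Finset.sum_insert (by simp [(h1 _).symm]), Finset.sum_singleton]
  simp [nb, ind, h1, h2, h3, Q.s4, k0, k1, k2]

theorem dd2 (z : V) : dd G {z, Q.s z} = 4 := by
  have h1 := Q.s1
  have h2 := Q.s2
  have h3 := Q.s3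
  have k : ∀ w ∈ Q.C z, Q.u w ≠ z ∧ Q.u w ≠ Q.s z ∧ Q.u w ≠ Q.s (Q.s z) := by
    intro w hw
    have := Q.u_not_C' hw
    rw [mem_C] at this; tauto
  have k0 := k z (by simp [mem_C])
  have k1 := k (Q.s z) (by simp [mem_C])
  rw [Q.dd_eq, Finset.sum_insert (by simp [(h1 z).symm, (h2 z).symm]), Finset.sum_singleton]
  simp [nb, ind, h1, h2, h3, Q.s4, k0, k1]

theorem ddo (z : V) : 5 ≤ dd G {z, Q.s (Q.s z)} := by
  have h1 := Q.s1
  have h2 := Q.s2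
  have h3 := Q.s3
  have k : ∀ w ∈ Q.C z, Q.u w ≠ z ∧ Q.u w ≠ Q.s z ∧ Q.u w ≠ Q.s (Q.s z) := by
    intro w hw
    have := Q.u_not_C' hw
    rw [mem_C] at this; tauto
  have k0 := k z (by simp [mem_C])
  have k2 := k (Q.s (Q.s z)) (by simp [mem_C])
  rw [Q.dd_eq, Finset.sum_insert (by simp [(h1 z).symm, (h2 z).symm]), Finset.sum_singleton]
  simp [nb, ind, h1, h2, h3, Q.s4, k0, k2, (h1 (Q.s z)).symm]

theorem round {S : Finset V} {v : V} (hv : v ∈ S) (hsv : Q.s v ∉ S) :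
    (dd G (S ∪ Q.C v) < dd G S ∨ dd G (S \ Q.C v) < dd G S) ∨
    (dd G (S ∪ Q.C v) ≤ dd G S ∧ dd G (S \ Q.C v) ≤ dd G S ∧
      ∃ z, S ∩ Q.C v = {z, Q.s z} ∧ Q.C v \ S = {Q.s (Q.s z), Q.s (Q.s (Q.s z))}) := by
  have a1 := dd_submod (G := G) S (Q.C v)
  have a2 := dd_diff (G := G) S (Q.C v)
  rw [dd_C] at a1 a2
  by_cases h2 : Q.s (Q.s v) ∈ S <;> by_cases h3 : Q.s (Q.s (Q.s v)) ∈ S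
  · have e : S ∩ Q.C v = {Q.s (Q.s v), Q.s (Q.s (Q.s v)), Q.s (Q.s (Q.s (Q.s v)))} := by
      ext w
      simp only [Finset.mem_inter, mem_C, Finset.mem_insert, Finset.mem_singleton, Q.s4]
      constructor
      · rintro ⟨h, rfl | rfl | rfl | rfl⟩ <;> simp_all
      · rintro (rfl | rfl | rfl) <;> simp_all
    rw [e] at a1
    have := Q.dd3 (Q.s (Q.s v))
    left; left; omega
  · have e : S ∩ Q.C v = {v, Q.s (Q.s v)} := by
      ext w
      simp only [Finset.mem_inter, mem_C, Finset.mem_insert, Finset.mem_singleton, Q.s4]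
      constructor
      · rintro ⟨h, rfl | rfl | rfl | rfl⟩ <;> simp_all
      · rintro (rfl | rfl) <;> simp_all
    rw [e] at a1
    have := Q.ddo v
    left; left; omega
  · have e : S ∩ Q.C v = {Q.s (Q.s (Q.s v)), Q.s (Q.s (Q.s (Q.s v)))} := by
      ext w
      simp only [Finset.mem_inter, mem_C, Finset.mem_insert, Finset.mem_singleton, Q.s4]
      constructor
      · rintro ⟨h, rfl | rfl | rfl | rfl⟩ <;> simp_all
      · rintro (rfl | rfl) <;> simp_all
    have e' : Q.C v \ S = {Q.s v, Q.s (Q.s v)} := by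
      ext w
      simp only [Finset.mem_sdiff, mem_C, Finset.mem_insert, Finset.mem_singleton, Q.s4]
      constructor
      · rintro ⟨rfl | rfl | rfl | rfl, h⟩ <;> simp_all
      · rintro (rfl | rfl) <;> simp_all
    have b1 := Q.dd2 (Q.s (Q.s (Q.s v)))
    have b2 := Q.dd2 (Q.s v)
    rw [← e] at b1
    rw [← e'] at b2
    right
    refine ⟨by omega, by omega, Q.s (Q.s (Q.s v)), e, ?_⟩
    rw [e']; simp only [Q.s4]
  · have e' : Q.C v \ S = {Q.s v, Q.s (Q.s v), Q.s (Q.s (Q.s v))} := by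
      ext w
      simp only [Finset.mem_sdiff, mem_C, Finset.mem_insert, Finset.mem_singleton, Q.s4]
      constructor
      · rintro ⟨rfl | rfl | rfl | rfl, h⟩ <;> simp_all
      · rintro (rfl | rfl | rfl) <;> simp_all
    rw [e'] at a2
    have := Q.dd3 (Q.s v)
    left; right; omega

/-- number of vertices in split quads -/
noncomputable def spl (S : Finset V) : ℕ :=
  (Finset.univ.filter fun v => (∃ a ∈ Q.C v, a ∈ S) ∧ ∃ b ∈ Q.C v, b ∉ S).card

theorem C_disj {v w : V} (h : w ∉ Q.C v) {a : V} (ha : a ∈ Q.C w) : a ∉ Q.C v := by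
  intro h'
  apply h
  rw [← Q.C_eq h', Q.C_eq ha]; exact Q.C_self w

theorem spl_union {S : Finset V} {v : V} (hv : v ∈ S) (hsv : Q.s v ∉ S) :
    Q.spl (S ∪ Q.C v) < Q.spl S := by
  apply Finset.card_lt_card
  rw [Finset.ssubset_iff_of_subset]
  · refine ⟨v, ?_, ?_⟩
    · simp only [Finset.mem_filter, Finset.mem_univ, true_and]
      exact ⟨⟨v, Q.C_self v, hv⟩, ⟨Q.s v, by simp [mem_C], hsv⟩⟩
    · simp only [Finset.mem_filter, Finset.mem_union]; tauto
  · intro w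
    simp only [Finset.mem_filter, Finset.mem_univ, true_and, Finset.mem_union]
    rintro ⟨⟨a, ha, ha'⟩, b, hb, hb'⟩
    push Not at hb'
    refine ⟨?_, b, hb, hb'.1⟩
    refine ⟨a, ha, ha'.resolve_right ?_⟩
    apply Q.C_disj _ ha
    intro h; exact hb'.2 (by rw [← Q.C_eq h]; exact hb)

theorem spl_sdiff {S : Finset V} {v : V} (hv : v ∈ S) (hsv : Q.s v ∉ S) :
    Q.spl (S \ Q.C v) < Q.spl S := by
  apply Finset.card_lt_card
  rw [Finset.ssubset_iff_of_subset]
  · refine ⟨v, ?_, ?_⟩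
    · simp only [Finset.mem_filter, Finset.mem_univ, true_and]
      exact ⟨⟨v, Q.C_self v, hv⟩, ⟨Q.s v, by simp [mem_C], hsv⟩⟩
    · simp; intros; exfalso; tauto
  · intro w
    simp only [Finset.mem_filter, Finset.mem_univ, true_and, Finset.mem_sdiff]
    rintro ⟨⟨a, ha, ha'⟩, b, hb, hb'⟩
    refine ⟨⟨a, ha, ha'.1⟩, b, hb, ?_⟩
    intro hbS
    refine hb' ⟨hbS, ?_⟩
    apply Q.C_disj _ hb
    intro h; exact ha'.2 (by rw [← Q.C_eq h]; exact ha)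

/-- contains a full quad -/
def Full (S : Finset V) : Prop := ∃ x, Q.C x ⊆ S

theorem full_union {S T : Finset V} (h : Q.Full S) : Q.Full (S ∪ T) := by
  obtain ⟨x, hx⟩ := h
  exact ⟨x, hx.trans Finset.subset_union_left⟩

theorem full_sdiff {S : Finset V} (h : Q.Full S) {v : V} (hsv : ∃ b ∈ Q.C v, b ∉ S) :
    Q.Full (S \ Q.C v) := by
  obtain ⟨x, hx⟩ := h
  obtain ⟨b, hb, hb'⟩ := hsv
  refine ⟨x, fun a ha => Finset.mem_sdiff.2 ⟨hx ha, Q.C_disj ?_ ha⟩⟩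
  intro h
  apply hb'; apply hx; rw [Q.C_eq h]; exact hb

theorem compl_union_C (S : Finset V) (v : V) : (S ∪ Q.C v)ᶜ = Sᶜ \ Q.C v := by
  ext; simp
theorem compl_sdiff_C (S : Finset V) (v : V) : (S \ Q.C v)ᶜ = Sᶜ ∪ Q.C v := by
  ext; simp; tauto

theorem lemB (hconn : G.Connected) : ∀ (n : ℕ) (S : Finset V), Q.spl S = n → Q.Full S →
    Q.Full Sᶜ → 4 ≤ dd G S := by
  intro n
  induction n using Nat.strong_induction_on with
  | _ n ih =>
    intro S hn h1 h2
    by_cases hS : Q.Sat S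
    · obtain ⟨x, hx⟩ := h1
      obtain ⟨y, hy⟩ := h2
      exact Q.lemA hconn hS ⟨x, hx (Q.C_self x)⟩ ⟨y, hy (Q.C_self y)⟩
    · simp only [Sat] at hS
      push Not at hS
      obtain ⟨v, hv, hsv⟩ := hS
      have hs : Q.s v ∈ Q.C v := by simp [mem_C]
      have u1 := ih _ (hn ▸ Q.spl_union hv hsv) _ rfl (Q.full_union h1) (by
        rw [compl_union_C]; exact Q.full_sdiff h2 ⟨v, Q.C_self v, by simpa using hv⟩)
      have u2 := ih _ (hn ▸ Q.spl_sdiff hv hsv) _ rfl (Q.full_sdiff h1 ⟨_, hs, hsv⟩) (by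
        rw [compl_sdiff_C]; exact Q.full_union h2)
      rcases Q.round hv hsv with h | h <;> omega

theorem all_or {z : V} {A : Finset V} (h : ee G {z, Q.s z} A = 2) (hd : Disjoint (Q.C z) A) :
    Q.u z ∈ A ∧ Q.u (Q.s z) ∈ A := by
  have hC : ∀ w ∈ Q.C z, w ∉ A := fun w hw => Finset.disjoint_left.1 hd hw
  have h0 := hC z (by simp [mem_C])
  have h1 := hC (Q.s z) (by simp [mem_C])
  have h2 := hC (Q.s (Q.s z)) (by simp [mem_C])
  have h3 := hC (Q.s (Q.s (Q.s z))) (by simp [mem_C])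
  rw [Q.ee_eq, Finset.sum_insert (by simp [(Q.s1 z).symm]), Finset.sum_singleton] at h
  simp only [nb, ind, Q.s4, h0, h1, h2, h3] at h
  by_cases a : Q.u z ∈ A <;> by_cases b : Q.u (Q.s z) ∈ A <;> simp [a, b] at h ⊢

set_option maxHeartbeats 1000000 in
theorem lemD (hconn : G.Connected) : ∀ (n : ℕ) (S : Finset V), Q.spl S = n → Q.Full S →
    Q.Full Sᶜ → dd G S = 4 → (∃ x, S = Q.C x) ∨ (∃ x, Sᶜ = Q.C x) ∨
    ∃ a b, b ∉ Q.C a ∧ ee G (Q.C a) (Q.C b) = 2 := by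
  intro n
  induction n using Nat.strong_induction_on with
  | _ n ih =>
    intro S hn h1 h2 h4
    by_cases hS : Q.Sat S
    · obtain ⟨x, hx⟩ := h1
      obtain ⟨y, hy⟩ := h2
      by_cases c1 : S.card < 8
      · obtain ⟨v, -, hv⟩ := hS.quad ⟨x, hx (Q.C_self x)⟩ c1
        exact Or.inl ⟨v, hv⟩
      by_cases c2 : Sᶜ.card < 8
      · obtain ⟨v, -, hv⟩ := hS.compl.quad ⟨y, hy (Q.C_self y)⟩ c2
        exact Or.inr (Or.inl ⟨v, hv⟩)
      exact Or.inr (Or.inr (Q.lemC hconn hS (by omega) (by omega) h4))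
    · simp only [Sat] at hS
      push Not at hS
      obtain ⟨v, hv, hsv⟩ := hS
      have hs : Q.s v ∈ Q.C v := by simp [mem_C]
      have f1 : Q.Full (S ∪ Q.C v) := Q.full_union h1
      have f2 : Q.Full (S ∪ Q.C v)ᶜ := by
        rw [compl_union_C]; exact Q.full_sdiff h2 ⟨v, Q.C_self v, by simpa using hv⟩
      have f3 : Q.Full (S \ Q.C v) := Q.full_sdiff h1 ⟨_, hs, hsv⟩
      have f4 : Q.Full (S \ Q.C v)ᶜ := by
        rw [compl_sdiff_C]; exact Q.full_union h2
      have b1 := Q.lemB hconn _ _ rfl f1 f2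
      have b2 := Q.lemB hconn _ _ rfl f3 f4
      rcases Q.round hv hsv with h | ⟨r1, r2, z, hz, hz'⟩
      · omega
      have hzC : z ∈ Q.C v := by
        have : z ∈ S ∩ Q.C v := by rw [hz]; simp
        exact (Finset.mem_inter.1 this).2
      have hCz := Q.C_eq hzC
      rcases ih _ (hn ▸ Q.spl_union hv hsv) _ rfl f1 f2 (by omega) with ⟨x, hx⟩ | ⟨B, hB⟩ | h
      · exfalso
        obtain ⟨y, hy⟩ := f3
        have hd : ∀ w ∈ Q.C x, w ∉ Q.C v := by
          have hyx : y ∈ Q.C x := by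
            rw [← hx]; exact Finset.mem_union_left _ (Finset.mem_sdiff.1 (hy (Q.C_self y))).1
          intro w hw
          rw [← Q.C_eq hyx] at hw
          exact (Finset.mem_sdiff.1 (hy hw)).2
        exact hd v (by rw [← hx]; exact Finset.mem_union_left _ hv) (Q.C_self v)
      · rcases ih _ (hn ▸ Q.spl_sdiff hv hsv) _ rfl f3 f4 (by omega) with ⟨A, hA⟩ | ⟨x, hx⟩ | h
        · right; right
          have d1 : Disjoint (Q.C v) (S \ Q.C v) := by
            rw [Finset.disjoint_left]; intro w; simp; tauto
          have d2 : Disjoint (Q.C v) (Sᶜ \ Q.C v) := by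
            rw [Finset.disjoint_left]; intro w; simp; tauto
          have d1' : Disjoint (S ∩ Q.C v) (S \ Q.C v) := by
            rw [Finset.disjoint_left]; intro w; simp; tauto
          have d2' : Disjoint (Q.C v \ S) (Sᶜ \ Q.C v) := by
            rw [Finset.disjoint_left]; intro w; simp; tauto
          have e1 := dd_union (G := G) _ _ d1'
          have e2 := dd_union (G := G) _ _ d2'
          have t1 : S ∩ Q.C v ∪ S \ Q.C v = S := by ext; simp; tauto
          have t2 : Q.C v \ S ∪ Sᶜ \ Q.C v = Sᶜ := by ext; simp; tauto
          rw [compl_union_C] at hB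
          rw [t1, hz, Q.dd2, h4, hA, Q.dd_C] at e1
          rw [t2, hz', Q.dd2 (Q.s (Q.s z)), dd_compl, h4, hB, Q.dd_C] at e2
          rw [hA, ← hCz] at d1
          rw [hB, ← hCz] at d2
          have hd2 : Disjoint (Q.C (Q.s (Q.s z))) (Q.C B) := by rw [C_s, C_s]; exact d2
          have g1 := Q.all_or (by omega) d1
          have g2 := Q.all_or (by omega) hd2
          refine ⟨z, A, ?_, ?_⟩
          · intro h; exact Finset.disjoint_left.1 d1 h (Q.C_self A)
          · have hAB : ∀ w ∈ Q.C B, w ∉ Q.C A := by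
              intro w hw hw'
              rw [← hA] at hw'; rw [← hB] at hw
              simp only [Finset.mem_sdiff, Finset.mem_compl] at hw hw'
              tauto
            have hC : ∀ w ∈ Q.C z, w ∉ Q.C A := fun w hw => Finset.disjoint_left.1 d1 hw
            have h0 := hC z (by simp [mem_C])
            have h1 := hC (Q.s z) (by simp [mem_C])
            have h2 := hC (Q.s (Q.s z)) (by simp [mem_C])
            have h3 := hC (Q.s (Q.s (Q.s z))) (by simp [mem_C])
            have k1 := hAB _ g2.1
            have k2 := hAB _ g2.2
            rw [Q.ee_eq]
            conv_lhs => rw [C]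
            rw [Finset.sum_insert (by simp [(Q.s1 _).symm, (Q.s2 _).symm, (Q.s3 _).symm]),
              Finset.sum_insert (by simp [(Q.s1 _).symm, (Q.s2 _).symm, (Q.s3 _).symm]),
              Finset.sum_insert (by simp [(Q.s1 _).symm, (Q.s2 _).symm, (Q.s3 _).symm]),
              Finset.sum_singleton]
            simp [nb, ind, Q.s4, h0, h1, h2, h3, k1, k2, g1]
        · exfalso
          obtain ⟨y, hy⟩ := f2
          rw [compl_union_C] at hy
          rw [compl_sdiff_C] at hx
          have hyx : y ∈ Q.C x := by
            rw [← hx]; exact Finset.mem_union_left _ (Finset.mem_sdiff.1 (hy (Q.C_self y))).1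
          have : v ∈ Q.C x := by rw [← hx]; exact Finset.mem_union_right _ (Q.C_self v)
          rw [← Q.C_eq hyx] at this
          exact (Finset.mem_sdiff.1 (hy this)).2 (Q.C_self v)
        · exact Or.inr (Or.inr h)
      · exact Or.inr (Or.inr h)

end QS
end QSec
section QSec
open Classical
namespace QS
variable {V : Type*} [Fintype V] {G : SimpleGraph V} (Q : QS G)

theorem dd_three (S : Finset V) : dd G S = (S.filter fun v => Q.s v ∉ S).card +
    (S.filter fun v => Q.s (Q.s (Q.s v)) ∉ S).card + (S.filter fun v => Q.u v ∉ S).card := by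
  rw [Q.dd_eq]
  simp only [nb, ind, Finset.sum_add_distrib, Finset.card_filter, Finset.mem_compl]

theorem run_end {S : Finset V} (hf : ¬ Q.Full S) {x : V} (hx : x ∈ S) :
    (∃ a ∈ Q.C x, a ∈ S ∧ Q.s a ∉ S) ∧ (∃ b ∈ Q.C x, b ∈ S ∧ Q.s (Q.s (Q.s b)) ∉ S) := by
  have h : ¬ Q.C x ⊆ S := fun h => hf ⟨x, h⟩
  by_cases h1 : Q.s x ∈ S <;> by_cases h2 : Q.s (Q.s x) ∈ S <;>
    by_cases h3 : Q.s (Q.s (Q.s x)) ∈ S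
  all_goals simp only [mem_C, or_and_right, exists_or, exists_eq_left, Q.s4, hx, h1, h2, h3]
  all_goals simp
  apply h
  intro w hw
  rcases Q.mem_C.1 hw with rfl | rfl | rfl | rfl <;> assumption

theorem run_form {S : Finset V} {x b : V} (hb : b ∈ Q.C x) (hbS : b ∈ S)
    (hb3 : Q.s (Q.s (Q.s b)) ∉ S)
    (huniq : ∀ p ∈ Q.C x, ∀ q ∈ Q.C x, p ∈ S → q ∈ S → Q.s p ∉ S → Q.s q ∉ S → p = q) :
    (∀ y, y ∈ Q.C x → (y ∈ S ↔ y = b)) ∨ (∀ y, y ∈ Q.C x → (y ∈ S ↔ y = b ∨ y = Q.s b)) ∨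
    (∀ y, y ∈ Q.C x → (y ∈ S ↔ y = b ∨ y = Q.s b ∨ y = Q.s (Q.s b))) := by
  rw [← Q.C_eq hb] at huniq ⊢
  have n1 := Q.s1 b
  have n2 := Q.s2 b
  have n3 := Q.s3 b
  have n4 := Q.s1 (Q.s b)
  have n5 := Q.s1 (Q.s (Q.s b))
  have n6 := Q.s2 (Q.s b)
  by_cases h1 : Q.s b ∈ S <;> by_cases h2 : Q.s (Q.s b) ∈ S
  · right; right
    intro y hy
    rcases Q.mem_C.1 hy with rfl | rfl | rfl | rfl <;> simp_all
  · right; left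
    intro y hy
    rcases Q.mem_C.1 hy with rfl | rfl | rfl | rfl <;> simp_all
  · exfalso
    exact n2.symm (huniq b (Q.C_self b) (Q.s (Q.s b)) (by simp [mem_C]) hbS h2 h1 hb3)
  · left
    intro y hy
    rcases Q.mem_C.1 hy with rfl | rfl | rfl | rfl <;> simp_all

theorem lemE {S Z : Finset V} (hd : dd G S ≤ 4) (hZ : Z ⊆ S) (hn : Z.Nonempty)
    (hcore : ∀ z ∈ Z, ∃ a ∈ Z, ∃ b ∈ Z, a ≠ b ∧ G.Adj z a ∧ G.Adj z b) : Q.Full S := by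
  by_contra hf
  have hx : ∃ x ∈ Z, Q.u x ∈ Z := by
    by_contra h
    push Not at h
    have : Q.Sat Z := by
      intro z hz
      obtain ⟨a, ha, b, hb, hab, h1, h2⟩ := hcore z hz
      have := h z hz
      rw [Q.adj] at h1 h2
      grind
    obtain ⟨z, hz⟩ := hn
    exact hf ⟨z, (this.C_sub hz).trans hZ⟩
  obtain ⟨x, hxZ, huZ⟩ := hx
  have hxS := hZ hxZ
  have huS := hZ huZ
  obtain ⟨⟨a1, ha1, ha1S, ha1'⟩, ⟨b1, hb1, hb1S, hb1'⟩⟩ := Q.run_end hf hxS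
  obtain ⟨⟨a2, ha2, ha2S, ha2'⟩, ⟨b2, hb2, hb2S, hb2'⟩⟩ := Q.run_end hf huS
  have hdis : ∀ w, w ∈ Q.C (Q.u x) → w ∉ Q.C x := fun w hw => Q.C_disj (Q.u_not_C x) hw
  have h3 := Q.dd_three S
  have ea : ({a1, a2} : Finset V) ⊆ S.filter fun v => Q.s v ∉ S := by
    intro w; simp only [Finset.mem_insert, Finset.mem_singleton, Finset.mem_filter]
    rintro (rfl | rfl) <;> tauto
  have eb : ({b1, b2} : Finset V) ⊆ S.filter fun v => Q.s (Q.s (Q.s v)) ∉ S := by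
    intro w; simp only [Finset.mem_insert, Finset.mem_singleton, Finset.mem_filter]
    rintro (rfl | rfl) <;> tauto
  have hab : a1 ≠ a2 := fun h => hdis a2 ha2 (h ▸ ha1)
  have hbb : b1 ≠ b2 := fun h => hdis b2 hb2 (h ▸ hb1)
  have ca := Finset.card_le_card ea
  have cb := Finset.card_le_card eb
  have ca2 := Finset.card_pair hab
  have cb2 := Finset.card_pair hbb
  have Ea := Finset.eq_of_subset_of_card_le ea (by omega)
  have hg : (S.filter fun v => Q.u v ∉ S) = ∅ := by rw [← Finset.card_eq_zero]; omega
  have hu : ∀ y ∈ S, Q.u y ∈ S := by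
    intro y hy
    by_contra h
    have : y ∈ (S.filter fun v => Q.u v ∉ S) := by simp [hy, h]
    rw [hg] at this; simp at this
  have hal : ∀ y ∈ S, Q.s y ∉ S → y = a1 ∨ y = a2 := by
    intro y hy h
    have : y ∈ (S.filter fun v => Q.s v ∉ S) := by simp [hy, h]
    rw [← Ea] at this; simpa using this
  have hloc : ∀ y ∈ S, y ∈ Q.C x ∨ y ∈ Q.C (Q.u x) := by
    intro y hy
    obtain ⟨⟨a, ha, haS, ha'⟩, -⟩ := Q.run_end hf hy
    rw [← Q.C_eq ha1, ← Q.C_eq ha2]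
    rcases hal a haS ha' with rfl | rfl <;> rw [Q.C_eq ha] <;> simp [Q.C_self]
  have f1 := Q.run_form hb1 hb1S hb1' (by
    intro p hp q hq hpS hqS h1 h2
    rcases hal p hpS h1 with rfl | rfl <;> rcases hal q hqS h2 with rfl | rfl <;>
      first | rfl | exact absurd hp (hdis _ ha2) | exact absurd hq (hdis _ ha2))
  have f2 := Q.run_form hb2 hb2S hb2' (by
    intro p hp q hq hpS hqS h1 h2
    rcases hal p hpS h1 with rfl | rfl <;> rcases hal q hqS h2 with rfl | rfl <;>
      first | rfl | exact absurd ha1 (hdis _ hp) | exact absurd ha1 (hdis _ hq))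
  have m1 : ∀ y, y ∈ S → y ∈ Q.C x → Q.u y ∈ Q.C (Q.u x) := fun y hy hyx =>
    (hloc _ (hu y hy)).resolve_left (Q.u_not_C' hyx)
  have m2 : ∀ y, y ∈ S → y ∈ Q.C (Q.u x) → Q.u y ∈ Q.C x := fun y hy hyx =>
    (hloc _ (hu y hy)).resolve_right (Q.u_not_C' hyx)
  obtain ⟨p, hp, q, hq, hpq, hxp, hxq⟩ := hcore x hxZ
  have hp' := hZ hp
  have hq' := hZ hq
  have key : ∀ P1 P2 : V → Prop, (∀ y, y ∈ Q.C x → (y ∈ S ↔ P1 y)) →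
      (∀ y, y ∈ Q.C (Q.u x) → (y ∈ S ↔ P2 y)) → (∀ y, P1 y → y ∈ Q.C x) →
      (∀ y, P2 y → y ∈ Q.C (Q.u x)) → (∀ y, P1 y → P2 (Q.u y)) ∧ (∀ y, P2 y → P1 (Q.u y)) := by
    intro P1 P2 h1 h2 h1' h2'
    refine ⟨fun y hy => ?_, fun y hy => ?_⟩
    · have hyS := (h1 y (h1' y hy)).2 hy
      exact (h2 _ (m1 y hyS (h1' y hy))).1 (hu y hyS)
    · have hyS := (h2 y (h2' y hy)).2 hy
      exact (h1 _ (m2 y hyS (h2' y hy))).1 (hu y hyS)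
  have c11 : Q.s b1 ∈ Q.C x := Q.Sat_C x _ hb1
  have c12 : Q.s (Q.s b1) ∈ Q.C x := Q.Sat_C x _ c11
  have c21 : Q.s b2 ∈ Q.C (Q.u x) := Q.Sat_C _ _ hb2
  have c22 : Q.s (Q.s b2) ∈ Q.C (Q.u x) := Q.Sat_C _ _ c21
  have uinj : ∀ a b, Q.u a = Q.u b → a = b := fun a b => Q.u_inj
  have n1 := Q.s1 b1
  have n2 := Q.s2 b1
  have n4 := Q.s1 (Q.s b1)
  have n1' := Q.s1 b2
  have n2' := Q.s2 b2
  have n4' := Q.s1 (Q.s b2)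
  have q1 := Q.nq1 b1
  have q2 := Q.nq1 (Q.s b1)
  have q3 := Q.nq3 b1
  have q4 := Q.nq3 (Q.s b1)
  have r1 := Q.s4 b2
  have r2 := Q.s4 (Q.s b2)
  rcases f1 with f1 | f1 | f1 <;> rcases f2 with f2 | f2 | f2 <;>
    obtain ⟨k1, k2⟩ := key _ _ f1 f2 (by rintro y hy; rcases hy with rfl | rfl | rfl <;> assumption)
      (by rintro y hy; rcases hy with rfl | rfl | rfl <;> assumption)
  · have : ∀ y ∈ S, y = b1 ∨ y = b2 := by
      intro y hy
      rcases hloc y hy with h | h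
      · exact Or.inl ((f1 y h).1 hy)
      · exact Or.inr ((f2 y h).1 hy)
    have e1 := this x hxS
    have e2 := this p hp'
    have e3 := this q hq'
    have := hxp.ne
    have := hxq.ne
    grind
  all_goals clear key m1 m2 hloc hal hu hcore hdis f1 f2
  all_goals simp only [forall_eq_or_imp, forall_eq] at k1 k2
  all_goals grind
end QS
end QSec
section QSec
open Classical
namespace QS
variable {V : Type*} [Fintype V] {G : SimpleGraph V} (Q : QS G)

theorem IsA.C_map {Q : QS G} {f : V ≃ V} (h : Q.IsA f) (v : V) :
    (Q.C v).map f.toEmbedding = Q.C (f v) := by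
  have h1 := h.ss v
  have h2 := h.ss (Q.s v)
  ext w
  simp only [C, Finset.map_insert, Finset.map_singleton, Finset.mem_insert, Finset.mem_singleton,
    Equiv.toEmbedding_apply, h1, h2]
  rcases h.2 v with h3 | h3 <;> rw [h3]
  simp only [Q.s4]; tauto

theorem IsA.ee_map {Q : QS G} {f : V ≃ V} (h : Q.IsA f) (A B : Finset V) :
    ee G (A.map f.toEmbedding) (B.map f.toEmbedding) = ee G A B := by
  rw [Q.ee_eq, Q.ee_eq, Finset.sum_map]
  exact Finset.sum_congr rfl fun v _ => h.nb_map _ _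

theorem ee_CC {a b : V} (h : b ∉ Q.C a) : ee G (Q.C a) (Q.C b) =
    ind (Q.u a ∈ Q.C b) + ind (Q.u (Q.s a) ∈ Q.C b) + ind (Q.u (Q.s (Q.s a)) ∈ Q.C b)
      + ind (Q.u (Q.s (Q.s (Q.s a))) ∈ Q.C b) := by
  have hC : ∀ w ∈ Q.C a, w ∉ Q.C b := fun w hw hw' => Q.C_disj h hw' hw
  have h0 := hC a (by simp [mem_C])
  have h1 := hC (Q.s a) (by simp [mem_C])
  have h2 := hC (Q.s (Q.s a)) (by simp [mem_C])
  have h3 := hC (Q.s (Q.s (Q.s a))) (by simp [mem_C])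
  rw [Q.ee_eq]
  conv_lhs => rw [C]
  rw [Finset.sum_insert (by simp [(Q.s1 _).symm, (Q.s2 _).symm, (Q.s3 _).symm]),
    Finset.sum_insert (by simp [(Q.s1 _).symm, (Q.s2 _).symm, (Q.s3 _).symm]),
    Finset.sum_insert (by simp [(Q.s1 _).symm, (Q.s2 _).symm, (Q.s3 _).symm]),
    Finset.sum_singleton]
  simp only [nb, Q.s4, ind_f h0, ind_f h1, ind_f h2, ind_f h3]
  ring

theorem C_comm {a b : V} : a ∈ Q.C b ↔ b ∈ Q.C a :=
  ⟨fun h => by rw [Q.C_eq h]; exact Q.C_self b, fun h => by rw [Q.C_eq h]; exact Q.C_self a⟩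

theorem struct (h : ∃ a b, b ∉ Q.C a ∧ ee G (Q.C a) (Q.C b) = 2) :
    (∀ v, Q.u (Q.s v) ∉ Q.C (Q.u v)) ∧ (∀ v, Q.u (Q.s (Q.s v)) = Q.s (Q.s (Q.u v))) := by
  obtain ⟨a, b, hab, he⟩ := h
  have hv : ∃ v ∈ Q.C a, Q.u v ∈ Q.C b := by
    by_contra hno
    push Not at hno
    rw [Q.ee_CC hab, ind_f (hno _ (by simp [mem_C])), ind_f (hno _ (by simp [mem_C])),
      ind_f (hno _ (by simp [mem_C])), ind_f (hno _ (by simp [mem_C]))] at he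
    omega
  obtain ⟨v, hva, hvb⟩ := hv
  rw [← Q.C_eq hva, ← Q.C_eq hvb] at he
  have e2 : ∀ w, ee G (Q.C w) (Q.C (Q.u w)) = 2 := by
    intro w
    obtain ⟨f, hf, h1, h2⟩ := Q.aut v w
    have hA : Q.IsA f := ⟨h1, h2⟩
    rw [← hA.ee_map, hA.C_map, hA.C_map, h1, hf] at he
    exact he
  have P : ∀ w w', Q.u (Q.s (Q.s w)) ∈ Q.C (Q.u w) → Q.u (Q.s (Q.s w')) ∈ Q.C (Q.u w') := by
    intro w w' hw
    obtain ⟨f, hf, h1, h2⟩ := Q.aut w w'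
    have hA : Q.IsA f := ⟨h1, h2⟩
    have : f (Q.u (Q.s (Q.s w))) ∈ (Q.C (Q.u w)).map f.toEmbedding := by simpa using hw
    rw [hA.C_map, h1, h1, hA.ss, hf] at this
    exact this
  have e3 : ∀ w, ind (Q.u (Q.s w) ∈ Q.C (Q.u w)) + ind (Q.u (Q.s (Q.s w)) ∈ Q.C (Q.u w))
      + ind (Q.u (Q.s (Q.s (Q.s w))) ∈ Q.C (Q.u w)) = 1 := by
    intro w
    have := e2 w
    rw [Q.ee_CC (Q.u_not_C w), ind_t (Q.C_self _)] at this
    omega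
  have Pex : ∃ w, Q.u (Q.s (Q.s w)) ∈ Q.C (Q.u w) := by
    by_contra hno
    push Not at hno
    have : ∃ w, Q.u (Q.s w) ∈ Q.C (Q.u w) := by
      by_contra hno2
      push Not at hno2
      have := e3 v
      rw [ind_f (hno v), ind_f (hno2 v)] at this
      have h3 : Q.u (Q.s (Q.s (Q.s v))) ∈ Q.C (Q.u v) := by
        by_contra h4
        rw [ind_f h4] at this; omega
      rw [C_comm] at h3
      apply hno2 (Q.s (Q.s (Q.s v)))
      rw [Q.s4]; exact h3
    obtain ⟨w, hw⟩ := this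
    rcases Q.mem_C.1 hw with h | h | h | h
    · exact Q.s1 w (Q.u_inj h)
    · exact Q.nq1 w h
    · apply hno (Q.u w)
      rw [← h, Q.u2, Q.u2, mem_C]; simp
    · exact Q.nq3 w h
  obtain ⟨w0, hw0⟩ := Pex
  have Pall : ∀ w, Q.u (Q.s (Q.s w)) ∈ Q.C (Q.u w) := fun w => P w0 w hw0
  have A1 : ∀ v, Q.u (Q.s v) ∉ Q.C (Q.u v) := by
    intro v hv
    have := e3 v
    rw [ind_t (Pall v), ind_t hv] at this; omega
  have A3 : ∀ v, Q.u (Q.s (Q.s (Q.s v))) ∉ Q.C (Q.u v) := by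
    intro v hv
    have := e3 v
    rw [ind_t (Pall v), ind_t hv] at this; omega
  refine ⟨A1, fun v => ?_⟩
  rcases Q.mem_C.1 (Pall v) with h | h | h | h
  · exact absurd (Q.u_inj h) (Q.s2 v)
  · exfalso
    apply A1 (Q.u v)
    rw [← h, Q.u2, Q.u2]; simp [mem_C]
  · exact h
  · exfalso
    apply A3 (Q.u v)
    rw [← h, Q.u2, Q.u2]; simp [mem_C]

/-- power of `s` -/
def pw (i : ZMod 4) (v : V) : V := Q.s^[i.val] v

theorem pw0 (v : V) : Q.pw 0 v = v := rfl
theorem pw1 (v : V) : Q.pw 1 v = Q.s v := rfl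
theorem pw2 (v : V) : Q.pw 2 v = Q.s (Q.s v) := rfl
theorem pw3 (v : V) : Q.pw 3 v = Q.s (Q.s (Q.s v)) := rfl

theorem zcases (i : ZMod 4) : i = 0 ∨ i = 1 ∨ i = 2 ∨ i = 3 := by
  revert i; decide

theorem s_pw (i : ZMod 4) (v : V) : Q.s (Q.pw i v) = Q.pw (i + 1) v := by
  rcases zcases i with rfl | rfl | rfl | rfl
  · rfl
  · rfl
  · rfl
  · exact Q.s4 v

theorem ss_pw (i : ZMod 4) (v : V) : Q.s (Q.s (Q.pw i v)) = Q.pw (i + 2) v := by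
  rw [s_pw, s_pw]; congr 1; ring

theorem sss_pw (i : ZMod 4) (v : V) : Q.s (Q.s (Q.s (Q.pw i v))) = Q.pw (i + 3) v := by
  rw [s_pw, s_pw, s_pw]; congr 1; ring

theorem pw_pw (i j : ZMod 4) (v : V) : Q.pw i (Q.pw j v) = Q.pw (j + i) v := by
  rcases zcases i with rfl | rfl | rfl | rfl
  · rw [pw0, add_zero]
  · rw [pw1, s_pw]
  · rw [pw2, ss_pw]
  · rw [pw3, sss_pw]

theorem pw_mem (i : ZMod 4) (v : V) : Q.pw i v ∈ Q.C v := by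
  rcases zcases i with rfl | rfl | rfl | rfl <;> simp [mem_C, pw0, pw1, pw2, pw3]

theorem mem_pw {v w : V} (h : w ∈ Q.C v) : ∃ i, w = Q.pw i v := by
  rcases Q.mem_C.1 h with h | h | h | h
  exacts [⟨0, h⟩, ⟨1, h⟩, ⟨2, h⟩, ⟨3, h⟩]

theorem pw_inj {i j : ZMod 4} {v : V} (h : Q.pw i v = Q.pw j v) : i = j := by
  have h1 : Q.pw (-j) (Q.pw i v) = v := by rw [h, pw_pw, add_neg_cancel, pw0]
  rw [pw_pw] at h1
  have : i + -j = 0 := by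
    rcases zcases (i + -j) with h | h | h | h
    · exact h
    · rw [h] at h1; exact absurd h1 (Q.s1 v)
    · rw [h] at h1; exact absurd h1 (Q.s2 v)
    · rw [h] at h1; exact absurd h1 (Q.s3 v)
  rwa [add_neg_eq_zero] at this

/-- forward sequence -/
def wt (v0 : V) (t : ℕ) : V := (fun v => Q.s (Q.u v))^[t] v0

theorem wt_succ (v0 : V) (t : ℕ) : Q.wt v0 (t + 1) = Q.s (Q.u (Q.wt v0 t)) := by
  unfold wt; rw [Function.iterate_succ_apply']

theorem u_wt (v0 : V) (t : ℕ) : Q.u (Q.wt v0 t) = Q.pw 3 (Q.wt v0 (t + 1)) := by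
  rw [wt_succ, pw3, Q.s4]

theorem wt_ne (uss : ∀ v, Q.u (Q.s (Q.s v)) = Q.s (Q.s (Q.u v))) (v0 : V) : ∀ n a,
    Q.wt v0 a ≠ Q.s (Q.wt v0 (a + n)) ∧ Q.wt v0 a ≠ Q.s (Q.s (Q.s (Q.wt v0 (a + n)))) := by
  intro n
  induction n using Nat.strong_induction_on with
  | _ n ih =>
    intro a
    match n, ih with
    | 0, _ => exact ⟨(Q.s1 _).symm, (Q.s3 _).symm⟩
    | 1, _ =>
      rw [wt_succ]
      generalize Q.wt v0 a = x
      refine ⟨fun h => ?_, fun h => ?_⟩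
      · apply Q.us2 x
        conv_rhs => rw [h]
        rw [Q.s4]
      · rw [Q.s4] at h; exact Q.us0 x h.symm
    | n + 2, ih =>
      have := ih n (by omega) (a + 1)
      have e : a + (n + 2) = (a + 1 + n) + 1 := by ring
      rw [wt_succ] at this
      rw [e, wt_succ]
      refine ⟨fun h => this.2 ?_, fun h => this.1 ?_⟩
      · rw [← uss] at h
        rw [h, Q.u2]
      · rw [Q.s4] at h
        rw [h, Q.u2]

theorem wt_C (uss : ∀ v, Q.u (Q.s (Q.s v)) = Q.s (Q.s (Q.u v))) (v0 : V) {a b : ℕ} (hab : a ≤ b)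
    (h : Q.wt v0 a ∈ Q.C (Q.wt v0 b)) :
    Q.wt v0 b = Q.wt v0 a ∨ Q.wt v0 b = Q.s (Q.s (Q.wt v0 a)) := by
  have := Q.wt_ne uss v0 (b - a) a
  rw [Nat.add_sub_cancel' hab] at this
  rcases Q.mem_C.1 h with h | h | h | h
  · exact Or.inl h.symm
  · exact absurd h this.1
  · right; rw [h, Q.s4]
  · exact absurd h this.2

theorem wt_add (uss : ∀ v, Q.u (Q.s (Q.s v)) = Q.s (Q.s (Q.u v))) (v0 : V) {e : ZMod 4} {a b : ℕ}
    (he : e = 0 ∨ e = 2) (t : ℕ) :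
    Q.wt v0 (a + t) = Q.pw e (Q.wt v0 (b + t)) ↔ Q.wt v0 a = Q.pw e (Q.wt v0 b) := by
  induction t with
  | zero => rfl
  | succ t ih =>
    rw [← ih, ← add_assoc, ← add_assoc, wt_succ, wt_succ]
    generalize Q.wt v0 (a + t) = x
    generalize Q.wt v0 (b + t) = y
    have : Q.pw e (Q.s (Q.u y)) = Q.s (Q.u (Q.pw e y)) := by
      rcases he with rfl | rfl
      · rfl
      · rw [pw2, pw2, uss]
    rw [this]
    exact ⟨fun h => Q.u_inj (Q.s_inj h), fun h => by rw [h]⟩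

theorem period (v0 : V) : ∃ m, 0 < m ∧ (Q.wt v0 m = v0 ∨ Q.wt v0 m = Q.s (Q.s v0)) := by
  have hinj : Function.Injective (fun v => Q.s (Q.u v)) := fun a b h => Q.u_inj (Q.s_inj h)
  obtain ⟨n, hn, hp⟩ := hinj.mem_periodicPts v0
  exact ⟨n, hn, Or.inl hp⟩

end QS
end QSec
section QSec
open Classical
namespace QS
variable {V : Type*} [Fintype V] {G : SimpleGraph V} (Q : QS G)

/-- forward relation -/
def FW (m : ℕ) (δ : ZMod 4) (p q : ZMod 4 × Fin m) : Prop :=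
  (p.1 = ((p.2 : ℕ) : ZMod 4) + 1 ∨ p.1 = ((p.2 : ℕ) : ZMod 4) + 3) ∧
  (((q.2 : ℕ) = (p.2 : ℕ) + 1 ∧ q.1 = p.1) ∨ ((p.2 : ℕ) + 1 = m ∧ (q.2 : ℕ) = 0 ∧ q.1 = p.1 + δ))

theorem cast_par (t : ℕ) : (t % 2 = 0 → (t : ZMod 4) = 0 ∨ (t : ZMod 4) = 2) ∧
    (t % 2 = 1 → (t : ZMod 4) = 1 ∨ (t : ZMod 4) = 3) := by
  have h : (t : ZMod 4) = ((t % 4 : ℕ) : ZMod 4) := by rw [ZMod.natCast_mod]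
  have h4 : t % 4 = 0 ∨ t % 4 = 1 ∨ t % 4 = 2 ∨ t % 4 = 3 := by omega
  rcases h4 with h4 | h4 | h4 | h4 <;> rw [h, h4] <;> refine ⟨fun h => ?_, fun h => ?_⟩ <;>
    first | omega | simp | (right; rfl) | (left; rfl)

theorem par1 {τ x : ZMod 4} (h : τ = 0 ∨ τ = 2) : (x = τ + 1 ∨ x = τ + 3) ↔ (x = 1 ∨ x = 3) := by
  revert τ x; decide
theorem par2 {τ x : ZMod 4} (h : τ = 1 ∨ τ = 3) : (x = τ + 1 ∨ x = τ + 3) ↔ (x = 2 ∨ x = 0) := by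
  revert τ x; decide

theorem tm_rel (m : ℕ) (hm : 2 ≤ m) (δ : ZMod 4) (h0 : m % 2 = 0 → δ = 0 ∨ δ = 2)
    (h1 : m % 2 = 1 → δ = 1 ∨ δ = 3) (p q : ZMod 4 × Fin m) (hne : p ≠ q) :
    (TmGraph m (decide (δ = 0 ∨ δ = 1))).Adj p q ↔
      (q = (p.1 + 1, p.2)) ∨ (p = (q.1 + 1, q.2)) ∨ FW m δ p q ∨ FW m δ q p := by
  have key : ∀ p q : ZMod 4 × Fin m, FW m δ p q ↔ 
    (((p.1 = 1 ∨ p.1 = 3) ∧ q.1 = p.1 ∧ (p.2 : ℕ) % 2 = 0 ∧ (q.2 : ℕ) = (p.2 : ℕ) + 1) ∨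
    ((p.1 = 2 ∨ p.1 = 0) ∧ q.1 = p.1 ∧ (p.2 : ℕ) % 2 = 1 ∧ (q.2 : ℕ) = (p.2 : ℕ) + 1) ∨
    (m % 2 = 1 ∧ (p.2 : ℕ) = m - 1 ∧ (q.2 : ℕ) = 0 ∧
      ((decide (δ = 0 ∨ δ = 1) = true ∧ ((p.1 = 1 ∧ q.1 = 2) ∨ (p.1 = 3 ∧ q.1 = 0))) ∨
        (decide (δ = 0 ∨ δ = 1) = false ∧ ((p.1 = 1 ∧ q.1 = 0) ∨ (p.1 = 3 ∧ q.1 = 2))))) ∨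
    (m % 2 = 0 ∧ (p.2 : ℕ) = m - 1 ∧ (q.2 : ℕ) = 0 ∧
      ((decide (δ = 0 ∨ δ = 1) = true ∧ ((p.1 = 2 ∧ q.1 = 2) ∨ (p.1 = 0 ∧ q.1 = 0))) ∨
        (decide (δ = 0 ∨ δ = 1) = false ∧ ((p.1 = 2 ∧ q.1 = 0) ∨ (p.1 = 0 ∧ q.1 = 2)))))) := by
    clear hne p q
    rintro ⟨i, t⟩ ⟨j, t'⟩
    unfold FW
    simp only
    have e1 : ((t : ℕ) = m - 1) ↔ ((t : ℕ) + 1 = m) := by omega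
    rw [e1]
    have ht := cast_par (t : ℕ)
    by_cases hw : (t : ℕ) + 1 = m
    · have hnot : ¬ ((t' : ℕ) = m) := by have := t'.2; omega
      have hm0 : ¬ (0 = m) := by omega
      simp only [hw, hnot, true_and, false_and, and_false, false_or]
      by_cases hz : (t' : ℕ) = 0
      · simp only [hz, true_and]
        rcases Nat.mod_two_eq_zero_or_one m with hpar | hpar
        · rw [par2 (ht.2 (by omega))]
          rcases h0 hpar with rfl | rfl
          · simp only [hpar, hm0]
            clear ht
            revert i j; decide
          · simp only [hpar, hm0]
            clear ht
            revert i j; decide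
        · rw [par1 (ht.1 (by omega))]
          rcases h1 hpar with rfl | rfl
          · simp only [hpar, hm0]
            clear ht
            revert i j; decide
          · simp only [hpar, hm0]
            clear ht
            revert i j; decide
      · simp [hz]
    · simp only [hw, false_and, and_false, or_false]
      rcases Nat.mod_two_eq_zero_or_one (t : ℕ) with hpar | hpar
      · rw [par1 (ht.1 hpar)]
        simp [hpar]; tauto
      · rw [par2 (ht.2 hpar)]
        simp [hpar]; tauto
  rw [key p q, key q p]
  have g1 : (q = (p.1 + 1, p.2)) ↔ (q.1 = p.1 + 1 ∧ q.2 = p.2) := Prod.ext_iff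
  have g2 : (p = (q.1 + 1, q.2)) ↔ (p.1 = q.1 + 1 ∧ p.2 = q.2) := Prod.ext_iff
  rw [g1, g2]
  unfold TmGraph
  rw [SimpleGraph.fromRel_adj]
  simp only [ne_eq, hne, not_false_eq_true, true_and]
  generalize (q.1 = p.1 + 1 ∧ q.2 = p.2) = X1
  generalize (p.1 = q.1 + 1 ∧ p.2 = q.2) = X2
  constructor
  · rintro ((h | h) | (h | h))
    · exact Or.inl h
    · exact Or.inr (Or.inr (Or.inl h))
    · exact Or.inr (Or.inl h)
    · exact Or.inr (Or.inr (Or.inr h))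
  · rintro (h | h | h | h)
    · exact Or.inl (Or.inl h)
    · exact Or.inr (Or.inl h)
    · exact Or.inl (Or.inr h)
    · exact Or.inr (Or.inr h)

theorem tm_iso [Nonempty V] (hconn : G.Connected) (A1 : ∀ v, Q.u (Q.s v) ∉ Q.C (Q.u v))
    (uss : ∀ v, Q.u (Q.s (Q.s v)) = Q.s (Q.s (Q.u v))) :
    ∃ m, 2 ≤ m ∧ ∃ b : Bool, Nonempty (G ≃g TmGraph m b) := by
  obtain ⟨v0⟩ := ‹Nonempty V›
  let m := Nat.find (Q.period v0)
  obtain ⟨hm0, hmp⟩ : 0 < m ∧ (Q.wt v0 m = v0 ∨ Q.wt v0 m = Q.s (Q.s v0)) :=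
    Nat.find_spec (Q.period v0)
  have hmin : ∀ k, 0 < k → k < m → ¬ (Q.wt v0 k = v0 ∨ Q.wt v0 k = Q.s (Q.s v0)) :=
    fun k hk hkm h => Nat.find_min (Q.period v0) hkm ⟨hk, h⟩
  have hm2 : 2 ≤ m := by
    by_contra hlt
    have h1 : m = 1 := by omega
    rw [h1, show (1 : ℕ) = 0 + 1 from rfl, wt_succ] at hmp
    have : Q.s (Q.u v0) ∈ Q.C v0 := by
      rw [mem_C]; rcases hmp with h | h
      · left; exact h
      · right; right; left; exact h
    have h2 : Q.u v0 ∈ Q.C v0 := ((Q.Sat_C v0).iff).1 this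
    exact Q.u_not_C v0 h2
  have hε : ∃ ε : ZMod 4, (ε = 0 ∨ ε = 2) ∧ Q.wt v0 m = Q.pw ε (Q.wt v0 0) := by
    rcases hmp with h | h
    · exact ⟨0, Or.inl rfl, h⟩
    · exact ⟨2, Or.inr rfl, h⟩
  obtain ⟨ε, hε, hwm⟩ := hε
  have hper : ∀ t, Q.wt v0 (m + t) = Q.pw ε (Q.wt v0 t) := by
    intro t
    have := (Q.wt_add uss v0 (a := m) (b := 0) hε t).2 hwm
    rwa [zero_add] at this
  -- distinct columns
  have hdist : ∀ a b, a < b → b < m → Q.wt v0 a ∉ Q.C (Q.wt v0 b) := by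
    intro a b hab hb h
    have h1 := Q.wt_C uss v0 hab.le h
    apply hmin (b - a) (by omega) (by omega)
    have e1 := Q.wt_add uss v0 (a := b - a) (b := 0) (e := 0) (Or.inl rfl) a
    have e2 := Q.wt_add uss v0 (a := b - a) (b := 0) (e := 2) (Or.inr rfl) a
    rw [Nat.sub_add_cancel hab.le, zero_add] at e1 e2
    exact h1.imp e1.1 e2.1
  -- coverage
  have hred : ∀ n t, t < n → ∃ t', t' < m ∧ Q.C (Q.wt v0 t) = Q.C (Q.wt v0 t') := by
    intro n
    induction n with
    | zero => intro t ht; omega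
    | succ n ih =>
      intro t ht
      by_cases h : t < m
      · exact ⟨t, h, rfl⟩
      · obtain ⟨t', h1, h2⟩ := ih (t - m) (by omega)
        refine ⟨t', h1, ?_⟩
        rw [← h2]
        have := hper (t - m)
        rw [Nat.add_sub_cancel' (by omega)] at this
        rw [this]
        exact Q.C_eq (Q.pw_mem _ _)
  have hucl : ∀ v t, v ∈ Q.C (Q.wt v0 t) → ∃ t', Q.u v ∈ Q.C (Q.wt v0 t') := by
    have main : ∀ v t, v ∈ Q.C (Q.wt v0 (t + 1)) → ∃ t', Q.u v ∈ Q.C (Q.wt v0 t') := by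
      intro v t hv
      have hw : ∀ t, Q.u (Q.wt v0 t) ∈ Q.C (Q.wt v0 (t + 1)) := by
        intro t; rw [u_wt]; exact Q.pw_mem _ _
      rcases Q.mem_C.1 hv with h | h | h | h
      · exact ⟨t + 2, by rw [h]; exact hw (t + 1)⟩
      · refine ⟨t, ?_⟩
        rw [h, wt_succ, uss, Q.u2]; simp [mem_C]
      · refine ⟨t + 2, ?_⟩
        rw [h, uss]
        exact Q.Sat_C _ _ (Q.Sat_C _ _ (hw (t + 1)))
      · refine ⟨t, ?_⟩
        rw [h, wt_succ, Q.s4, Q.u2]; simp [mem_C]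
    intro v t hv
    have := hper t
    have h2 : Q.C (Q.wt v0 (m + t)) = Q.C (Q.wt v0 t) := by
      rw [this]; exact Q.C_eq (Q.pw_mem _ _)
    rw [← h2] at hv
    have e : m + t = (m + t - 1) + 1 := by omega
    rw [e] at hv
    exact main v _ hv
  have hcov : ∀ v, ∃ t, t < m ∧ v ∈ Q.C (Q.wt v0 t) := by
    have : ∀ v, ∃ t, v ∈ Q.C (Q.wt v0 t) := by
      intro v
      obtain ⟨p⟩ := hconn.preconnected v0 v
      have step : ∀ a b, G.Adj a b → (∃ t, a ∈ Q.C (Q.wt v0 t)) → ∃ t, b ∈ Q.C (Q.wt v0 t) := by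
        rintro a b hab ⟨t, ht⟩
        rcases (Q.adj a b).1 hab with rfl | rfl | rfl
        · exact ⟨t, Q.Sat_C _ _ ht⟩
        · exact ⟨t, Q.Sat_C _ _ (Q.Sat_C _ _ (Q.Sat_C _ _ ht))⟩
        · exact hucl a t ht
      have gen : ∀ (a b : V) (p : G.Walk a b), (∃ t, a ∈ Q.C (Q.wt v0 t)) →
          ∃ t, b ∈ Q.C (Q.wt v0 t) := by
        intro a b p
        induction p with
        | nil => exact id
        | cons h p ih => exact fun ha => ih (step _ _ h ha)
      exact gen _ _ p ⟨0, Q.C_self _⟩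
    intro v
    obtain ⟨t, ht⟩ := this v
    obtain ⟨t', h1, h2⟩ := hred (t + 1) t (by omega)
    exact ⟨t', h1, h2 ▸ ht⟩
  -- the map
  let F : ZMod 4 × Fin m → V := fun p => Q.pw (p.1 - (((p.2 : ℕ) : ZMod 4) + 1)) (Q.wt v0 p.2)
  have hFinj : Function.Injective F := by
    rintro ⟨i, t⟩ ⟨j, t'⟩ h
    have hc : Q.C (Q.wt v0 t) = Q.C (Q.wt v0 t') := by
      have h1 := Q.C_eq (Q.pw_mem (i - (((t : ℕ) : ZMod 4) + 1)) (Q.wt v0 t))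
      have h2 := Q.C_eq (Q.pw_mem (j - (((t' : ℕ) : ZMod 4) + 1)) (Q.wt v0 t'))
      rw [← h1, ← h2]
      exact congrArg Q.C h
    have htt : t = t' := by
      rcases lt_trichotomy (t : ℕ) (t' : ℕ) with hlt | heq | hgt
      · exact absurd (hc ▸ Q.C_self _) (hdist _ _ hlt t'.2)
      · exact Fin.ext heq
      · exact absurd (hc ▸ Q.C_self _) (hdist _ _ hgt t.2)
    subst htt
    have := Q.pw_inj h
    simp only at this
    rw [sub_left_inj] at this
    rw [this]
  have hFsurj : Function.Surjective F := by
    intro v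
    obtain ⟨t, ht, hv⟩ := hcov v
    obtain ⟨k, hk⟩ := Q.mem_pw hv
    refine ⟨(k + ((t : ZMod 4) + 1), ⟨t, ht⟩), ?_⟩
    simp only [F]
    rw [add_sub_cancel_right, hk]
  let δ : ZMod 4 := ε - (m : ZMod 4)
  have hmpar := cast_par m
  have hδ0 : m % 2 = 0 → δ = 0 ∨ δ = 2 := by
    intro h
    have := hmpar.1 h
    simp only [δ]
    generalize (m : ZMod 4) = μ at this
    clear hwm hper
    revert ε μ; decide
  have hδ1 : m % 2 = 1 → δ = 1 ∨ δ = 3 := by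
    intro h
    have := hmpar.2 h
    simp only [δ]
    generalize (m : ZMod 4) = μ at this
    clear hwm hper hδ0
    revert ε μ; decide
  have Fs : ∀ p, Q.s (F p) = F (p.1 + 1, p.2) := by
    intro p; simp only [F]; rw [s_pw]; congr 1; ring
  have upw : ∀ e : ZMod 4, e = 0 ∨ e = 2 → ∀ v, Q.u (Q.pw e v) = Q.pw e (Q.u v) := by
    rintro e (rfl | rfl) v
    · rfl
    · exact uss v
  have hFW : ∀ p q, FW m δ p q → F q = Q.u (F p) := by
    rintro ⟨i, t⟩ ⟨j, t'⟩ ⟨h1, h2⟩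
    simp only at h1 h2
    have he : i - (((t : ℕ) : ZMod 4) + 1) = 0 ∨ i - (((t : ℕ) : ZMod 4) + 1) = 2 := by
      rcases h1 with h | h <;> rw [h]
      · left; ring
      · right; ring
    simp only [F]
    rw [upw _ he, u_wt, pw_pw]
    rcases h2 with ⟨h2, h3⟩ | ⟨h2, h3, h4⟩
    · rw [h2, h3]
      congr 1
      push_cast
      have : (4 : ZMod 4) = 0 := rfl
      linear_combination (-1 : ZMod 4) * this
    · rw [h2, hwm, pw_pw, h3, h4]
      congr 1
      have hmt : (m : ZMod 4) = ((t : ℕ) : ZMod 4) + 1 := by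
        have := congrArg (Nat.cast : ℕ → ZMod 4) h2
        push_cast at this; exact this.symm
      simp only [δ]
      rw [hmt]
      have : (4 : ZMod 4) = 0 := rfl
      push_cast
      linear_combination (-1 : ZMod 4) * this
  have hex : ∀ p, (∃ q, FW m δ p q) ∨ (∃ q, FW m δ q p) := by
    rintro ⟨i, t⟩
    have hc : (i = ((t : ℕ) : ZMod 4) + 1 ∨ i = ((t : ℕ) : ZMod 4) + 3) ∨
        (i = ((t : ℕ) : ZMod 4) ∨ i = ((t : ℕ) : ZMod 4) + 2) := by
      generalize ((t : ℕ) : ZMod 4) = τ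
      clear hwm hper hδ0 hδ1
      revert i τ; decide
    rcases hc with hc | hc
    · left
      by_cases h : (t : ℕ) + 1 = m
      · exact ⟨(i + δ, ⟨0, hm0⟩), hc, Or.inr ⟨h, rfl, rfl⟩⟩
      · exact ⟨(i, ⟨t + 1, by have := t.2; omega⟩), hc, Or.inl ⟨rfl, rfl⟩⟩
    · right
      by_cases h : (t : ℕ) = 0
      · refine ⟨(i - δ, ⟨m - 1, by omega⟩), ?_, Or.inr ⟨by simp only; omega, h, by simp⟩⟩
        simp only [δ]
        rw [Nat.cast_sub (by omega)]
        rw [h] at hc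
        push_cast at hc ⊢
        generalize (m : ZMod 4) = μ
        clear hwm hper hδ0 hδ1 hFW
        revert i ε μ; decide
      · refine ⟨(i, ⟨t - 1, by have := t.2; omega⟩), ?_, Or.inl ⟨by simp only; omega, rfl⟩⟩
        simp only
        rw [Nat.cast_sub (by omega)]
        push_cast
        generalize ((t : ℕ) : ZMod 4) = τ at hc
        clear hwm hper hδ0 hδ1
        revert i τ; decide
  have hFu : ∀ p q, F q = Q.u (F p) ↔ FW m δ p q ∨ FW m δ q p := by
    intro p q
    constructor
    · intro h
      rcases hex p with ⟨q', hq⟩ | ⟨q', hq⟩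
      · have := hFW _ _ hq
        rw [← h] at this
        rw [← hFinj this]; exact Or.inl hq
      · have := hFW _ _ hq
        rw [this, Q.u2] at h
        rw [hFinj h]; exact Or.inr hq
    · rintro (h | h)
      · exact hFW _ _ h
      · rw [hFW _ _ h, Q.u2]
  refine ⟨m, hm2, decide (δ = 0 ∨ δ = 1), ⟨RelIso.symm ⟨Equiv.ofBijective F ⟨hFinj, hFsurj⟩, ?_⟩⟩⟩
  intro p q
  change G.Adj (F p) (F q) ↔ _
  by_cases hne : p = q
  · subst hne; simp
  rw [tm_rel m hm2 δ hδ0 hδ1 p q hne, Q.adj, hFu, Fs, hFinj.eq_iff]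
  have : F q = Q.s (Q.s (Q.s (F p))) ↔ p = (q.1 + 1, q.2) := by
    rw [← hFinj.eq_iff, ← Fs]
    constructor
    · intro h; rw [h, Q.s4]
    · intro h; rw [h, Q.s4]
  rw [Fs] at this
  rw [this]
end QS
end QSec
section QSec
open Classical

theorem quad_walk {V : Type*} {G : SimpleGraph V} {a b c d : V} (h : Quad4 G a b c d) :
    ∃ w : G.Walk a a, w.IsCycle ∧ w.length = 4 ∧
      (∀ x, x ∈ w.support ↔ x = a ∨ x = b ∨ x = c ∨ x = d) ∧
      (∀ e, e ∈ w.edges ↔ e = s(a, b) ∨ e = s(b, c) ∨ e = s(c, d) ∨ e = s(d, a)) := by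
  obtain ⟨h1, h2, h3, h4, h5, h6⟩ := h
  refine ⟨.cons h1 (.cons h2 (.cons h3 (.cons h4 .nil))), ?_, rfl, ?_, ?_⟩
  · have n1 := h1.ne
    have n2 := h2.ne
    have n3 := h3.ne
    have n4 := h4.ne
    rw [SimpleGraph.Walk.cons_isCycle_iff]
    refine ⟨?_, ?_⟩
    · simp [SimpleGraph.Walk.cons_isPath_iff]
      grind
    · simp
      grind
  · intro x; simp; tauto
  · intro e; simp

theorem walk_quad {V : Type*} {G : SimpleGraph V} {a : V} (w : G.Walk a a) (hw : w.IsCycle)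
    (h4 : w.length = 4) : ∃ b c d, Quad4 G a b c d := by
  match w, h4 with
  | .cons (v := b) h1 (.cons (v := c) h2 (.cons (v := d) h3 (.cons h4 .nil))), _ =>
    refine ⟨b, c, d, h1, h2, h3, h4, ?_, ?_⟩
    · have := hw.support_nodup
      simp at this
      tauto
    · have := hw.support_nodup
      simp at this
      tauto

theorem no_tri {V : Type*} {G : SimpleGraph V} (hg : G.girth = 4) (a b c : V) (h1 : G.Adj a b)
    (h2 : G.Adj b c) (h3 : G.Adj c a) : False := by
  have hc : (SimpleGraph.Walk.cons h1 (.cons h2 (.cons h3 .nil))).IsCycle := by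
    have n1 := h1.ne
    have n2 := h2.ne
    have n3 := h3.ne
    rw [SimpleGraph.Walk.cons_isCycle_iff]
    refine ⟨?_, ?_⟩
    · simp [SimpleGraph.Walk.cons_isPath_iff]
      grind
    · simp
      grind
  have := SimpleGraph.girth_le_length hc
  rw [hg] at this
  simp at this

theorem Quad4.rot {V : Type*} {G : SimpleGraph V} {a b c d : V} (h : Quad4 G a b c d) :
    Quad4 G b c d a := by
  obtain ⟨h1, h2, h3, h4, h5, h6⟩ := h
  exact ⟨h2, h3, h4, h1, h6, h5.symm⟩

/-- uniqueness of quads at a vertex -/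
def QU {V : Type*} (G : SimpleGraph V) : Prop := ∀ a b c d b' c' d', Quad4 G a b c d →
  Quad4 G a b' c' d' → (b = b' ∧ c = c' ∧ d = d') ∨ (b = d' ∧ c = c' ∧ d = b')

theorem quad_uniq {V : Type*} {G : SimpleGraph V} 
    (hquad : ∀ (u v : V) (c : G.Walk u u) (c' : G.Walk v v),
      c.IsCycle → c'.IsCycle → c.length = 4 → c'.length = 4 →
      (∃ w, w ∈ c.support ∧ w ∈ c'.support) → ∀ e, e ∈ c.edges ↔ e ∈ c'.edges) : QU G := by
  intro a b c d b' c' d' h h'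
  obtain ⟨w, w1, w2, w3, w4⟩ := quad_walk h
  obtain ⟨w', w1', w2', w3', w4'⟩ := quad_walk h'
  have he := hquad a a w w' w1 w1' w2 w2' ⟨a, by simp, by simp⟩
  have e1 := (w4' _).1 ((he _).1 ((w4 s(a, b)).2 (by simp)))
  have e2 := (w4' _).1 ((he _).1 ((w4 s(b, c)).2 (by simp)))
  have e4 := (w4' _).1 ((he _).1 ((w4 s(d, a)).2 (by simp)))
  obtain ⟨h1, h2, h3, h4, h5, h6⟩ := h
  obtain ⟨h1', h2', h3', h4', h5', h6'⟩ := h'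
  have n1 := h1.ne
  have n2 := h2.ne
  have n3 := h3.ne
  have n4 := h4.ne
  have n1' := h1'.ne
  have n2' := h2'.ne
  have n3' := h3'.ne
  have n4' := h4'.ne
  clear h1 h2 h3 h4 h1' h2' h3' h4' he w4 w4'
  simp only [Sym2.eq_iff] at e1 e2 e4
  have f1 : b = b' ∨ b = d' := by grind
  have f2 : d = b' ∨ d = d' := by grind
  have f3 : c = c' := by grind
  grind

theorem exists_rot {V : Type*} [Nonempty V] {G : SimpleGraph V} (hu : QU G)
    (hq : ∀ a, ∃ b c d, Quad4 G a b c d) :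
    ∃ σ : V → V, ∀ v, σ (σ (σ (σ v))) = v ∧ Quad4 G v (σ v) (σ (σ v)) (σ (σ (σ v))) := by
  choose b c d hbcd using hq
  let qs : V → Finset V := fun v => {v, b v, c v, d v}
  have hmem : ∀ v w, w ∈ qs v ↔ w = v ∨ w = b v ∨ w = c v ∨ w = d v := by
    intro v w; simp [qs]
  have key : ∀ v w, w ∈ qs v → qs w = qs v := by
    intro v w hw
    have gen : ∀ x y z, Quad4 G w x y z → qs w = {w, x, y, z} := by
      intro x y z h
      ext t
      rw [hmem]
      rcases hu _ _ _ _ _ _ _ (hbcd w) h with ⟨h1, h2, h3⟩ | ⟨h1, h2, h3⟩ <;>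
        rw [h1, h2, h3] <;> simp <;> tauto
    have h0 := hbcd v
    rcases (hmem v w).1 hw with h | h | h | h
    · rw [h]
    · subst h; rw [gen _ _ _ h0.rot]; ext t; rw [hmem]; simp; tauto
    · subst h; rw [gen _ _ _ h0.rot.rot]; ext t; rw [hmem]; simp; tauto
    · subst h; rw [gen _ _ _ h0.rot.rot.rot]; ext t; rw [hmem]; simp; tauto
  let r : V → V := fun v => Function.invFun qs (qs v)
  have hr : ∀ v, qs (r v) = qs v := fun v => Function.invFun_eq ⟨v, rfl⟩
  have hrc : ∀ v w, w ∈ qs v → r w = r v := by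
    intro v w h; simp only [r]; rw [key v w h]
  let σ : V → V := fun v => if v = r v then b (r v) else if v = b (r v) then c (r v) else
    if v = c (r v) then d (r v) else r v
  refine ⟨σ, fun v => ?_⟩
  have hv : v ∈ qs (r v) := by rw [hr, hmem]; simp
  generalize hR : r v = R at hv
  have hRR : r R = R := by rw [← hR]; apply hrc; rw [← hr v, hmem]; simp
  have hQ := hbcd R
  have hQ' := hQ
  obtain ⟨h1, h2, h3, h4, h5, h6⟩ := hQ'
  have n1 := h1.ne
  have n2 := h2.ne
  have n3 := h3.ne
  have n4 := h4.ne
  have rb : r (b R) = R := by rw [hrc R _ (by rw [hmem]; simp), hRR]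
  have rc : r (c R) = R := by rw [hrc R _ (by rw [hmem]; simp), hRR]
  have rd : r (d R) = R := by rw [hrc R _ (by rw [hmem]; simp), hRR]
  have s1 : σ R = b R := by simp only [σ]; rw [hRR]; simp
  have s2 : σ (b R) = c R := by simp only [σ]; rw [rb]; simp [n1.symm]
  have s3 : σ (c R) = d R := by simp only [σ]; rw [rc]; simp [n2.symm, h5.symm]
  have s4 : σ (d R) = R := by simp only [σ]; rw [rd]; simp [n3.symm, h6.symm, n4]
  rcases (hmem _ _).1 hv with h | h | h | h <;> subst h <;> simp only [s1, s2, s3, s4]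
  · exact ⟨trivial, hQ⟩
  · exact ⟨trivial, hQ.rot⟩
  · exact ⟨trivial, hQ.rot.rot⟩
  · exact ⟨trivial, hQ.rot.rot.rot⟩

theorem exists_QS {V : Type*} [Fintype V] (G : SimpleGraph V) [DecidableRel G.Adj]
    (hconn : G.Connected)
    (hcubic : G.IsRegularOfDegree 3) (hvt : IsVertexTransitive G) (hg : G.girth = 4)
    (hquad : ∀ (u v : V) (c : G.Walk u u) (c' : G.Walk v v),
      c.IsCycle → c'.IsCycle → c.length = 4 → c'.length = 4 →
      (∃ w, w ∈ c.support ∧ w ∈ c'.support) → ∀ e, e ∈ c.edges ↔ e ∈ c'.edges) :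
    Nonempty (QS G) := by
  have hne : Nonempty V := hconn.nonempty
  have hu := quad_uniq hquad
  have hnt := no_tri hg
  have hmap : ∀ (φ : G ≃g G) a b c d, Quad4 G a b c d → Quad4 G (φ a) (φ b) (φ c) (φ d) := by
    rintro φ a b c d ⟨h1, h2, h3, h4, h5, h6⟩
    exact ⟨φ.map_adj_iff.2 h1, φ.map_adj_iff.2 h2, φ.map_adj_iff.2 h3, φ.map_adj_iff.2 h4,
      fun h => h5 (φ.injective h), fun h => h6 (φ.injective h)⟩
  have hq : ∀ a, ∃ b c d, Quad4 G a b c d := by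
    have hac : ¬ G.IsAcyclic := by
      intro h
      rw [SimpleGraph.girth_eq_zero.2 h] at hg
      omega
    obtain ⟨x, w, hw, hl⟩ := SimpleGraph.exists_girth_eq_length.2 hac
    obtain ⟨b, c, d, h⟩ := walk_quad w hw (by omega)
    intro a
    obtain ⟨φ, rfl⟩ := hvt x a
    exact ⟨_, _, _, hmap φ _ _ _ _ h⟩
  obtain ⟨σ, hσ⟩ := exists_rot hu hq
  have s4 := fun v => (hσ v).1
  have sq := fun v => (hσ v).2
  have hμ : ∀ v, ∃ m, ∀ w, (G.Adj v w ∧ w ≠ σ v ∧ w ≠ σ (σ (σ v))) ↔ w = m := by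
    intro v
    have hc : (G.neighborFinset v \ {σ v, σ (σ (σ v))}).card = 1 := by
      rw [Finset.card_sdiff_of_subset, SimpleGraph.card_neighborFinset_eq_degree, hcubic v,
        Finset.card_pair (sq v).2.2.2.2.2]
      intro x hx
      simp at hx
      rw [SimpleGraph.mem_neighborFinset]
      rcases hx with rfl | rfl
      · exact (sq v).1
      · exact (sq v).2.2.2.1.symm
    obtain ⟨m, hm⟩ := Finset.card_eq_one.1 hc
    refine ⟨m, fun w => ?_⟩
    rw [← Finset.mem_singleton, ← hm]
    simp
  choose μ hμ using hμ
  have m0 : ∀ v, G.Adj v (μ v) ∧ μ v ≠ σ v ∧ μ v ≠ σ (σ (σ v)) := fun v => (hμ v _).2 rfl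
  have mm : ∀ v, μ (μ v) = v := by
    intro v
    symm
    rw [← hμ (μ v) v]
    refine ⟨(m0 v).1.symm, fun h => (m0 v).2.2 ?_, fun h => (m0 v).2.1 ?_⟩
    · conv_rhs => rw [h]
      rw [s4]
    · conv_rhs => rw [h]
      rw [s4]
  have hadj : ∀ v w, G.Adj v w ↔ w = σ v ∨ w = σ (σ (σ v)) ∨ w = μ v := by
    intro v w
    rw [← hμ v w]
    constructor
    · tauto
    · rintro (rfl | rfl | h)
      · exact (sq v).1
      · exact (sq v).2.2.2.1.symm
      · exact h.1
  have nq : ∀ v, ¬ G.Adj (μ (σ v)) (μ v) := by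
    intro v h
    have h5 : v ≠ μ (σ v) := by
      intro h'
      apply (m0 v).2.1
      conv_lhs => rw [h', mm]
    have hQ : Quad4 G v (σ v) (μ (σ v)) (μ v) :=
      ⟨(sq v).1, (m0 _).1, h, (m0 v).1.symm, h5, (m0 v).2.1.symm⟩
    rcases hu _ _ _ _ _ _ _ hQ (sq v) with ⟨_, _, h3⟩ | ⟨h3, _, _⟩
    · exact (m0 v).2.2 h3
    · exact (sq v).2.2.2.2.2 h3
  refine ⟨⟨σ, μ, s4, mm, hadj, fun v => (sq v).2.2.2.2.1.symm, fun v => (m0 v).1.ne',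
    fun v => (m0 v).2.1, ?_, fun v => (m0 v).2.2, ?_, ?_, ?_⟩⟩
  · intro v h
    have := (m0 v).1
    rw [h] at this
    exact hnt _ _ _ (sq v).1 (sq v).2.1 this.symm
  · intro v h
    apply nq v
    rw [h]; exact (sq (μ v)).1.symm
  · intro v h
    apply nq v
    rw [h]; exact (sq (μ v)).2.2.2.1
  · intro x y
    obtain ⟨φ, hφ⟩ := hvt x y
    have hc : ∀ v, (φ (σ v) = σ (φ v) ∧ φ (σ (σ (σ v))) = σ (σ (σ (φ v)))) ∨
        (φ (σ v) = σ (σ (σ (φ v))) ∧ φ (σ (σ (σ v))) = σ (φ v)) := by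
      intro v
      rcases hu _ _ _ _ _ _ _ (hmap φ _ _ _ _ (sq v)) (sq (φ v)) with h | h
      · exact Or.inl ⟨h.1, h.2.2⟩
      · exact Or.inr ⟨h.1, h.2.2⟩
    refine ⟨φ.toEquiv, hφ, fun v => ?_, fun v => (hc v).imp And.left And.left⟩
    change φ (μ v) = μ (φ v)
    rw [← hμ]
    refine ⟨φ.map_adj_iff.2 (m0 v).1, ?_, ?_⟩
    · intro h
      rcases hc v with h' | h'
      · rw [← h'.1] at h; exact (m0 v).2.1 (φ.injective h)
      · rw [← h'.2] at h; exact (m0 v).2.2 (φ.injective h)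
    · intro h
      rcases hc v with h' | h'
      · rw [← h'.2] at h; exact (m0 v).2.2 (φ.injective h)
      · rw [← h'.1] at h; exact (m0 v).2.1 (φ.injective h)
end QSec
section QSec
open Classical
namespace QS
variable {V : Type*} [Fintype V] {G : SimpleGraph V} (Q : QS G)

/-- edge boundary -/
def bd (G : SimpleGraph V) (S : Finset V) : Set (Sym2 V) :=
  {e | ∃ a b, a ∈ S ∧ b ∉ S ∧ G.Adj a b ∧ e = s(a, b)}

theorem bd_sub (S : Finset V) : bd G S ⊆ G.edgeSet := by
  rintro e ⟨a, b, _, _, h, rfl⟩; exact h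

theorem bd_adj (S : Finset V) (a b : V) :
    (G.deleteEdges (bd G S)).Adj a b ↔ G.Adj a b ∧ (a ∈ S ↔ b ∈ S) := by
  rw [SimpleGraph.deleteEdges_adj]
  constructor
  · rintro ⟨h, hn⟩
    refine ⟨h, ?_⟩
    by_contra hc
    apply hn
    by_cases ha : a ∈ S
    · exact ⟨a, b, ha, by tauto, h, rfl⟩
    · exact ⟨b, a, by tauto, ha, h.symm, Sym2.eq_swap⟩
  · rintro ⟨h, hi⟩
    refine ⟨h, ?_⟩
    rintro ⟨c, d, hc, hd, _, he⟩
    rcases Sym2.eq_iff.1 he with ⟨rfl, rfl⟩ | ⟨rfl, rfl⟩ <;> tauto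

theorem bd_reach (S : Finset V) {a b : V} (h : (G.deleteEdges (bd G S)).Reachable a b) :
    a ∈ S ↔ b ∈ S := by
  obtain ⟨p⟩ := h
  induction p with
  | nil => rfl
  | cons h p ih => exact ((bd_adj S _ _).1 h).2.trans ih

theorem bd_ncard (S : Finset V) : (bd G S).ncard = dd G S := by
  let P : Finset (V × V) := Finset.univ.filter fun p => p.1 ∈ S ∧ p.2 ∈ Sᶜ ∧ G.Adj p.1 p.2
  have h1 : dd G S = P.card := by
    simp only [dd, ee, P]
    rw [Finset.card_filter, Fintype.sum_prod_type]
  have h2 : bd G S = ((P.image fun p => s(p.1, p.2) : Finset (Sym2 V)) : Set (Sym2 V)) := by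
    ext e
    simp only [bd, Set.mem_ofPred_eq, Finset.coe_image, Set.mem_image, P, Finset.coe_filter,
      Finset.mem_univ, true_and, Finset.mem_compl, Prod.exists]
    constructor
    · rintro ⟨a, b, h1, h2, h3, rfl⟩; exact ⟨a, b, ⟨h1, h2, h3⟩, rfl⟩
    · rintro ⟨a, b, ⟨h1, h2, h3⟩, rfl⟩; exact ⟨a, b, h1, h2, h3, rfl⟩
  rw [h1, h2, Set.ncard_coe_finset, Finset.card_image_of_injOn]
  rintro ⟨a, b⟩ h ⟨c, d⟩ h' he
  simp [P] at h h'
  rcases Sym2.eq_iff.1 he with ⟨h1, h2⟩ | ⟨h1, h2⟩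
  · exact Prod.ext h1 h2
  · simp only at h1 h2; subst h1 h2; tauto

theorem quadH {T : Finset V} (hT : Q.Sat T) (x : V) :
    Quad4 (G.deleteEdges (bd G T)) x (Q.s x) (Q.s (Q.s x)) (Q.s (Q.s (Q.s x))) := by
  have hs : ∀ x, (G.deleteEdges (bd G T)).Adj x (Q.s x) := fun x =>
    (bd_adj T _ _).2 ⟨(Q.adj _ _).2 (Or.inl rfl), hT.iff.symm⟩
  refine ⟨hs _, hs _, hs _, ?_, (Q.s2 x).symm, (Q.s2 (Q.s x)).symm⟩
  have := hs (Q.s (Q.s (Q.s x)))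
  rwa [Q.s4] at this

theorem cut_C (x : V) : IsCyclicEdgeCut G (bd G (Q.C x)) := by
  obtain ⟨w, hw, -⟩ := quad_walk (Q.quadH (Q.Sat_C x) x)
  obtain ⟨w', hw', -⟩ := quad_walk (Q.quadH (Q.Sat_C x) (Q.u x))
  refine ⟨bd_sub _, _, _, w, w', hw, hw', fun h => ?_⟩
  exact Q.u_not_C x ((bd_reach _ h).1 (Q.C_self x))

theorem core {S : Finset V} {H : SimpleGraph V} (hH : H ≤ G) {a : V} (w : H.Walk a a)
    (hw : w.IsCycle) (hS : ∀ x, H.Reachable a x → x ∈ S) (hd : dd G S ≤ 4) : Q.Full S := by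
  refine Q.lemE (Z := w.support.toFinset) hd ?_ ⟨a, by simp⟩ ?_
  · intro x hx
    rw [List.mem_toFinset] at hx
    exact hS x (w.takeUntil x hx).reachable
  · intro z hz
    rw [List.mem_toFinset] at hz
    have h2 := hw.ncard_neighborSet_toSubgraph_eq_two hz
    obtain ⟨p, q, hpq, he⟩ := Set.ncard_eq_two.1 h2
    have hp : p ∈ w.toSubgraph.neighborSet z := by rw [he]; simp
    have hq : q ∈ w.toSubgraph.neighborSet z := by rw [he]; simp
    rw [SimpleGraph.Subgraph.mem_neighborSet] at hp hq
    refine ⟨p, ?_, q, ?_, hpq, hH hp.adj_sub, hH hq.adj_sub⟩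
    · rw [List.mem_toFinset, ← SimpleGraph.Walk.mem_verts_toSubgraph]
      exact hp.snd_mem
    · rw [List.mem_toFinset, ← SimpleGraph.Walk.mem_verts_toSubgraph]
      exact hq.snd_mem

theorem fin_C (x : V) {F : Set (Sym2 V)} (hF : F = bd G (Q.C x)) :
    HasCycleComponentOfLength (G.deleteEdges F) 4 := by
  subst hF
  obtain ⟨w, hw, hl, hs, he⟩ := quad_walk (Q.quadH (Q.Sat_C x) x)
  refine ⟨x, w, hw, hl, ?_, ?_⟩
  · intro y hy
    rw [hs, ← Q.mem_C]
    exact (bd_reach _ hy).1 (Q.C_self x)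
  · intro e hE hr
    obtain ⟨y, hy, hr⟩ := hr
    have hyC := (bd_reach _ hr).1 (Q.C_self x)
    obtain ⟨z, rfl⟩ := Sym2.mem_iff_exists.1 hy
    rw [SimpleGraph.mem_edgeSet, bd_adj] at hE
    have hzC := hE.2.1 hyC
    rw [he]
    rcases (Q.adj y z).1 hE.1 with h | h | h
    · rcases Q.mem_C.1 hyC with h' | h' | h' | h' <;> subst h' <;> subst h <;> simp [Q.s4]
    · rcases Q.mem_C.1 hyC with h' | h' | h' | h' <;> subst h' <;> subst h <;> simp [Q.s4]
    · rw [h] at hzC; exact absurd hzC (Q.u_not_C' hyC)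

theorem bd_compl (S : Finset V) : bd G Sᶜ = bd G S := by
  ext e
  constructor
  · rintro ⟨a, b, h1, h2, h3, rfl⟩
    exact ⟨b, a, by simpa using h2, by simpa using h1, h3.symm, Sym2.eq_swap⟩
  · rintro ⟨a, b, h1, h2, h3, rfl⟩
    exact ⟨b, a, by simpa using h2, by simpa using h1, h3.symm, Sym2.eq_swap⟩

theorem final (Q : QS G) (hconn : G.Connected)
    (hTm : ∀ m : ℕ, 2 ≤ m → ∀ Mc : Bool, ¬ Nonempty (G ≃g TmGraph m Mc)) (F : Set (Sym2 V))
    (hF : IsCyclicEdgeCut G F) (hmin : ∀ F', IsCyclicEdgeCut G F' → F.ncard ≤ F'.ncard) :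
    HasCycleComponentOfLength (G.deleteEdges F) 4 := by
  obtain ⟨hFs, a, b, c, c', hc, hc', hnr⟩ := hF
  let S : Finset V := Finset.univ.filter fun x => (G.deleteEdges F).Reachable a x
  have hS : ∀ x, x ∈ S ↔ (G.deleteEdges F).Reachable a x := by intro x; simp [S]
  have hsub : bd G S ⊆ F := by
    rintro e ⟨x, y, hx, hy, hadj, rfl⟩
    by_contra hno
    apply hy
    rw [hS] at hx ⊢
    exact hx.trans (SimpleGraph.Adj.reachable (SimpleGraph.deleteEdges_adj.2 ⟨hadj, hno⟩))
  have hle : G.deleteEdges F ≤ G.deleteEdges (bd G S) := SimpleGraph.deleteEdges_anti hsub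
  have hcut : IsCyclicEdgeCut G (bd G S) := by
    refine ⟨bd_sub S, a, b, c.mapLe hle, c'.mapLe hle, hc.mapLe hle, hc'.mapLe hle, fun h => ?_⟩
    apply hnr
    rw [← hS]
    exact (bd_reach S h).1 ((hS a).2 (SimpleGraph.Reachable.refl a))
  have hFeq : bd G S = F := Set.eq_of_subset_of_ncard_le hsub (hmin _ hcut) (Set.toFinite F)
  have h4 : dd G S ≤ 4 := by
    rw [← bd_ncard, hFeq, ← Q.dd_C a, ← bd_ncard]
    exact hmin _ (Q.cut_C a)
  have f1 : Q.Full S := Q.core (SimpleGraph.deleteEdges_le F) c hc (fun x hx => (hS x).2 hx) h4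
  have f2 : Q.Full Sᶜ := by
    refine Q.core (SimpleGraph.deleteEdges_le F) c' hc' (fun x hx => ?_) (by rw [dd_compl]; exact h4)
    rw [Finset.mem_compl, hS]
    exact fun h => hnr (h.trans hx.symm)
  have h4' := Q.lemB hconn _ S rfl f1 f2
  rcases Q.lemD hconn _ S rfl f1 f2 (by omega) with ⟨x, hx⟩ | ⟨x, hx⟩ | h
  · exact Q.fin_C x (by rw [← hx, hFeq])
  · exact Q.fin_C x (by rw [← hx, bd_compl, hFeq])
  · obtain ⟨A1, uss⟩ := Q.struct h
    have := hconn.nonempty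
    obtain ⟨m, hm, b, hi⟩ := Q.tm_iso hconn A1 uss
    exact absurd hi (hTm m hm b)
end QS
end QSec

/-- A finite connected cubic vertex-transitive graph of girth 4 with no two adjacent
quadrangles that is not isomorphic to `T_m` for any `m ≥ 2` is super cyclically
edge-connected: any minimum cyclic edge-cut leaves a component which is a cycle of
length 4. -/
theorem cubic_girth_four_super_cyclically_edge_connected {V : Type*} [Fintype V]
    (G : SimpleGraph V) [DecidableRel G.Adj] (hconn : G.Connected)
    (hcubic : G.IsRegularOfDegree 3) (hvt : IsVertexTransitive G) (hg : G.girth = 4)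
    (hquad : ∀ (u v : V) (c : G.Walk u u) (c' : G.Walk v v),
      c.IsCycle → c'.IsCycle → c.length = 4 → c'.length = 4 →
      (∃ w, w ∈ c.support ∧ w ∈ c'.support) → ∀ e, e ∈ c.edges ↔ e ∈ c'.edges)
    (hTm : ∀ m : ℕ, 2 ≤ m → ∀ Mc : Bool, ¬ Nonempty (G ≃g TmGraph m Mc)) :
    ∀ F : Set (Sym2 V), IsCyclicEdgeCut G F →
      (∀ F', IsCyclicEdgeCut G F' → F.ncard ≤ F'.ncard) →
      HasCycleComponentOfLength (G.deleteEdges F) 4 := by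
  obtain ⟨Q⟩ := exists_QS G hconn hcubic hvt hg hquad
  exact fun F hF hmin => Q.final hconn hTm F hF hmin
end

section
/- For every integer m ≥ 3 and either choice of the matching M, the graph T_m is 2-extendable. -/
open SimpleGraph

namespace TmAux

/-- Canonical graph: `(t, s, i)`; `s = true` is the right side of column `t`. -/
def H {m : ℕ} (σ : Equiv.Perm (Fin m)) : SimpleGraph (Fin m × Bool × Bool) :=
  SimpleGraph.fromRel fun p q =>
    p.2.1 = true ∧ q.2.1 = false ∧ (q.1 = p.1 ∨ (q.1 = σ p.1 ∧ q.2.2 = p.2.2))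

/-- pairs of disjoint edges extend to fixed-point-free involutions along edges -/
def Ext {V : Type*} (G : SimpleGraph V) : Prop :=
  ∀ a b c d : V, G.Adj a b → G.Adj c d → a ≠ c → a ≠ d → b ≠ c → b ≠ d →
    ∃ f : V → V, (∀ v, G.Adj v (f v)) ∧ (∀ v, f (f v) = v) ∧ f a = b ∧ f c = d

theorem Ext.of_equiv {V W : Type*} {G : SimpleGraph V} {K : SimpleGraph W} (e : V ≃ W)
    (he : ∀ p q, G.Adj p q ↔ K.Adj (e p) (e q)) (h : Ext K) : Ext G := by
  intro a b c d hab hcd h1 h2 h3 h4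
  obtain ⟨f, hf, hff, h5, h6⟩ := h (e a) (e b) (e c) (e d) ((he _ _).1 hab) ((he _ _).1 hcd)
    (by simpa) (by simpa) (by simpa) (by simpa)
  refine ⟨fun v => e.symm (f (e v)), fun v => ?_, fun v => ?_, ?_, ?_⟩
  · rw [he]; simpa using hf (e v)
  · simp [hff]
  · simp [h5]
  · simp [h6]

theorem exists_perfect {V : Type*} (G : SimpleGraph V) (f : V → V) (hf : ∀ v, G.Adj v (f v))
    (hff : ∀ v, f (f v) = v) :
    ∃ P : G.Subgraph, P.IsPerfectMatching ∧ ∀ v, P.Adj v (f v) := by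
  refine ⟨{ verts := Set.univ, Adj := fun a b => f a = b, adj_sub := ?_, edge_vert := ?_,
            symm := ?_ }, ?_, ?_⟩
  · rintro a b rfl; exact hf a
  · intros; trivial
  · constructor; rintro a b rfl; exact hff a
  · rw [Subgraph.isPerfectMatching_iff]
    intro v
    exact ⟨f v, rfl, fun y hy => Eq.symm (show f v = y from hy)⟩
  · intro v; rfl

theorem Ext.extend {V : Type*} {G : SimpleGraph V} (h : Ext G) (M : G.Subgraph)
    (hM : M.IsMatching) (hc : M.edgeSet.ncard = 2) :
    ∃ P : G.Subgraph, P.IsPerfectMatching ∧ M.edgeSet ⊆ P.edgeSet := by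
  obtain ⟨x, y, hxy, hs⟩ := Set.ncard_eq_two.1 hc
  induction x using Sym2.ind with | _ a b
  induction y using Sym2.ind with | _ c d
  have hab : M.Adj a b := by
    rw [← Subgraph.mem_edgeSet, hs]; simp
  have hcd : M.Adj c d := by
    rw [← Subgraph.mem_edgeSet, hs]; simp
  have key : ∀ u v w, M.Adj u v → M.Adj u w → v = w := fun u v w h1 h2 =>
    hM.eq_of_adj_left h1 h2
  obtain ⟨f, hf, hff, h5, h6⟩ := h a b c d hab.adj_sub hcd.adj_sub
    (by rintro rfl; exact hxy (by rw [key _ _ _ hab hcd]))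
    (by rintro rfl; exact hxy (by rw [key _ _ _ hab hcd.symm, Sym2.eq_swap]))
    (by rintro rfl; exact hxy (by rw [key _ _ _ hab.symm hcd, Sym2.eq_swap]))
    (by rintro rfl; exact hxy (by rw [key _ _ _ hab.symm hcd.symm]))
  obtain ⟨P, hP, hPf⟩ := exists_perfect G f hf hff
  refine ⟨P, hP, ?_⟩
  rw [hs]
  rintro e (rfl | rfl)
  · rw [Subgraph.mem_edgeSet, ← h5]; exact hPf a
  · rw [Subgraph.mem_edgeSet, ← h6]; exact hPf c

/-- all link edges -/
theorem H_two {m : ℕ} (σ : Equiv.Perm (Fin m)) :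
    ∃ f : Fin m × Bool × Bool → Fin m × Bool × Bool, (∀ v, (H σ).Adj v (f v)) ∧
      (∀ v, f (f v) = v) ∧ (∀ t i, f (t, true, i) = (σ t, false, i)) ∧
      (∀ t i, f (σ t, false, i) = (t, true, i)) := by
  refine ⟨fun v => if v.2.1 then (σ v.1, false, v.2.2) else (σ.symm v.1, true, v.2.2), ?_, ?_,
    ?_, ?_⟩
  · rintro ⟨t, s, i⟩; cases s <;> simp [H]
  · rintro ⟨t, s, i⟩; cases s <;> simp
  · simp
  · simp

theorem H_zero {m : ℕ} (σ : Equiv.Perm (Fin m)) (c : Fin m → Bool) :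
    ∃ f : Fin m × Bool × Bool → Fin m × Bool × Bool, (∀ v, (H σ).Adj v (f v)) ∧
      (∀ v, f (f v) = v) ∧ (∀ t s i, f (t, s, i) = (t, !s, xor i (c t))) := by
  refine ⟨fun v => (v.1, !v.2.1, xor v.2.2 (c v.1)), ?_, ?_, ?_⟩
  · rintro ⟨t, s, i⟩; cases s <;> simp [H]
  · rintro ⟨t, s, i⟩; simp
  · simp

theorem H_one {m : ℕ} (σ : Equiv.Perm (Fin m)) (d : Fin m → Bool) :
    ∃ f : Fin m × Bool × Bool → Fin m × Bool × Bool, (∀ v, (H σ).Adj v (f v)) ∧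
      (∀ v, f (f v) = v) ∧ (∀ t, f (t, true, d t) = (σ t, false, d t)) ∧
      (∀ t, f (σ t, false, d t) = (t, true, d t)) ∧
      (∀ t, f (σ t, true, !d (σ t)) = (σ t, false, !d t)) ∧
      (∀ t, f (σ t, false, !d t) = (σ t, true, !d (σ t))) := by
  refine ⟨fun v => if v.2.1 then
      (if v.2.2 = d v.1 then (σ v.1, false, v.2.2) else (v.1, false, !d (σ.symm v.1)))
      else (if v.2.2 = d (σ.symm v.1) then (σ.symm v.1, true, v.2.2) else (v.1, true, !d v.1)),
      ?_, ?_, ?_, ?_, ?_, ?_⟩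
  · rintro ⟨t, s, i⟩; cases s <;> simp only [H] <;> split_ifs <;> simp_all
  · rintro ⟨t, s, i⟩
    cases s
    · by_cases h : i = d (σ.symm t)
      · simp [h]
      · simp [h]; cases i <;> cases h' : d (σ.symm t) <;> simp_all
    · by_cases h : i = d t
      · simp [h]
      · simp [h]; cases i <;> cases h' : d t <;> simp_all
  all_goals simp

/-- link edge plus column edge, oriented from right to left -/
theorem H_mixed {m : ℕ} (σ : Equiv.Perm (Fin m)) (hσ : ∀ t, σ t ≠ t) (s t : Fin m)
    (i a b : Bool) (h1 : s = σ t → i ≠ b) (h2 : s = t → i ≠ a) :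
    ∃ f : Fin m × Bool × Bool → Fin m × Bool × Bool, (∀ v, (H σ).Adj v (f v)) ∧
      (∀ v, f (f v) = v) ∧ f (s, true, i) = (σ s, false, i) ∧
      f (σ t, true, b) = (σ t, false, a) := by
  obtain ⟨f, hf, hff, h3, h4, h5, h6⟩ := H_one σ
    (fun u => if u = t then !a else if u = σ t then !b else i)
  refine ⟨f, hf, hff, ?_, ?_⟩
  · have := h3 s
    by_cases e1 : s = t
    · have h7 : i = !a := by have h8 := h2 e1; clear * - h8; revert i a; decide
      rw [if_pos e1, ← h7] at this
      exact this
    · by_cases e2 : s = σ t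
      · have h7 : i = !b := by have h8 := h1 e2; clear * - h8; revert i b; decide
        rw [if_neg e1, if_pos e2, ← h7] at this
        exact this
      · rw [if_neg e1, if_neg e2] at this
        exact this
  · have := h5 t
    simpa [hσ t] using this

/-- extension for edges oriented right to left -/
theorem H_or {m : ℕ} (σ : Equiv.Perm (Fin m)) (hσ : ∀ t, σ t ≠ t)
    (s t s' t' : Fin m) (i j i' j' : Bool)
    (h : s' = s ∨ (s' = σ s ∧ i' = i)) (h' : t' = t ∨ (t' = σ t ∧ j' = j))
    (hr : ¬ (s = t ∧ i = j)) (hl : ¬ (s' = t' ∧ i' = j')) :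
    ∃ f : Fin m × Bool × Bool → Fin m × Bool × Bool, (∀ v, (H σ).Adj v (f v)) ∧
      (∀ v, f (f v) = v) ∧ f (s, true, i) = (s', false, i') ∧
      f (t, true, j) = (t', false, j') := by
  rcases h with rfl | ⟨rfl, rfl⟩ <;> rcases h' with rfl | ⟨rfl, rfl⟩
  · obtain ⟨f, hf, hff, h3⟩ := H_zero σ (fun u => if u = s' then xor i i' else xor j j')
    refine ⟨f, hf, hff, ?_, ?_⟩
    · rw [h3]; simp
    · rw [h3]
      by_cases e : t' = s'
      · subst e
        cases i <;> cases i' <;> cases j <;> cases j' <;> simp_all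
      · simp [e]
  · obtain ⟨u, rfl⟩ := σ.surjective s'
    obtain ⟨f, hf, hff, h3, h4⟩ := H_mixed σ hσ t u j' i' i
      (by rintro rfl; grind) (by rintro rfl; grind)
    exact ⟨f, hf, hff, h4, h3⟩
  · obtain ⟨u, rfl⟩ := σ.surjective t'
    obtain ⟨f, hf, hff, h3, h4⟩ := H_mixed σ hσ s u i' j' j
      (by rintro rfl; grind) (by rintro rfl; grind)
    exact ⟨f, hf, hff, h3, h4⟩
  · obtain ⟨f, hf, hff, h3, h4⟩ := H_two σ
    exact ⟨f, hf, hff, h3 _ _, h3 _ _⟩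

theorem H_ext {m : ℕ} (σ : Equiv.Perm (Fin m)) (hσ : ∀ t, σ t ≠ t) : Ext (H σ) := by
  rintro ⟨at', as, ai⟩ ⟨bt, bs, bi⟩ ⟨ct, cs, ci⟩ ⟨dt, ds, di⟩ hab hcd h1 h2 h3 h4
  simp only [H, SimpleGraph.fromRel_adj] at hab hcd
  have sw : ∀ (f : Fin m × Bool × Bool → Fin m × Bool × Bool) (x y), (∀ v, f (f v) = v) →
      f x = y → f y = x := by
    rintro f x y h rfl; exact h x
  rcases hab with ⟨-, ⟨rfl, rfl, h⟩ | ⟨rfl, rfl, h⟩⟩ <;>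
  rcases hcd with ⟨-, ⟨rfl, rfl, h'⟩ | ⟨rfl, rfl, h'⟩⟩ <;>
  simp only [ne_eq, Prod.mk.injEq, true_and] at h1 h2 h3 h4
  · obtain ⟨f, hf, hff, h5, h6⟩ := H_or σ hσ _ _ _ _ _ _ _ _ h h' h1 h4
    exact ⟨f, hf, hff, h5, h6⟩
  · obtain ⟨f, hf, hff, h5, h6⟩ := H_or σ hσ _ _ _ _ _ _ _ _ h h' h2 h3
    exact ⟨f, hf, hff, h5, sw _ _ _ hff h6⟩
  · obtain ⟨f, hf, hff, h5, h6⟩ := H_or σ hσ _ _ _ _ _ _ _ _ h h' h3 h2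
    exact ⟨f, hf, hff, sw _ _ _ hff h5, h6⟩
  · obtain ⟨f, hf, hff, h5, h6⟩ := H_or σ hσ _ _ _ _ _ _ _ _ h h' h4 h1
    exact ⟨f, hf, hff, sw _ _ _ hff h5, sw _ _ _ hff h6⟩

/-- row code: `p` = column is odd, `b` = flip the right side -/
def code (p b : Bool) (r : ZMod 4) : Bool × Bool :=
  let odd : Bool := decide (r = 1 ∨ r = 3)
  let hi : Bool := decide (r = 2 ∨ r = 3)
  (xor odd p, xor hi (xor odd p && b))

theorem code_bij (p b : Bool) : Function.Bijective (code p b) := by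
  revert p b; decide

def flipc (m : ℕ) (Mc : Bool) (t : Fin m) : Bool :=
  decide ((t : ℕ) = m - 1) && (Mc == decide (m % 2 = 1))

def emap (m : ℕ) (Mc : Bool) (v : ZMod 4 × Fin m) : Fin m × Bool × Bool :=
  (v.2, code (decide ((v.2 : ℕ) % 2 = 1)) (flipc m Mc v.2) v.1)

theorem emap_bij (m : ℕ) (Mc : Bool) : Function.Bijective (emap m Mc) := by
  constructor
  · rintro ⟨r, t⟩ ⟨r', t'⟩ h
    simp only [emap, Prod.mk.injEq] at h
    obtain ⟨rfl, h⟩ := h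
    rw [(code_bij _ _).1 h]
  · rintro ⟨t, c⟩
    obtain ⟨r, hr⟩ := (code_bij (decide ((t : ℕ) % 2 = 1)) (flipc m Mc t)).2 c
    exact ⟨(r, t), by simp [emap, hr]⟩

theorem rot_val {m : ℕ} (hm : 3 ≤ m) (t : Fin m) :
    ((finRotate m t : Fin m) : ℕ) = if (t : ℕ) = m - 1 then 0 else (t : ℕ) + 1 := by
  obtain ⟨n, rfl⟩ : ∃ n, m = n + 1 := ⟨m - 1, by omega⟩
  rw [coe_finRotate]
  simp [Fin.ext_iff]

set_option linter.unusedSimpArgs false in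
set_option maxHeartbeats 4000000 in
theorem emap_adj (m : ℕ) (hm : 3 ≤ m) (Mc : Bool) (p q : ZMod 4 × Fin m) :
    (TmGraph m Mc).Adj p q ↔ (H (finRotate m)).Adj (emap m Mc p) (emap m Mc q) := by
  simp only [H, TmGraph, SimpleGraph.fromRel_adj, (emap_bij m Mc).1.ne_iff]
  obtain ⟨r, t⟩ := p
  obtain ⟨r', t'⟩ := q
  have e1 := rot_val hm t
  have e2 := rot_val hm t'
  have l1 := t.2
  have l2 := t'.2
  simp only [emap, code, flipc, ne_eq, Prod.mk.injEq, Fin.ext_iff, e1, e2]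
  clear e1 e2
  generalize (t : ℕ) = x at *
  generalize (t' : ℕ) = y at *
  have d01 : ¬ (0 : ZMod 4) = 1 := by decide
  have d02 : ¬ (0 : ZMod 4) = 2 := by decide
  have d03 : ¬ (0 : ZMod 4) = 3 := by decide
  have d10 : ¬ (1 : ZMod 4) = 0 := by decide
  have d12 : ¬ (1 : ZMod 4) = 2 := by decide
  have d13 : ¬ (1 : ZMod 4) = 3 := by decide
  have d20 : ¬ (2 : ZMod 4) = 0 := by decide
  have d21 : ¬ (2 : ZMod 4) = 1 := by decide
  have d23 : ¬ (2 : ZMod 4) = 3 := by decide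
  have d30 : ¬ (3 : ZMod 4) = 0 := by decide
  have d31 : ¬ (3 : ZMod 4) = 1 := by decide
  have d32 : ¬ (3 : ZMod 4) = 2 := by decide
  have a0 : (0 : ZMod 4) + 1 = 1 := by decide
  have a1 : (1 : ZMod 4) + 1 = 2 := by decide
  have a2 : (2 : ZMod 4) + 1 = 3 := by decide
  have a3 : (3 : ZMod 4) + 1 = 0 := by decide
  have rc : ∀ r : ZMod 4, r = 0 ∨ r = 1 ∨ r = 2 ∨ r = 3 := by decide
  rcases rc r with rfl | rfl | rfl | rfl <;> rcases rc r' with rfl | rfl | rfl | rfl <;>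
  rcases Nat.mod_two_eq_zero_or_one x with hx | hx <;>
  rcases Nat.mod_two_eq_zero_or_one y with hy | hy <;>
  rcases Nat.mod_two_eq_zero_or_one m with hm2 | hm2 <;>
  cases Mc <;>
  simp only [hm2, a0, a1, a2, a3, d01, d02, d03, d10, d12, d13, d20, d21, d23, d30, d31, d32, hx, hy,
    true_and, and_true, false_and, and_false, true_or, or_true, false_or, or_false,
    decide_true, decide_false, Bool.xor_false, Bool.xor_true, Bool.false_xor, Bool.true_xor,
    Bool.not_true, Bool.not_false, Bool.false_and, Bool.true_and, Bool.and_false,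
    reduceCtorEq, zero_ne_one, one_ne_zero, not_false_eq_true, not_true_eq_false,
    Bool.true_eq_false, Bool.false_eq_true] <;>
  (try simp) <;> (try omega) <;> (try grind)

end TmAux

/-- For every `m ≥ 3` and either choice of the matching, `T_m` is 2-extendable. -/
theorem TmGraph_two_extendable (m : ℕ) (hm : 3 ≤ m) (Mc : Bool) :
    IsNExtendable (TmGraph m Mc) 2 := by
  have hext : TmAux.Ext (TmGraph m Mc) := by
    refine TmAux.Ext.of_equiv (Equiv.ofBijective _ (TmAux.emap_bij m Mc))
      (TmAux.emap_adj m hm Mc) (TmAux.H_ext _ ?_)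
    intro t h
    have := congrArg Fin.val h
    rw [TmAux.rot_val hm] at this
    split_ifs at this <;> omega
  refine ⟨?_, ?_, fun M => hext.extend M⟩
  · simp [ZMod.card]; omega
  · have a1 : (TmGraph m Mc).Adj (0, ⟨0, by omega⟩) (1, ⟨0, by omega⟩) := by
      simp [TmGraph]
      decide
    have a2 : (TmGraph m Mc).Adj (0, ⟨1, by omega⟩) (1, ⟨1, by omega⟩) := by
      simp [TmGraph]
      decide
    refine ⟨(TmGraph m Mc).subgraphOfAdj a1 ⊔ (TmGraph m Mc).subgraphOfAdj a2, ?_, ?_⟩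
    · refine Subgraph.IsMatching.sup (Subgraph.IsMatching.subgraphOfAdj a1)
        (Subgraph.IsMatching.subgraphOfAdj a2) ?_
      rw [(Subgraph.IsMatching.subgraphOfAdj a1).support_eq_verts,
        (Subgraph.IsMatching.subgraphOfAdj a2).support_eq_verts]
      simp
    · rw [Subgraph.edgeSet_sup, edgeSet_subgraphOfAdj, edgeSet_subgraphOfAdj]
      rw [Set.singleton_union, Set.ncard_pair]
      simp
end

section
/- Let G be a finite connected cubic vertex-transitive graph of girth 5 that is uniformly cyclically 5-edge-connected (U(5)). If G contains a subgraph isomorphic to the rosette, then G is isomorphic to the dodecahedron GP(10,2). -/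
open SimpleGraph

/-- The generalized Petersen graph `GP(n,k)`, with outer vertices `Sum.inl i` and
inner vertices `Sum.inr i`, `i ∈ ZMod n`. -/
def genPetersen (n k : ℕ) : SimpleGraph (ZMod n ⊕ ZMod n) :=
  SimpleGraph.fromRel fun p q =>
    (∃ i : ZMod n, p = Sum.inl i ∧ q = Sum.inl (i + 1)) ∨
    (∃ i : ZMod n, p = Sum.inl i ∧ q = Sum.inr i) ∨
    (∃ i : ZMod n, p = Sum.inr i ∧ q = Sum.inr (i + (k : ZMod n)))

/-- `G` is uniformly cyclically 5-edge-connected: `cλ(G) = 5` and every edge of `G`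
lies in some cyclic edge-cut of cardinality 5. -/
def IsU5 {V : Type*} (G : SimpleGraph V) : Prop :=
  (∃ F, IsCyclicEdgeCut G F ∧ F.ncard = 5) ∧
    (∀ F, IsCyclicEdgeCut G F → 5 ≤ F.ncard) ∧
    ∀ e ∈ G.edgeSet, ∃ F, IsCyclicEdgeCut G F ∧ F.ncard = 5 ∧ e ∈ F

/-- The rosette: vertex `(0, i)` is `c_{i+1}`, `(1, i)` is `a_{i+1}`, `(2, i)` is `u_{i+1}`,
with edges `c_i c_{i+1}`, `c_i a_i`, `a_i u_i`, `u_i a_{i+1}` (indices modulo 5). -/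
def rosette : SimpleGraph (Fin 3 × ZMod 5) :=
  SimpleGraph.fromRel fun p q =>
    (p.1 = 0 ∧ q.1 = 0 ∧ q.2 = p.2 + 1) ∨
    (p.1 = 0 ∧ q.1 = 1 ∧ q.2 = p.2) ∨
    (p.1 = 1 ∧ q.1 = 2 ∧ q.2 = p.2) ∨
    (p.1 = 2 ∧ q.1 = 1 ∧ q.2 = p.2 + 1)

theorem nbr_aux {V : Type*} [Fintype V] (G : SimpleGraph V) [DecidableRel G.Adj]
    (hcubic : G.IsRegularOfDegree 3) {v x y z : V} (hx : G.Adj v x) (hy : G.Adj v y)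
    (hz : G.Adj v z) (hxy : x ≠ y) (hxz : x ≠ z) (hyz : y ≠ z) (t : V) (ht : G.Adj v t) :
    t = x ∨ t = y ∨ t = z := by
  classical
  have h : ({x, y, z} : Finset V) = G.neighborFinset v := by
    apply Finset.eq_of_subset_of_card_le
    · intro s hs
      simp only [Finset.mem_insert, Finset.mem_singleton] at hs
      rw [mem_neighborFinset]
      rcases hs with rfl | rfl | rfl <;> assumption
    · rw [card_neighborFinset_eq_degree, hcubic v, Finset.card_eq_three.2 ⟨x, y, z, hxy, hxz, hyz, rfl⟩]
  have : t ∈ ({x, y, z} : Finset V) := by rw [h, mem_neighborFinset]; exact ht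
  simpa using this

theorem third_aux {V : Type*} [Fintype V] (G : SimpleGraph V) [DecidableRel G.Adj]
    (hcubic : G.IsRegularOfDegree 3) (v x y : V) : ∃ z, G.Adj v z ∧ z ≠ x ∧ z ≠ y := by
  classical
  have h : ({x, y} : Finset V).card < (G.neighborFinset v).card := by
    rw [card_neighborFinset_eq_degree, hcubic v]
    exact lt_of_le_of_lt Finset.card_le_two (by norm_num)
  obtain ⟨z, hz, hn⟩ := Finset.exists_mem_notMem_of_card_lt_card h
  simp only [Finset.mem_insert, Finset.mem_singleton, not_or] at hn
  exact ⟨z, (mem_neighborFinset _ _ _).1 hz, hn.1, hn.2⟩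

theorem iso_aux {V W : Type*} [Fintype V] [Fintype W] (G : SimpleGraph V) [DecidableRel G.Adj]
    (H : SimpleGraph W) [DecidableRel H.Adj] [Nonempty W]
    (hG : G.IsRegularOfDegree 3) (hH : H.IsRegularOfDegree 3) (hconn : G.Connected)
    (g : W → V) (hinj : Function.Injective g) (hadj : ∀ x y, H.Adj x y → G.Adj (g x) (g y)) :
    Nonempty (G ≃g H) := by
  classical
  have key : ∀ x, (H.neighborFinset x).image g = G.neighborFinset (g x) := by
    intro x
    apply Finset.eq_of_subset_of_card_le
    · intro s hs
      obtain ⟨t, ht, rfl⟩ := Finset.mem_image.1 hs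
      rw [mem_neighborFinset] at ht ⊢
      exact hadj _ _ ht
    · rw [Finset.card_image_of_injective _ hinj, card_neighborFinset_eq_degree,
        card_neighborFinset_eq_degree, hG, hH]
  have key2 : ∀ x v, G.Adj (g x) v → ∃ y, H.Adj x y ∧ g y = v := by
    intro x v h
    have : v ∈ (H.neighborFinset x).image g := by rw [key, mem_neighborFinset]; exact h
    obtain ⟨t, ht, rfl⟩ := Finset.mem_image.1 this
    exact ⟨t, (mem_neighborFinset _ _ _).1 ht, rfl⟩
  have walk : ∀ u v, G.Walk u v → (∃ x, g x = u) → ∃ y, g y = v := by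
    intro u v p
    induction p with
    | nil => exact id
    | cons h p ih =>
      rintro ⟨x, rfl⟩
      obtain ⟨y, _, hy⟩ := key2 x _ h
      exact ih ⟨y, hy⟩
  have hsurj : Function.Surjective g := by
    intro v
    obtain ⟨x⟩ := ‹Nonempty W›
    obtain ⟨p⟩ := hconn.preconnected (g x) v
    exact walk _ _ p ⟨x, rfl⟩
  refine ⟨Iso.symm ⟨Equiv.ofBijective g ⟨hinj, hsurj⟩, ?_⟩⟩
  intro x y
  show G.Adj (g x) (g y) ↔ H.Adj x y
  refine ⟨fun h => ?_, hadj x y⟩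
  obtain ⟨z, hz, e⟩ := key2 x _ h
  rwa [← hinj e]

def gpe : ZMod 10 ⊕ ZMod 10 → Fin 4 × ZMod 5
  | Sum.inl n => (if n.val % 2 = 0 then 1 else 2, ((n.val / 2 : ℕ) : ZMod 5))
  | Sum.inr n => (if n.val % 2 = 0 then 0 else 3, ((n.val / 2 : ℕ) : ZMod 5))

instance gpDec : DecidableRel (genPetersen 10 2).Adj := fun p q => by
  unfold genPetersen
  rw [SimpleGraph.fromRel_adj]
  infer_instance

def dodRel (p q : Fin 4 × ZMod 5) : Prop :=
    (p.1 = 0 ∧ q.1 = 0 ∧ q.2 = p.2 + 1) ∨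
    (p.1 = 0 ∧ q.1 = 1 ∧ q.2 = p.2) ∨
    (p.1 = 1 ∧ q.1 = 2 ∧ q.2 = p.2) ∨
    (p.1 = 2 ∧ q.1 = 1 ∧ q.2 = p.2 + 1) ∨
    (p.1 = 2 ∧ q.1 = 3 ∧ q.2 = p.2) ∨
    (p.1 = 3 ∧ q.1 = 3 ∧ q.2 = p.2 + 1)

instance (p q) : Decidable (dodRel p q) := by unfold dodRel; infer_instance

set_option maxRecDepth 100000 in
theorem gpe_inj : Function.Injective gpe := by decide

set_option maxRecDepth 100000 in
set_option maxHeartbeats 2000000 in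
theorem gp_reg : (genPetersen 10 2).IsRegularOfDegree 3 := by
  unfold IsRegularOfDegree
  decide +kernel

set_option maxRecDepth 100000 in
set_option maxHeartbeats 2000000 in
theorem gpe_adj : ∀ p q, (genPetersen 10 2).Adj p q →
    dodRel (gpe p) (gpe q) ∨ dodRel (gpe q) (gpe p) := by
  decide +kernel

theorem core_aux {V : Type*} [Fintype V]
    (G : SimpleGraph V) [DecidableRel G.Adj] (hconn : G.Connected)
    (hcubic : G.IsRegularOfDegree 3)
    (pent : ∀ v x y, G.Adj v x → G.Adj v y → x ≠ y → ∃ p q, G.Adj x p ∧ G.Adj p q ∧ G.Adj q y ∧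
      p ≠ v ∧ q ≠ v ∧ p ≠ y ∧ q ≠ x)
    (c a u : ZMod 5 → V)
    (cc : ∀ i j, c i = c j → i = j) (aa : ∀ i j, a i = a j → i = j)
    (uu : ∀ i j, u i = u j → i = j) (ca : ∀ i j, c i ≠ a j) (cu : ∀ i j, c i ≠ u j)
    (au : ∀ i j, a i ≠ u j)
    (Acc : ∀ i, G.Adj (c i) (c (i + 1))) (Aca : ∀ i, G.Adj (c i) (a i))
    (Aau : ∀ i, G.Adj (a i) (u i)) (Aua : ∀ i, G.Adj (u i) (a (i + 1))) :
    Nonempty (G ≃g genPetersen 10 2) := by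
  have s1 : ∀ i : ZMod 5, i - 1 + 1 = i := by decide
  have n1 : ∀ i : ZMod 5, i + 1 ≠ i := by decide
  have Nc : ∀ i t, G.Adj (c i) t → t = c (i + 1) ∨ t = c (i - 1) ∨ t = a i := by
    intro i
    have h := (Acc (i - 1)).symm
    rw [s1] at h
    refine nbr_aux G hcubic (Acc i) h (Aca i) ?_ (ca _ _) (ca _ _)
    intro e
    have := cc _ _ e
    clear * - this; revert i; decide
  have Na : ∀ i t, G.Adj (a i) t → t = c i ∨ t = u i ∨ t = u (i - 1) := by
    intro i
    have h := (Aua (i - 1)).symm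
    rw [s1] at h
    refine nbr_aux G hcubic (Aca i).symm (Aau i) h (cu _ _) (cu _ _) ?_
    intro e
    have := uu _ _ e
    clear * - this; revert i; decide
  choose w Auw wa wa' using fun i => third_aux G hcubic (u i) (a i) (a (i + 1))
  have Nu : ∀ i t, G.Adj (u i) t → t = a i ∨ t = a (i + 1) ∨ t = w i := by
    intro i
    refine nbr_aux G hcubic (Aau i).symm (Aua i) (Auw i) ?_ (wa i).symm (wa' i).symm
    intro e
    exact n1 i (aa _ _ e).symm
  have wc : ∀ i k, w i ≠ c k := by
    intro i k e
    have h := (Auw i).symm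
    rw [e] at h
    rcases Nc _ _ h with h | h | h
    · exact cu _ _ h.symm
    · exact cu _ _ h.symm
    · exact au _ _ h.symm
  have wna : ∀ i k, w i ≠ a k := by
    intro i k e
    have h := (Auw i).symm
    rw [e] at h
    rcases Na _ _ h with h | h | h
    · exact cu _ _ h.symm
    · have := uu _ _ h; subst this; exact wa _ e
    · have := uu _ _ h; subst this; exact wa' (k - 1) (by rw [s1]; exact e)
  have wsymm : ∀ i j, w i = u j → w j = u i := by
    intro i j e
    have h := (Auw i).symm
    rw [e] at h
    rcases Nu _ _ h with h | h | h
    · exact absurd h.symm (au _ _)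
    · exact absurd h.symm (au _ _)
    · exact h.symm
  have noc : ∀ i j q, G.Adj (c j) q → G.Adj q (w i) → q = a j := by
    intro i j q h1 h2
    rcases Nc _ _ h1 with rfl | rfl | rfl
    · rcases Nc _ _ h2 with h | h | h
      · exact absurd h (wc _ _)
      · exact absurd h (wc _ _)
      · exact absurd h (wna _ _)
    · rcases Nc _ _ h2 with h | h | h
      · exact absurd h (wc _ _)
      · exact absurd h (wc _ _)
      · exact absurd h (wna _ _)
    · rfl
  have A : ∀ i, w i = u (i - 2) ∨ G.Adj (w i) (w (i - 1)) := by
    intro i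
    obtain ⟨p, q, h1, h2, h3, h4, h5, h6, h7⟩ :=
      pent (u i) (a i) (w i) (Aau i).symm (Auw i) (wa i).symm
    rcases Na _ _ h1 with rfl | rfl | rfl
    · exact absurd (noc _ _ _ h2 h3) h7
    · exact absurd rfl h4
    · rcases Nu _ _ h2 with rfl | rfl | rfl
      · left
        rcases Na _ _ h3 with h | h | h
        · exact absurd h (wc _ _)
        · exact absurd h.symm h6
        · rw [h]; congr 1; ring
      · rw [s1] at h7; exact absurd rfl h7
      · right; exact h3.symm
  have B : ∀ i, w i = u (i + 2) ∨ G.Adj (w i) (w (i + 1)) := by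
    intro i
    obtain ⟨p, q, h1, h2, h3, h4, h5, h6, h7⟩ :=
      pent (u i) (a (i + 1)) (w i) (Aua i) (Auw i) (wa' i).symm
    rcases Na _ _ h1 with rfl | rfl | rfl
    · exact absurd (noc _ _ _ h2 h3) h7
    · rcases Nu _ _ h2 with rfl | rfl | rfl
      · exact absurd rfl h7
      · left
        rcases Na _ _ h3 with h | h | h
        · exact absurd h (wc _ _)
        · rw [h]; congr 1; ring
        · rw [add_sub_cancel_right] at h; exact absurd h.symm h6
      · right; exact h3.symm
    · rw [add_sub_cancel_right] at h4; exact absurd rfl h4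
  -- adjacency of w i to u j
  have wuw : ∀ i j, G.Adj (w i) (u j) → w i = w j := by
    intro i j h
    rcases Nu _ _ h.symm with h | h | h
    · exact absurd h (wna _ _)
    · exact absurd h (wna _ _)
    · exact h
  have C : ∀ i, w i ≠ u (i + 2) := by
    intro i e
    have e' := wsymm _ _ e
    have k1 : w (i + 1) = u (i - 1) := by
      rcases A (i + 1) with h | h
      · rw [h]; congr 1; ring
      · rw [add_sub_cancel_right, e] at h
        have h' := wuw _ _ h
        rw [e'] at h'
        have := wsymm _ _ h'
        rw [e] at this
        have := uu _ _ this
        exfalso; clear * - this; revert i; decide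
    rcases B (i + 1) with h | h
    · rw [k1] at h
      have := uu _ _ h
      clear * - this; revert i; decide
    · have r : i + 1 + 1 = i + 2 := by ring
      rw [r, e'] at h
      have h' := wuw _ _ h
      rw [k1, e] at h'
      have := uu _ _ h'
      clear * - this; revert i; decide
  have C' : ∀ i, w i ≠ u (i - 2) := by
    intro i e
    have := wsymm _ _ e
    apply C (i - 2)
    rw [this]; congr 1; ring
  have A' : ∀ i, G.Adj (w i) (w (i - 1)) := fun i => (A i).resolve_left (C' i)
  have B' : ∀ i, G.Adj (w i) (w (i + 1)) := fun i => (B i).resolve_left (C i)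
  have D : ∀ i, w i ≠ u (i + 1) := by
    intro i e
    have h := (A' i).symm
    rw [e] at h
    have h1 := wuw _ _ h
    rw [wsymm _ _ e] at h1
    have h2 := wsymm _ _ h1
    rw [e] at h2
    have := uu _ _ h2
    clear * - this; revert i; decide
  have wu : ∀ i j, w i ≠ u j := by
    intro i j e
    have : j = i ∨ j = i + 1 ∨ i = j + 1 ∨ j = i + 2 ∨ j = i - 2 := by clear * - i j; revert i j; decide
    rcases this with rfl | rfl | rfl | rfl | rfl
    · have := Auw j; rw [e] at this; exact G.irrefl this
    · exact D _ e
    · exact D _ (wsymm _ _ e)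
    · exact C _ e
    · exact C' _ e
  have E : ∀ i, w i ≠ w (i + 2) := by
    intro i e
    have k1 := (Auw i).symm
    have k2 := (Auw (i + 2)).symm
    rw [← e] at k2
    have k3 := A' i
    have k4 := B' (i + 2)
    rw [← e] at k4
    have k5 := A' (i - 1)
    have r : i - 1 - 1 = i + 2 + 1 := by clear * - i; revert i; decide
    rw [r] at k5
    have k6 : u i ≠ u (i + 2) := by
      intro h
      have := uu _ _ h
      clear * - this; revert i; decide
    rcases nbr_aux G hcubic k1 k2 k3 k6 (wu _ _).symm (wu _ _).symm _ k4 with h | h | h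
    · exact wu _ _ h
    · exact wu _ _ h
    · rw [h] at k5; exact G.irrefl k5
  have ww : ∀ i j, w i = w j → i = j := by
    intro i j e
    have : i = j ∨ j = i + 1 ∨ i = j + 1 ∨ j = i + 2 ∨ i = j + 2 := by clear * - i j; revert i j; decide
    rcases this with h | rfl | rfl | rfl | rfl
    · exact h
    · have := B' i; rw [e] at this; exact absurd this G.irrefl
    · have := B' j; rw [e] at this; exact absurd this G.irrefl
    · exact absurd e (E _)
    · exact absurd e.symm (E _)
  let F : Fin 4 × ZMod 5 → V := fun p => (![c, a, u, w] p.1) p.2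
  have Finj : Function.Injective F := by
    rintro ⟨k, i⟩ ⟨l, j⟩ h
    have ac := fun i j => (ca j i).symm
    have uc := fun i j => (cu j i).symm
    have ua := fun i j => (au j i).symm
    have cw := fun i j => (wc j i).symm
    have aw := fun i j => (wna j i).symm
    have uw := fun i j => (wu j i).symm
    fin_cases k <;> fin_cases l <;> simp [F] at h ⊢ <;>
      first
      | exact cc _ _ h
      | exact aa _ _ h
      | exact uu _ _ h
      | exact ww _ _ h
      | exact ca _ _ h
      | exact cu _ _ h
      | exact au _ _ h
      | exact wc _ _ h
      | exact wna _ _ h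
      | exact wu _ _ h
      | exact ac _ _ h
      | exact uc _ _ h
      | exact ua _ _ h
      | exact cw _ _ h
      | exact aw _ _ h
      | exact uw _ _ h
  have Fadj : ∀ p q, dodRel p q → G.Adj (F p) (F q) := by
    rintro ⟨k, i⟩ ⟨l, j⟩ h
    rcases h with ⟨h1, h2, h3⟩ | ⟨h1, h2, h3⟩ | ⟨h1, h2, h3⟩ | ⟨h1, h2, h3⟩ | ⟨h1, h2, h3⟩ |
      ⟨h1, h2, h3⟩ <;> simp only at h1 h2 h3 <;> subst h1 h2 h3
    · exact Acc i
    · exact Aca j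
    · exact Aau j
    · exact Aua i
    · exact Auw j
    · exact B' i
  haveI : Nonempty (ZMod 10 ⊕ ZMod 10) := ⟨Sum.inl 0⟩
  refine iso_aux G (genPetersen 10 2) hcubic gp_reg hconn (F ∘ gpe) (Finj.comp gpe_inj) ?_
  intro x y h
  rcases gpe_adj x y h with h | h
  · exact Fadj _ _ h
  · exact (Fadj _ _ h).symm

/-- A finite connected cubic vertex-transitive graph of girth 5 which is uniformly
cyclically 5-edge-connected and contains a subgraph isomorphic to the rosette is
isomorphic to the dodecahedron `GP(10,2)`. -/
theorem u5_rosette_dodecahedron {V : Type*} [Fintype V]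
    (G : SimpleGraph V) [DecidableRel G.Adj] (hconn : G.Connected)
    (hcubic : G.IsRegularOfDegree 3) (hvt : IsVertexTransitive G) (hg : G.girth = 5)
    (hU : IsU5 G)
    (hros : ∃ f : (Fin 3 × ZMod 5) ↪ V, ∀ p q, rosette.Adj p q → G.Adj (f p) (f q)) :
    Nonempty (G ≃g genPetersen 10 2) := by
  obtain ⟨f, hf⟩ := hros
  have ne : ∀ p q, p ≠ q → f p ≠ f q := fun p q h e => h (f.injective e)
  have Acc : ∀ i, G.Adj (f (0, i)) (f (0, i + 1)) := fun i => hf _ _ (by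
    simp only [rosette, SimpleGraph.fromRel_adj]; clear * - i; revert i; decide)
  have Aca : ∀ i, G.Adj (f (0, i)) (f (1, i)) := fun i => hf _ _ (by
    simp only [rosette, SimpleGraph.fromRel_adj]; clear * - i; revert i; decide)
  have Aau : ∀ i, G.Adj (f (1, i)) (f (2, i)) := fun i => hf _ _ (by
    simp only [rosette, SimpleGraph.fromRel_adj]; clear * - i; revert i; decide)
  have Aua : ∀ i, G.Adj (f (2, i)) (f (1, i + 1)) := fun i => hf _ _ (by
    simp only [rosette, SimpleGraph.fromRel_adj]; clear * - i; revert i; decide)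
  have base : ∀ x y, G.Adj (f (0, 0)) x → G.Adj (f (0, 0)) y → x ≠ y →
      ∃ p q, G.Adj x p ∧ G.Adj p q ∧ G.Adj q y ∧
      p ≠ f (0, 0) ∧ q ≠ f (0, 0) ∧ p ≠ y ∧ q ≠ x := by
    have N := nbr_aux G hcubic (Acc 0) (Acc 4).symm (Aca 0)
      (ne _ _ (by decide)) (ne _ _ (by decide)) (ne _ _ (by decide))
    intro x y hx hy hxy
    rcases N x hx with rfl | rfl | rfl <;> rcases N y hy with rfl | rfl | rfl
    · exact absurd rfl hxy
    · exact ⟨f (0, 2), f (0, 3), Acc 1, Acc 2, Acc 3, ne _ _ (by decide), ne _ _ (by decide),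
        ne _ _ (by decide), ne _ _ (by decide)⟩
    · exact ⟨f (1, 1), f (2, 0), Aca 1, (Aua 0).symm, (Aau 0).symm, ne _ _ (by decide),
        ne _ _ (by decide), ne _ _ (by decide), ne _ _ (by decide)⟩
    · exact ⟨f (0, 3), f (0, 2), (Acc 3).symm, (Acc 2).symm, (Acc 1).symm, ne _ _ (by decide),
        ne _ _ (by decide), ne _ _ (by decide), ne _ _ (by decide)⟩
    · exact absurd rfl hxy
    · exact ⟨f (1, 4), f (2, 4), Aca 4, Aau 4, Aua 4, ne _ _ (by decide),
        ne _ _ (by decide), ne _ _ (by decide), ne _ _ (by decide)⟩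
    · exact ⟨f (2, 0), f (1, 1), Aau 0, Aua 0, (Aca 1).symm, ne _ _ (by decide),
        ne _ _ (by decide), ne _ _ (by decide), ne _ _ (by decide)⟩
    · exact ⟨f (2, 4), f (1, 4), (Aua 4).symm, (Aau 4).symm, (Aca 4).symm, ne _ _ (by decide),
        ne _ _ (by decide), ne _ _ (by decide), ne _ _ (by decide)⟩
    · exact absurd rfl hxy
  refine core_aux G hconn hcubic ?_ (fun i => f (0, i)) (fun i => f (1, i)) (fun i => f (2, i))
    ?_ ?_ ?_ ?_ ?_ ?_ Acc Aca Aau Aua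
  · intro v x y hx hy hxy
    obtain ⟨φ, rfl⟩ := hvt (f (0, 0)) v
    obtain ⟨x, rfl⟩ := φ.surjective x
    obtain ⟨y, rfl⟩ := φ.surjective y
    obtain ⟨p, q, h1, h2, h3, h4, h5, h6, h7⟩ := base x y (φ.map_adj_iff.1 hx)
      (φ.map_adj_iff.1 hy) (fun e => hxy (by rw [e]))
    exact ⟨φ p, φ q, φ.map_adj_iff.2 h1, φ.map_adj_iff.2 h2, φ.map_adj_iff.2 h3,
      φ.injective.ne h4, φ.injective.ne h5, φ.injective.ne h6, φ.injective.ne h7⟩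
  · intro i j h; simpa using f.injective h
  · intro i j h; simpa using f.injective h
  · intro i j h; simpa using f.injective h
  · intro i j; exact ne _ _ (by simp)
  · intro i j; exact ne _ _ (by simp)
  · intro i j; exact ne _ _ (by simp)
end

section
/- Let G be a graph isomorphic to an odd or even double ladder (for some length k and some choice of the matching) such that G is uniformly cyclically 5-edge-connected (U(5)) and vertex-transitive. Then either G is 2-extendable or G is isomorphic to the Petersen graph GP(5,2). -/
open SimpleGraph

/-- Vertices of the odd double ladder of length `k` (0-based indices):
`Sum.inl t` is `a_{t+1}`, `Sum.inr (Sum.inl t)` is `b_{t+1}`,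
`Sum.inr (Sum.inr t)` is `c_{t+1}`. -/
abbrev OddDLVert (k : ℕ) := Fin k ⊕ Fin (2 * k + 1) ⊕ Fin (k + 1)

/-- `p` is the `j`-th element of `{a_1, b_1, c_1}` in the odd double ladder. -/
def oddDLStart (k : ℕ) (j : Fin 3) (p : OddDLVert k) : Prop :=
  (j = 0 ∧ ∃ a : Fin k, p = Sum.inl a ∧ (a : ℕ) = 0) ∨
  (j = 1 ∧ ∃ b : Fin (2 * k + 1), p = Sum.inr (Sum.inl b) ∧ (b : ℕ) = 0) ∨
  (j = 2 ∧ ∃ c : Fin (k + 1), p = Sum.inr (Sum.inr c) ∧ (c : ℕ) = 0)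

/-- `p` is the `j`-th element of `{a_k, b_{2k+1}, c_{k+1}}` in the odd double ladder. -/
def oddDLEnd (k : ℕ) (j : Fin 3) (p : OddDLVert k) : Prop :=
  (j = 0 ∧ ∃ a : Fin k, p = Sum.inl a ∧ (a : ℕ) = k - 1) ∨
  (j = 1 ∧ ∃ b : Fin (2 * k + 1), p = Sum.inr (Sum.inl b) ∧ (b : ℕ) = 2 * k) ∨
  (j = 2 ∧ ∃ c : Fin (k + 1), p = Sum.inr (Sum.inr c) ∧ (c : ℕ) = k)

/-- The odd double ladder of length `k`, where the perfect matching between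
`{a_1, b_1, c_1}` and `{a_k, b_{2k+1}, c_{k+1}}` is given by the permutation `σ`
(the `j`-th start vertex is matched to the `σ j`-th end vertex, in the order `a, b, c`). -/
def oddDoubleLadder (k : ℕ) (σ : Equiv.Perm (Fin 3)) : SimpleGraph (OddDLVert k) :=
  SimpleGraph.fromRel fun p q =>
    -- a_i b_{2i}
    (∃ (a : Fin k) (b : Fin (2 * k + 1)),
      p = Sum.inl a ∧ q = Sum.inr (Sum.inl b) ∧ (b : ℕ) = 2 * (a : ℕ) + 1) ∨
    -- c_i b_{2i-1}
    (∃ (c : Fin (k + 1)) (b : Fin (2 * k + 1)),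
      p = Sum.inr (Sum.inr c) ∧ q = Sum.inr (Sum.inl b) ∧ (b : ℕ) = 2 * (c : ℕ)) ∨
    -- a_i a_{i+1}
    (∃ a a' : Fin k, p = Sum.inl a ∧ q = Sum.inl a' ∧ (a' : ℕ) = (a : ℕ) + 1) ∨
    -- b_i b_{i+1}
    (∃ b b' : Fin (2 * k + 1),
      p = Sum.inr (Sum.inl b) ∧ q = Sum.inr (Sum.inl b') ∧ (b' : ℕ) = (b : ℕ) + 1) ∨
    -- c_i c_{i+1}
    (∃ c c' : Fin (k + 1),
      p = Sum.inr (Sum.inr c) ∧ q = Sum.inr (Sum.inr c') ∧ (c' : ℕ) = (c : ℕ) + 1) ∨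
    -- the matching
    (∃ j : Fin 3, oddDLStart k j p ∧ oddDLEnd k (σ j) q)

/-- Vertices of the even double ladder of length `k` (0-based indices). -/
abbrev EvenDLVert (k : ℕ) := Fin k ⊕ Fin (2 * k) ⊕ Fin k

/-- `p` is the `j`-th element of `{a_1, b_1, c_1}` in the even double ladder. -/
def evenDLStart (k : ℕ) (j : Fin 3) (p : EvenDLVert k) : Prop :=
  (j = 0 ∧ ∃ a : Fin k, p = Sum.inl a ∧ (a : ℕ) = 0) ∨
  (j = 1 ∧ ∃ b : Fin (2 * k), p = Sum.inr (Sum.inl b) ∧ (b : ℕ) = 0) ∨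
  (j = 2 ∧ ∃ c : Fin k, p = Sum.inr (Sum.inr c) ∧ (c : ℕ) = 0)

/-- `p` is the `j`-th element of `{a_k, b_{2k}, c_k}` in the even double ladder. -/
def evenDLEnd (k : ℕ) (j : Fin 3) (p : EvenDLVert k) : Prop :=
  (j = 0 ∧ ∃ a : Fin k, p = Sum.inl a ∧ (a : ℕ) = k - 1) ∨
  (j = 1 ∧ ∃ b : Fin (2 * k), p = Sum.inr (Sum.inl b) ∧ (b : ℕ) = 2 * k - 1) ∨
  (j = 2 ∧ ∃ c : Fin k, p = Sum.inr (Sum.inr c) ∧ (c : ℕ) = k - 1)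

/-- The even double ladder of length `k`, with matching given by `σ` as above. -/
def evenDoubleLadder (k : ℕ) (σ : Equiv.Perm (Fin 3)) : SimpleGraph (EvenDLVert k) :=
  SimpleGraph.fromRel fun p q =>
    (∃ (a : Fin k) (b : Fin (2 * k)),
      p = Sum.inl a ∧ q = Sum.inr (Sum.inl b) ∧ (b : ℕ) = 2 * (a : ℕ) + 1) ∨
    (∃ (c : Fin k) (b : Fin (2 * k)),
      p = Sum.inr (Sum.inr c) ∧ q = Sum.inr (Sum.inl b) ∧ (b : ℕ) = 2 * (c : ℕ)) ∨
    (∃ a a' : Fin k, p = Sum.inl a ∧ q = Sum.inl a' ∧ (a' : ℕ) = (a : ℕ) + 1) ∨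
    (∃ b b' : Fin (2 * k),
      p = Sum.inr (Sum.inl b) ∧ q = Sum.inr (Sum.inl b') ∧ (b' : ℕ) = (b : ℕ) + 1) ∨
    (∃ c c' : Fin k,
      p = Sum.inr (Sum.inr c) ∧ q = Sum.inr (Sum.inr c') ∧ (c' : ℕ) = (c : ℕ) + 1) ∨
    (∃ j : Fin 3, evenDLStart k j p ∧ evenDLEnd k (σ j) q)

def dlLen (l m n t : ℕ) : ℕ := if t = 0 then l else if t = 1 then m else n
def dlR (l m n s0 s1 s2 : ℕ) (t i t' j : ℕ) : Bool :=
  (t == 0 && t' == 1 && j == 2 * i + 1) || (t == 2 && t' == 1 && j == 2 * i) ||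
  (t == t' && j == i + 1) ||
  (i == 0 && t' == dlLen s0 s1 s2 t && j + 1 == dlLen l m n t')

abbrev DLV (l m n : ℕ) := Fin l ⊕ Fin m ⊕ Fin n

def dlT {l m n : ℕ} : DLV l m n → ℕ
  | Sum.inl _ => 0
  | Sum.inr (Sum.inl _) => 1
  | Sum.inr (Sum.inr _) => 2

def dlI {l m n : ℕ} : DLV l m n → ℕ
  | Sum.inl a => a.val
  | Sum.inr (Sum.inl a) => a.val
  | Sum.inr (Sum.inr a) => a.val

def dlRel (l m n s0 s1 s2 : ℕ) (p q : DLV l m n) : Prop :=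
  dlR l m n s0 s1 s2 (dlT p) (dlI p) (dlT q) (dlI q) = true

def DL (l m n s0 s1 s2 : ℕ) : SimpleGraph (DLV l m n) :=
  SimpleGraph.fromRel (dlRel l m n s0 s1 s2)

instance (l m n s0 s1 s2 : ℕ) : DecidableRel (DL l m n s0 s1 s2).Adj := fun p q =>
  decidable_of_iff (p ≠ q ∧
    ((dlR l m n s0 s1 s2 (dlT p) (dlI p) (dlT q) (dlI q) ||
     dlR l m n s0 s1 s2 (dlT q) (dlI q) (dlT p) (dlI p)) = true))
    (by simp [DL, dlRel])

theorem odd_eq_DL (k : ℕ) (σ : Equiv.Perm (Fin 3)) :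
    oddDoubleLadder k σ = DL k (2*k+1) (k+1) (σ 0).val (σ 1).val (σ 2).val := by
  unfold oddDoubleLadder DL
  congr 1
  funext p q
  apply propext
  have e0 : ∀ x : Fin 3, x = 0 ↔ 0 = x.val := by decide
  have e1 : ∀ x : Fin 3, x = 1 ↔ 1 = x.val := by decide
  have e2 : ∀ x : Fin 3, x = 2 ↔ 2 = x.val := by decide
  rcases p with a | a | a <;> rcases q with b | b | b <;>
    simp [dlRel, dlR, dlT, dlI, oddDLStart, oddDLEnd, dlLen, Fin.exists_fin_succ, e0, e1, e2] <;>
    omega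

theorem even_eq_DL (k : ℕ) (σ : Equiv.Perm (Fin 3)) :
    evenDoubleLadder k σ = DL k (2*k) k (σ 0).val (σ 1).val (σ 2).val := by
  unfold evenDoubleLadder DL
  congr 1
  funext p q
  apply propext
  have e0 : ∀ x : Fin 3, x = 0 ↔ 0 = x.val := by decide
  have e1 : ∀ x : Fin 3, x = 1 ↔ 1 = x.val := by decide
  have e2 : ∀ x : Fin 3, x = 2 ↔ 2 = x.val := by decide
  rcases p with a | a | a <;> rcases q with b | b | b <;>
    simp [dlRel, dlR, dlT, dlI, evenDLStart, evenDLEnd, dlLen, Fin.exists_fin_succ, e0, e1, e2] <;>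
    omega

/-- local invariant -/
def PP {V : Type*} (G : SimpleGraph V) (v : V) : Prop :=
  ∀ x, G.Adj v x → ∀ y, G.Adj v y → x ≠ y →
    ∃ p, G.Adj x p ∧ p ≠ v ∧ ∃ q, G.Adj p q ∧ q ≠ v ∧ G.Adj q y
def QQ {V : Type*} (G : SimpleGraph V) (v : V) : Prop :=
  ∃ x, G.Adj v x ∧ ∃ y, G.Adj v y ∧ x ≠ y ∧ ∃ z, G.Adj v z ∧ x ≠ z ∧ y ≠ z
instance {V : Type*} [Fintype V] [DecidableEq V] (G : SimpleGraph V) [DecidableRel G.Adj] (v : V) :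
  Decidable (PP G v) := by unfold PP; infer_instance
instance {V : Type*} [Fintype V] [DecidableEq V] (G : SimpleGraph V) [DecidableRel G.Adj] (v : V) :
  Decidable (QQ G v) := by unfold QQ; infer_instance

theorem PP_iso {V W : Type*} {G : SimpleGraph V} {H : SimpleGraph W} (φ : G ≃g H) {v : V}
    (h : PP G v) : PP H (φ v) := by
  intro x hx y hy hxy
  obtain ⟨x, rfl⟩ := φ.surjective x
  obtain ⟨y, rfl⟩ := φ.surjective y
  obtain ⟨p, h1, h2, q, h3, h4, h5⟩ := h x (φ.map_adj_iff.1 hx) y (φ.map_adj_iff.1 hy)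
    (fun e => hxy (by rw [e]))
  exact ⟨φ p, φ.map_adj_iff.2 h1, fun e => h2 (φ.injective e), φ q, φ.map_adj_iff.2 h3,
    fun e => h4 (φ.injective e), φ.map_adj_iff.2 h5⟩

theorem QQ_iso {V W : Type*} {G : SimpleGraph V} {H : SimpleGraph W} (φ : G ≃g H) {v : V}
    (h : QQ G v) : QQ H (φ v) := by
  obtain ⟨x, hx, y, hy, hxy, z, hz, hxz, hyz⟩ := h
  exact ⟨φ x, φ.map_adj_iff.2 hx, φ y, φ.map_adj_iff.2 hy, fun e => hxy (φ.injective e),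
    φ z, φ.map_adj_iff.2 hz, fun e => hxz (φ.injective e), fun e => hyz (φ.injective e)⟩

theorem vt_iso {V W : Type*} {G : SimpleGraph V} {H : SimpleGraph W} (φ : G ≃g H)
    (h : IsVertexTransitive G) : IsVertexTransitive H := by
  intro x y
  obtain ⟨ψ, hψ⟩ := h (φ.symm x) (φ.symm y)
  exact ⟨(φ.symm.trans ψ).trans φ, by simp [hψ]⟩

theorem not_vt_P {V : Type*} {G : SimpleGraph V} (h : ∃ x y, PP G x ∧ ¬ PP G y) :
    ¬ IsVertexTransitive G := by
  obtain ⟨x, y, hx, hy⟩ := h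
  intro hv
  obtain ⟨φ, rfl⟩ := hv x y
  exact hy (PP_iso φ hx)

theorem not_vt_Q {V : Type*} {G : SimpleGraph V} (h : ∃ x y, QQ G x ∧ ¬ QQ G y) :
    ¬ IsVertexTransitive G := by
  obtain ⟨x, y, hx, hy⟩ := h
  intro hv
  obtain ⟨φ, rfl⟩ := hv x y
  exact hy (QQ_iso φ hx)

theorem DL_large (k m n s0 s1 s2 : ℕ) (hk : 6 ≤ k) (hm : 2 * k ≤ m) (hn : k ≤ n) :
    ∃ x y, PP (DL k m n s0 s1 s2) x ∧ ¬ PP (DL k m n s0 s1 s2) y := by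
  refine ⟨Sum.inr (Sum.inl ⟨3, by omega⟩), Sum.inl ⟨2, by omega⟩, ?_, ?_⟩
  · have nb : ∀ z, (DL k m n s0 s1 s2).Adj (Sum.inr (Sum.inl ⟨3, by omega⟩)) z →
        z = Sum.inl ⟨1, by omega⟩ ∨ z = Sum.inr (Sum.inl ⟨2, by omega⟩) ∨
        z = Sum.inr (Sum.inl ⟨4, by omega⟩) := by
      rintro (z | z | z) <;> simp [DL, dlRel, dlR, dlT, dlI, dlLen, Fin.ext_iff] <;> omega
    intro x hx y hy hxy
    rcases nb x hx with rfl | rfl | rfl <;> rcases nb y hy with rfl | rfl | rfl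
    · exact absurd rfl hxy
    · refine ⟨Sum.inl ⟨0, by omega⟩, ?_, ?_, Sum.inr (Sum.inl ⟨1, by omega⟩), ?_⟩ <;>
        simp [DL, dlRel, dlR, dlT, dlI, dlLen]
    · refine ⟨Sum.inl ⟨2, by omega⟩, ?_, ?_, Sum.inr (Sum.inl ⟨5, by omega⟩), ?_⟩ <;>
        simp [DL, dlRel, dlR, dlT, dlI, dlLen]
    · refine ⟨Sum.inr (Sum.inl ⟨1, by omega⟩), ?_, ?_, Sum.inl ⟨0, by omega⟩, ?_⟩ <;>
        simp [DL, dlRel, dlR, dlT, dlI, dlLen]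
    · exact absurd rfl hxy
    · refine ⟨Sum.inr (Sum.inr ⟨1, by omega⟩), ?_, ?_, Sum.inr (Sum.inr ⟨2, by omega⟩), ?_⟩ <;>
        simp [DL, dlRel, dlR, dlT, dlI, dlLen]
    · refine ⟨Sum.inr (Sum.inl ⟨5, by omega⟩), ?_, ?_, Sum.inl ⟨2, by omega⟩, ?_⟩ <;>
        simp [DL, dlRel, dlR, dlT, dlI, dlLen]
    · refine ⟨Sum.inr (Sum.inr ⟨2, by omega⟩), ?_, ?_, Sum.inr (Sum.inr ⟨1, by omega⟩), ?_⟩ <;>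
        simp [DL, dlRel, dlR, dlT, dlI, dlLen]
    · exact absurd rfl hxy
  · intro h
    obtain ⟨p, h1, h2, q, h3, h4, h5⟩ := h (Sum.inl ⟨1, by omega⟩)
      (by simp [DL, dlRel, dlR, dlT, dlI, dlLen]) (Sum.inl ⟨3, by omega⟩)
      (by simp [DL, dlRel, dlR, dlT, dlI, dlLen]) (by simp)
    have hp : p = Sum.inl ⟨0, by omega⟩ ∨ p = Sum.inr (Sum.inl ⟨3, by omega⟩) := by
      revert h1 h2
      rcases p with z | z | z <;> simp [DL, dlRel, dlR, dlT, dlI, dlLen, Fin.ext_iff] <;> omega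
    have hq : q = Sum.inl ⟨4, by omega⟩ ∨ q = Sum.inr (Sum.inl ⟨7, by omega⟩) := by
      revert h4 h5
      rcases q with z | z | z <;> simp [DL, dlRel, dlR, dlT, dlI, dlLen, Fin.ext_iff] <;> omega
    revert h3
    rcases hp with rfl | rfl <;> rcases hq with rfl | rfl <;>
      simp [DL, dlRel, dlR, dlT, dlI, dlLen] <;> omega

theorem cut_iso {V W : Type*} {G : SimpleGraph V} {H : SimpleGraph W} (φ : H ≃g G)
    {F : Set (Sym2 W)} (h : IsCyclicEdgeCut H F) :
    IsCyclicEdgeCut G (Sym2.map φ '' F) := by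
  obtain ⟨hF, u, v, c, c', hc, hc', hr⟩ := h
  have inj : Function.Injective (Sym2.map φ) := Sym2.map.injective φ.injective
  let ψ : H.deleteEdges F ≃g G.deleteEdges (Sym2.map φ '' F) :=
    ⟨φ.toEquiv, by
      intro a b
      have : (s(φ a, φ b) ∈ Sym2.map φ '' F) ↔ s(a, b) ∈ F := by
        rw [← Sym2.map_mk, inj.mem_set_image]
      simp only [deleteEdges_adj]
      exact and_congr φ.map_adj_iff (not_congr this)⟩
  refine ⟨?_, φ u, φ v, c.map ψ.toHom, c'.map ψ.toHom, hc.map ψ.injective, hc'.map ψ.injective, ?_⟩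
  · rintro _ ⟨e, he, rfl⟩
    induction e with
    | _ a b => exact φ.map_adj_iff.2 (hF he)
  · intro h
    exact hr (ψ.reachable_iff.1 h)

theorem U5_iso {V W : Type*} {G : SimpleGraph V} {H : SimpleGraph W} (φ : G ≃g H)
    (h : IsU5 G) {F : Set (Sym2 W)} (hF : IsCyclicEdgeCut H F) : 5 ≤ F.ncard := by
  have := h.2.1 _ (cut_iso φ.symm hF)
  rwa [Set.ncard_image_of_injective _ (Sym2.map.injective φ.symm.injective)] at this

theorem U5_card {V : Type*} [Fintype V] {G : SimpleGraph V} (h : IsU5 G) : 6 ≤ Fintype.card V := by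
  classical
  obtain ⟨⟨F, ⟨hF, u, v, c, c', hc, hc', hr⟩, -⟩, -⟩ := h
  have h1 := hc.three_le_length
  have h2 := hc'.three_le_length
  have n1 := hc.support_nodup
  have n2 := hc'.support_nodup
  have l1 : c.support.tail.length = c.length := by simp
  have l2 : c'.support.tail.length = c'.length := by simp
  have hd : (c.support.tail ++ c'.support.tail).Nodup := by
    refine List.Nodup.append n1 n2 ?_
    intro x hx hx'
    exact hr ((c.takeUntil x (List.mem_of_mem_tail hx)).reachable.trans
      (c'.takeUntil x (List.mem_of_mem_tail hx')).reachable.symm)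
  have := hd.length_le_card
  simp at this
  omega

theorem not_U5_of {V W : Type*} {G : SimpleGraph V} {H : SimpleGraph W} (φ : G ≃g H)
    (h : IsU5 G) (S : Set W) (x y : W) (F : Set (Sym2 W))
    (hF : ∀ e, e ∈ F ↔ e ∈ H.edgeSet ∧ ∃ a b, a ∈ S ∧ b ∉ S ∧ e = s(a,b))
    (hx : x ∈ S) (hy : y ∉ S) (c : H.Walk x x) (c' : H.Walk y y) (hc : c.IsCycle) (hc' : c'.IsCycle)
    (h1 : ∀ z ∈ c.support, z ∈ S) (h2 : ∀ z ∈ c'.support, z ∉ S) (hn : F.ncard < 5) : False := by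
  have key : ∀ a b, (H.deleteEdges F).Adj a b → (a ∈ S ↔ b ∈ S) := by
    intro a b hab
    rw [deleteEdges_adj, hF] at hab
    obtain ⟨ha, hb⟩ := hab
    by_contra hcon
    apply hb
    refine ⟨ha, ?_⟩
    by_cases haS : a ∈ S
    · exact ⟨a, b, haS, by tauto, rfl⟩
    · exact ⟨b, a, by tauto, haS, Sym2.eq_swap⟩
  have key2 : ∀ a b, (H.deleteEdges F).Reachable a b → (a ∈ S ↔ b ∈ S) := by
    rintro a b ⟨w⟩
    induction w with
    | nil => rfl
    | cons hh _ ih => exact (key _ _ hh).trans ih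
  have he : ∀ e ∈ c.edges, e ∉ F := by
    intro e he heF
    obtain ⟨-, a, b, ha, hb, rfl⟩ := (hF e).1 heF
    exact hb (h1 _ (c.snd_mem_support_of_mem_edges he))
  have he' : ∀ e ∈ c'.edges, e ∉ F := by
    intro e he heF
    obtain ⟨-, a, b, ha, hb, rfl⟩ := (hF e).1 heF
    exact (h2 _ (c'.fst_mem_support_of_mem_edges he)) ha
  have := U5_iso φ h (F := F) ⟨fun e he => ((hF e).1 he).1, x, y, c.toDeleteEdges F he,
    c'.toDeleteEdges F he', hc.toDeleteEdges _ _ _, hc'.toDeleteEdges _ _ _,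
    fun hr => hy ((key2 _ _ hr).1 hx)⟩
  omega

theorem not_U5_fin {V W : Type*} [Fintype W] [DecidableEq W] {G : SimpleGraph V}
    {H : SimpleGraph W} [DecidableRel H.Adj] (φ : G ≃g H)
    (h : IsU5 G) (S : Finset W) (x y : W) (hx : x ∈ S) (hy : y ∉ S)
    (c : H.Walk x x) (c' : H.Walk y y) (hc : c.IsCycle) (hc' : c'.IsCycle)
    (h1 : ∀ z ∈ c.support, z ∈ S) (h2 : ∀ z ∈ c'.support, z ∉ S)
    (hn : (Finset.univ.filter fun p : W × W =>
      p.1 ∈ S ∧ p.2 ∉ S ∧ H.Adj p.1 p.2).card < 5) : False := by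
  refine not_U5_of φ h (S : Set W) x y ((fun p : W × W => s(p.1, p.2)) ''
    ((Finset.univ.filter fun p : W × W => p.1 ∈ S ∧ p.2 ∉ S ∧ H.Adj p.1 p.2 : Finset _) : Set (W × W)))
    ?_ (by simpa using hx) (by simpa using hy) c c' hc hc' (by simpa using h1) (by simpa using h2) ?_
  · intro e
    constructor
    · rintro ⟨⟨a, b⟩, hab, rfl⟩
      simp at hab
      exact ⟨hab.2.2, a, b, by simpa using hab.1, by simpa using hab.2.1, rfl⟩
    · rintro ⟨he, a, b, ha, hb, rfl⟩
      exact ⟨(a, b), by simpa using ⟨ha, hb, he⟩, rfl⟩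
  · refine lt_of_le_of_lt (Set.ncard_image_le (Finset.finite_toSet _)) ?_
    rwa [Set.ncard_coe_finset]

theorem not_U5_tri {V W : Type*} [Fintype W] [DecidableEq W] {G : SimpleGraph V}
    {H : SimpleGraph W} [DecidableRel H.Adj] (φ : G ≃g H) (h : IsU5 G) (a b c d e f : W)
    (hd : [a, b, c, d, e, f].Nodup)
    (h1 : H.Adj a b ∧ H.Adj b c ∧ H.Adj c a) (h2 : H.Adj d e ∧ H.Adj e f ∧ H.Adj f d)
    (hn : (Finset.univ.filter fun p : W × W =>
      p.1 ∈ ({a, b, c} : Finset W) ∧ p.2 ∉ ({a, b, c} : Finset W) ∧ H.Adj p.1 p.2).card < 5) :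
    False := by
  refine not_U5_fin φ h {a, b, c} a d (by simp) (by simp at *; grind)
    (.cons h1.1 (.cons h1.2.1 (.cons h1.2.2 .nil)))
    (.cons h2.1 (.cons h2.2.1 (.cons h2.2.2 .nil))) ?_ ?_ ?_ ?_ hn
  · simp [Walk.cons_isCycle_iff] at *; grind
  · simp [Walk.cons_isCycle_iff] at *; grind
  · simp
  · simp at *; grind

theorem not_U5_quad {V W : Type*} [Fintype W] [DecidableEq W] {G : SimpleGraph V}
    {H : SimpleGraph W} [DecidableRel H.Adj] (φ : G ≃g H) (h : IsU5 G) (a b c a' d e f d' : W)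
    (hd : [a, b, c, a', d, e, f, d'].Nodup)
    (h1 : H.Adj a b ∧ H.Adj b c ∧ H.Adj c a' ∧ H.Adj a' a)
    (h2 : H.Adj d e ∧ H.Adj e f ∧ H.Adj f d' ∧ H.Adj d' d)
    (hn : (Finset.univ.filter fun p : W × W =>
      p.1 ∈ ({a, b, c, a'} : Finset W) ∧ p.2 ∉ ({a, b, c, a'} : Finset W) ∧
        H.Adj p.1 p.2).card < 5) :
    False := by
  refine not_U5_fin φ h {a, b, c, a'} a d (by simp) (by simp at *; grind)
    (.cons h1.1 (.cons h1.2.1 (.cons h1.2.2.1 (.cons h1.2.2.2 .nil))))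
    (.cons h2.1 (.cons h2.2.1 (.cons h2.2.2.1 (.cons h2.2.2.2 .nil)))) ?_ ?_ ?_ ?_ hn
  · simp [Walk.cons_isCycle_iff] at *; grind
  · simp [Walk.cons_isCycle_iff] at *; grind
  · simp
  · simp at *; grind

theorem ext_of {V : Type*} [Fintype V] (G : SimpleGraph V) (hcard : 6 ≤ Fintype.card V)
    (h0 : ∃ a b c d, G.Adj a b ∧ G.Adj c d ∧ a ≠ c ∧ a ≠ d ∧ b ≠ c ∧ b ≠ d)
    (h : ∀ a b c d, G.Adj a b → G.Adj c d → a ≠ c → a ≠ d → b ≠ c → b ≠ d →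
      ∃ f : V → V, (∀ v, G.Adj v (f v)) ∧ (∀ v, f (f v) = v) ∧ f a = b ∧ f c = d) :
    IsNExtendable G 2 := by
  refine ⟨by omega, ?_, ?_⟩
  · obtain ⟨a, b, c, d, hab, hcd, h1, h2, h3, h4⟩ := h0
    let M : G.Subgraph :=
      { verts := {a, b, c, d}
        Adj := fun x y => s(x, y) = s(a, b) ∨ s(x, y) = s(c, d)
        adj_sub := by
          intro x y hxy
          rcases hxy with h | h
          · exact (G.mem_edgeSet).1 (h ▸ hab)
          · exact (G.mem_edgeSet).1 (h ▸ hcd)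
        edge_vert := by
          intro x y hxy
          simp only [Sym2.eq_iff] at hxy
          simp only [Set.mem_insert_iff, Set.mem_singleton_iff]
          tauto
        symm := ⟨by
          intro x y hxy
          rwa [Sym2.eq_swap (a := y)]⟩ }
    refine ⟨M, ?_, ?_⟩
    · have hab' := hab.ne
      have hcd' := hcd.ne
      intro v hv
      simp only [M, Set.mem_insert_iff, Set.mem_singleton_iff] at hv
      simp only [M, Sym2.eq_iff, ExistsUnique]
      rcases hv with rfl | rfl | rfl | rfl
      · exact ⟨b, by grind⟩
      · exact ⟨a, by grind⟩
      · exact ⟨d, by grind⟩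
      · exact ⟨c, by grind⟩
    · have : M.edgeSet = {s(a, b), s(c, d)} := by
        ext e
        induction e with
        | _ x y => simp only [Subgraph.mem_edgeSet, M]; simp
      rw [this, Set.ncard_pair]
      simp only [ne_eq, Sym2.eq_iff]
      tauto
  · intro M hM hc
    obtain ⟨e, e', hne, hE⟩ := Set.ncard_eq_two.1 hc
    induction e with
    | _ a b =>
    induction e' with
    | _ c d =>
    have hab : M.Adj a b := by rw [← Subgraph.mem_edgeSet, hE]; simp
    have hcd : M.Adj c d := by rw [← Subgraph.mem_edgeSet, hE]; simp
    have key : ∀ x y z, M.Adj x y → M.Adj x z → y = z := fun x y z => hM.eq_of_adj_left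
    obtain ⟨f, f1, f2, f3, f4⟩ := h a b c d hab.adj_sub hcd.adj_sub
      (by rintro rfl; exact hne (by rw [key _ _ _ hab hcd]))
      (by rintro rfl; exact hne (by rw [key _ _ _ hab hcd.symm]; exact Sym2.eq_swap))
      (by rintro rfl; exact hne (by rw [key _ _ _ hab.symm hcd]; exact Sym2.eq_swap))
      (by rintro rfl; exact hne (by rw [key _ _ _ hab.symm hcd.symm]))
    let P : G.Subgraph :=
      { verts := Set.univ
        Adj := fun x y => f x = y
        adj_sub := by rintro x y rfl; exact f1 x
        edge_vert := by intros; trivial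
        symm := ⟨by rintro x y rfl; exact f2 x⟩ }
    refine ⟨P, Subgraph.isPerfectMatching_iff.2 fun v => ⟨f v, rfl, fun y hy => Eq.symm hy⟩, ?_⟩
    rw [hE]
    rintro e (rfl | rfl)
    · exact f3
    · exact f4

set_option synthInstance.maxHeartbeats 400000
set_option synthInstance.maxSize 4000

def sixL : List (ℕ × ℕ × ℕ) := [(0,1,2),(0,2,1),(1,0,2),(1,2,0),(2,0,1),(2,1,0)]

theorem perm_six : ∀ σ : Equiv.Perm (Fin 3),
    ((σ 0).val, (σ 1).val, (σ 2).val) ∈ sixL := by decide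

def GoodP (l m n : ℕ) (s : ℕ × ℕ × ℕ) : Prop :=
  ∃ x, PP (DL l m n s.1 s.2.1 s.2.2) x ∧ ∃ y, ¬ PP (DL l m n s.1 s.2.1 s.2.2) y
instance (l m n : ℕ) (s : ℕ × ℕ × ℕ) : Decidable (GoodP l m n s) := by
  unfold GoodP; infer_instance

theorem odd1 : ∀ s ∈ sixL, s ∈ [(1,0,2),(1,2,0),(2,0,1),(2,1,0)] ∨ GoodP 1 3 2 s := by decide +kernel
theorem odd2 : ∀ s ∈ sixL, s = (2,1,0) ∨ GoodP 2 5 3 s := by decide +kernel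
theorem odd3 : ∀ s ∈ sixL, GoodP 3 7 4 s := by decide +kernel
theorem odd4 : ∀ s ∈ sixL, GoodP 4 9 5 s := by decide +kernel
theorem odd5 : ∀ s ∈ sixL, GoodP 5 11 6 s := by decide +kernel
theorem even2 : ∀ s ∈ sixL, s ∈ [(0,1,2),(2,0,1),(2,1,0)] ∨ GoodP 2 4 2 s := by decide +kernel
theorem even3 : ∀ s ∈ sixL, s = (0,1,2) ∨ GoodP 3 6 3 s := by decide +kernel
theorem even4 : ∀ s ∈ sixL, GoodP 4 8 4 s := by decide +kernel
theorem even5 : ∀ s ∈ sixL, s = (0,1,2) ∨ GoodP 5 10 5 s := by decide +kernel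

theorem GoodP.not_vt {V : Type*} {G : SimpleGraph V} {l m n s0 s1 s2 : ℕ}
    (h : GoodP l m n (s0, s1, s2)) (φ : G ≃g DL l m n s0 s1 s2) : ¬ IsVertexTransitive G := by
  obtain ⟨x, hx, y, hy⟩ := h
  exact fun hv => not_vt_P ⟨x, y, hx, hy⟩ (vt_iso φ hv)

theorem odd1_degree : ∃ x y, QQ (DL 1 3 2 1 0 2) x ∧ ¬ QQ (DL 1 3 2 1 0 2) y := by decide +kernel
theorem even2_degree : ∃ x y, QQ (DL 2 4 2 0 1 2) x ∧ ¬ QQ (DL 2 4 2 0 1 2) y := by decide +kernel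

abbrev va {l m n : ℕ} (i : Fin l) : DLV l m n := Sum.inl i
abbrev vb {l m n : ℕ} (i : Fin m) : DLV l m n := Sum.inr (Sum.inl i)
abbrev vc {l m n : ℕ} (i : Fin n) : DLV l m n := Sum.inr (Sum.inr i)

def petF : DLV 2 5 3 → ZMod 5 ⊕ ZMod 5
  | Sum.inl i => Sum.inl (![0, 1] i)
  | Sum.inr (Sum.inl i) => ![Sum.inl 3, Sum.inl 4, Sum.inr 4, Sum.inr 1, Sum.inr 3] i
  | Sum.inr (Sum.inr i) => ![Sum.inl 2, Sum.inr 2, Sum.inr 0] i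

instance : DecidableRel (genPetersen 5 2).Adj := fun p q => by
  unfold genPetersen
  rw [SimpleGraph.fromRel_adj]
  haveI : Fintype (ZMod 5) := inferInstanceAs (Fintype (Fin 5))
  infer_instance

theorem petersen_iso : Nonempty (DL 2 5 3 2 1 0 ≃g genPetersen 5 2) := by
  have hb : Function.Bijective petF := by
    constructor
    · unfold Function.Injective; decide +kernel
    · unfold Function.Surjective; decide +kernel
  refine ⟨⟨Equiv.ofBijective petF hb, ?_⟩⟩
  have : ∀ a b, (genPetersen 5 2).Adj (petF a) (petF b) ↔ (DL 2 5 3 2 1 0).Adj a b := by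
    decide +kernel
  intro a b
  exact this a b

def dodIdx : DLV 5 10 5 → ℕ
  | Sum.inl i => i.val
  | Sum.inr (Sum.inl i) => 5 + i.val
  | Sum.inr (Sum.inr i) => 15 + i.val

def dodV (j : ℕ) : DLV 5 10 5 :=
  if j < 5 then Sum.inl (Fin.ofNat 5 j) else
  if j < 15 then Sum.inr (Sum.inl (Fin.ofNat 10 (j - 5))) else
  Sum.inr (Sum.inr (Fin.ofNat 5 (j - 15)))

def dodPM : List (List ℕ) :=
  [[1, 0, 10, 12, 14, 15, 7, 6, 9, 8, 2, 18, 3, 19, 4, 5, 17, 16, 11, 13],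
   [6, 2, 1, 4, 3, 14, 0, 8, 7, 17, 11, 10, 13, 12, 5, 16, 15, 9, 19, 18],
   [4, 8, 3, 2, 0, 6, 5, 16, 1, 10, 9, 12, 11, 14, 13, 19, 7, 18, 17, 15],
   [1, 0, 3, 2, 14, 6, 5, 8, 7, 10, 9, 18, 13, 12, 4, 19, 17, 16, 11, 15],
   [4, 2, 1, 12, 0, 14, 7, 6, 9, 8, 11, 10, 3, 19, 5, 16, 15, 18, 17, 13],
   [6, 8, 10, 4, 3, 15, 0, 16, 1, 17, 2, 12, 11, 14, 13, 5, 7, 9, 19, 18],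
   [1, 0, 3, 2, 14, 6, 5, 8, 7, 10, 9, 12, 11, 19, 4, 16, 15, 18, 17, 13],
   [6, 8, 10, 4, 3, 14, 0, 16, 1, 17, 2, 18, 13, 12, 5, 19, 7, 9, 11, 15],
   [4, 2, 1, 12, 0, 15, 7, 6, 9, 8, 11, 10, 3, 14, 13, 5, 17, 16, 19, 18],
   [1, 0, 3, 2, 14, 6, 5, 16, 9, 8, 11, 10, 13, 12, 4, 19, 7, 18, 17, 15],
   [6, 2, 1, 12, 14, 15, 0, 8, 7, 10, 9, 18, 3, 19, 4, 5, 17, 16, 11, 13],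
   [1, 0, 10, 4, 3, 6, 5, 8, 7, 17, 2, 12, 11, 14, 13, 16, 15, 9, 19, 18],
   [4, 8, 10, 12, 0, 14, 7, 6, 1, 17, 2, 18, 3, 19, 5, 16, 15, 9, 11, 13],
   [6, 8, 3, 2, 14, 15, 0, 16, 1, 17, 11, 10, 13, 12, 4, 5, 7, 9, 19, 18],
   [4, 8, 3, 2, 0, 14, 7, 6, 1, 10, 9, 18, 13, 12, 5, 19, 17, 16, 11, 15],
   [1, 0, 10, 4, 3, 14, 7, 6, 9, 8, 2, 12, 11, 19, 5, 16, 15, 18, 17, 13],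
   [6, 2, 1, 12, 14, 15, 0, 16, 9, 8, 11, 10, 3, 19, 4, 5, 7, 18, 17, 13],
   [4, 2, 1, 12, 0, 6, 5, 8, 7, 10, 9, 18, 3, 14, 13, 19, 17, 16, 11, 15],
   [6, 2, 1, 4, 3, 15, 0, 8, 7, 10, 9, 12, 11, 14, 13, 5, 17, 16, 19, 18]]

def dodF (L : List ℕ) (v : DLV 5 10 5) : DLV 5 10 5 := dodV (L.getD (dodIdx v) 0)

theorem dod_good : ∀ L ∈ dodPM, (∀ v, (DL 5 10 5 0 1 2).Adj v (dodF L v)) ∧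
    ∀ v, dodF L (dodF L v) = v := by decide +kernel

theorem dod_cover : ∀ a b, (DL 5 10 5 0 1 2).Adj a b → ∀ c, a ≠ c → b ≠ c →
    ∀ d, (DL 5 10 5 0 1 2).Adj c d → a ≠ d → b ≠ d →
    ∃ L ∈ dodPM, dodF L a = b ∧ dodF L c = d := by decide +kernel

theorem dod_two : ∃ a b, (DL 5 10 5 0 1 2).Adj a b ∧ ∃ c, a ≠ c ∧ b ≠ c ∧
    ∃ d, (DL 5 10 5 0 1 2).Adj c d ∧ a ≠ d ∧ b ≠ d := by decide +kernel

theorem dod_ext {V : Type*} [Fintype V] {G : SimpleGraph V} (φ : G ≃g DL 5 10 5 0 1 2) :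
    IsNExtendable G 2 := by
  have hadj : ∀ x y, (DL 5 10 5 0 1 2).Adj (φ x) (φ y) ↔ G.Adj x y := fun x y => φ.map_adj_iff
  have hs : ∀ x, φ (φ.symm x) = x := fun x => φ.apply_symm_apply x
  apply ext_of
  · rw [Fintype.card_congr φ.toEquiv]; decide
  · obtain ⟨a, b, hab, c, h1, h2, d, hcd, h3, h4⟩ := dod_two
    refine ⟨φ.symm a, φ.symm b, φ.symm c, φ.symm d, φ.symm.map_adj_iff.2 hab,
      φ.symm.map_adj_iff.2 hcd, ?_, ?_, ?_, ?_⟩ <;> simpa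
  · intro a b c d hab hcd h1 h2 h3 h4
    obtain ⟨L, hL, e1, e2⟩ := dod_cover (φ a) (φ b) ((hadj _ _).2 hab) (φ c)
      (fun e => h1 (φ.injective e)) (fun e => h3 (φ.injective e)) (φ d) ((hadj _ _).2 hcd)
      (fun e => h2 (φ.injective e)) (fun e => h4 (φ.injective e))
    obtain ⟨g1, g2⟩ := dod_good L hL
    refine ⟨fun v => φ.symm (dodF L (φ v)), ?_, ?_, ?_, ?_⟩
    · intro v
      rw [← hadj, hs]
      exact g1 _
    · intro v
      simp [g2]
    · simp [e1]
    · simp [e2]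

/-- A graph isomorphic to an odd or even double ladder which is uniformly cyclically
5-edge-connected and vertex-transitive is 2-extendable or isomorphic to the Petersen
graph `GP(5,2)`. -/
theorem doubleLadder_u5_vertexTransitive_two_extendable {V : Type*} [Fintype V]
    (G : SimpleGraph V)
    (hdl : (∃ (k : ℕ) (σ : Equiv.Perm (Fin 3)), Nonempty (G ≃g oddDoubleLadder k σ)) ∨
      (∃ (k : ℕ) (σ : Equiv.Perm (Fin 3)), Nonempty (G ≃g evenDoubleLadder k σ)))
    (hU : IsU5 G) (hvt : IsVertexTransitive G) :
    IsNExtendable G 2 ∨ Nonempty (G ≃g genPetersen 5 2) := by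
  rcases hdl with ⟨k, σ, ⟨φ⟩⟩ | ⟨k, σ, ⟨φ⟩⟩
  · rw [odd_eq_DL] at φ
    have h6 := perm_six σ
    generalize (σ 0).val = s0 at φ h6
    generalize (σ 1).val = s1 at φ h6
    generalize (σ 2).val = s2 at φ h6
    have hc := U5_card hU
    rw [Fintype.card_congr φ.toEquiv] at hc
    rcases Nat.lt_or_ge k 6 with hk | hk
    · interval_cases k
      · simp at hc
      · rcases odd1 _ h6 with h | h
        · simp only [List.mem_cons, Prod.mk.injEq, List.not_mem_nil, or_false] at h
          rcases h with ⟨rfl, rfl, rfl⟩ | ⟨rfl, rfl, rfl⟩ | ⟨rfl, rfl, rfl⟩ | ⟨rfl, rfl, rfl⟩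
          · exact absurd (vt_iso φ hvt) (not_vt_Q odd1_degree)
          · exact (not_U5_tri (W := DLV 1 3 2) φ hU (va 0) (vb 1) (vb 2) (vb 0) (vc 0) (vc 1)
              (by decide +kernel) (by decide +kernel) (by decide +kernel) (by decide +kernel)).elim
          · exact (not_U5_tri (W := DLV 1 3 2) φ hU (va 0) (vb 0) (vb 1) (vb 2) (vc 0) (vc 1)
              (by decide +kernel) (by decide +kernel) (by decide +kernel) (by decide +kernel)).elim
          · exact (not_U5_tri (W := DLV 1 3 2) φ hU (va 0) (vc 0) (vc 1) (vb 0) (vb 1) (vb 2)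
              (by decide +kernel) (by decide +kernel) (by decide +kernel) (by decide +kernel)).elim
        · exact absurd hvt (h.not_vt φ)
      · rcases odd2 _ h6 with h | h
        · simp only [Prod.mk.injEq] at h
          obtain ⟨rfl, rfl, rfl⟩ := h
          exact Or.inr ⟨φ.trans petersen_iso.some⟩
        · exact absurd hvt (h.not_vt φ)
      · exact absurd hvt ((odd3 _ h6).not_vt φ)
      · exact absurd hvt ((odd4 _ h6).not_vt φ)
      · exact absurd hvt ((odd5 _ h6).not_vt φ)
    · exact absurd (vt_iso φ hvt) (not_vt_P (DL_large _ _ _ _ _ _ hk (by omega) (by omega)))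
  · rw [even_eq_DL] at φ
    have h6 := perm_six σ
    generalize (σ 0).val = s0 at φ h6
    generalize (σ 1).val = s1 at φ h6
    generalize (σ 2).val = s2 at φ h6
    have hc := U5_card hU
    rw [Fintype.card_congr φ.toEquiv] at hc
    rcases Nat.lt_or_ge k 6 with hk | hk
    · interval_cases k
      · simp at hc
      · simp at hc
      · rcases even2 _ h6 with h | h
        · simp only [List.mem_cons, Prod.mk.injEq, List.not_mem_nil, or_false] at h
          rcases h with ⟨rfl, rfl, rfl⟩ | ⟨rfl, rfl, rfl⟩ | ⟨rfl, rfl, rfl⟩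
          · exact absurd (vt_iso φ hvt) (not_vt_Q even2_degree)
          · exact (not_U5_quad (W := DLV 2 4 2) φ hU (va 0) (va 1) (vb 0) (vb 1)
              (vb 2) (vb 3) (vc 0) (vc 1)
              (by decide +kernel) (by decide +kernel) (by decide +kernel) (by decide +kernel)).elim
          · exact (not_U5_quad (W := DLV 2 4 2) φ hU (va 0) (va 1) (vc 0) (vc 1)
              (vb 0) (vb 1) (vb 2) (vb 3)
              (by decide +kernel) (by decide +kernel) (by decide +kernel) (by decide +kernel)).elim
        · exact absurd hvt (h.not_vt φ)
      · rcases even3 _ h6 with h | h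
        · simp only [Prod.mk.injEq] at h
          obtain ⟨rfl, rfl, rfl⟩ := h
          exact (not_U5_tri (W := DLV 3 6 3) φ hU (va 0) (va 1) (va 2) (vc 0) (vc 1) (vc 2)
              (by decide +kernel) (by decide +kernel) (by decide +kernel) (by decide +kernel)).elim
        · exact absurd hvt (h.not_vt φ)
      · exact absurd hvt ((even4 _ h6).not_vt φ)
      · rcases even5 _ h6 with h | h
        · simp only [Prod.mk.injEq] at h
          obtain ⟨rfl, rfl, rfl⟩ := h
          exact Or.inl (dod_ext φ)
        · exact absurd hvt (h.not_vt φ)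
    · exact absurd (vt_iso φ hvt) (not_vt_P (DL_large _ _ _ _ _ _ hk (by omega) (by omega)))
end

section
/- For every integer k ≥ 2, the odd double ladder of length k whose matching between {a_1, b_1, c_1} and {a_k, b_{2k+1}, c_{k+1}} is {a_1c_{k+1}, b_1b_{2k+1}, c_1a_k} is isomorphic to the generalized Petersen graph GP(2k+1, 2). -/
/-- vertex map -/
def oddDLEquiv (k : ℕ) : OddDLVert k ≃ (ZMod (2 * k + 1) ⊕ ZMod (2 * k + 1)) where
  toFun p := match p with
    | Sum.inl a => Sum.inr (⟨2 * a.1 + 1, by omega⟩ : Fin (2 * k + 1))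
    | Sum.inr (Sum.inl b) => Sum.inl b
    | Sum.inr (Sum.inr c) => Sum.inr (⟨2 * c.1, by omega⟩ : Fin (2 * k + 1))
  invFun q := match q with
    | Sum.inl b => Sum.inr (Sum.inl b)
    | Sum.inr v =>
      have hv : ZMod.val v < 2 * k + 1 := ZMod.val_lt v
      if h : ZMod.val v % 2 = 1 then Sum.inl ⟨ZMod.val v / 2, by omega⟩
      else Sum.inr (Sum.inr ⟨ZMod.val v / 2, by omega⟩)
  left_inv := by
    rintro (a | b | c)
    · have : ZMod.val (n := 2 * k + 1) (⟨2 * a.1 + 1, by omega⟩ : Fin (2 * k + 1))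
        = 2 * a.1 + 1 := rfl
      simp only [this]
      rw [dif_pos (by omega)]
      congr 1; apply Fin.ext; simp only []; omega
    · rfl
    · have : ZMod.val (n := 2 * k + 1) (⟨2 * c.1, by omega⟩ : Fin (2 * k + 1))
        = 2 * c.1 := rfl
      simp only [this]
      rw [dif_neg (by omega)]
      congr 2; apply Fin.ext; simp only []; omega
  right_inv := by
    rintro (b | v)
    · rfl
    · by_cases h : ZMod.val v % 2 = 1
      · simp only [h, dif_pos]
        congr 1; apply ZMod.val_injective (2 * k + 1)
        change 2 * (ZMod.val v / 2) + 1 = ZMod.val v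
        omega
      · simp only [h, dif_neg, not_false_eq_true]
        congr 1; apply ZMod.val_injective (2 * k + 1)
        change 2 * (ZMod.val v / 2) = ZMod.val v
        omega

lemma zmod_eq_add_iff (k d : ℕ) (hd : d < 2 * k + 1) (i j : ZMod (2 * k + 1)) :
    j = i + (d : ZMod (2 * k + 1)) ↔
      (ZMod.val j = ZMod.val i + d ∨ ZMod.val j + (2 * k + 1) = ZMod.val i + d) := by
  have hi := ZMod.val_lt i
  have hj := ZMod.val_lt j
  rw [← (ZMod.val_injective (2 * k + 1)).eq_iff, ZMod.val_add, ZMod.val_natCast,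
    Nat.mod_eq_of_lt hd]
  rcases lt_or_ge (ZMod.val i + d) (2 * k + 1) with h | h
  · rw [Nat.mod_eq_of_lt h]; omega
  · rw [Nat.mod_eq_sub_mod h, Nat.mod_eq_of_lt (by omega)]; omega

lemma gp_adj_oo (k : ℕ) (hk : 2 ≤ k) (i j : ZMod (2 * k + 1)) :
    (genPetersen (2 * k + 1) 2).Adj (Sum.inl i) (Sum.inl j) ↔
      (ZMod.val j = ZMod.val i + 1 ∨ ZMod.val j + (2 * k + 1) = ZMod.val i + 1) ∨
      (ZMod.val i = ZMod.val j + 1 ∨ ZMod.val i + (2 * k + 1) = ZMod.val j + 1) := by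
  rw [← zmod_eq_add_iff k 1 (by omega), ← zmod_eq_add_iff k 1 (by omega)]
  have : ∀ x : ZMod (2 * k + 1), x ≠ x + ((1 : ℕ) : ZMod (2 * k + 1)) := by
    intro x hx
    rw [zmod_eq_add_iff k 1 (by omega)] at hx
    omega
  have h2 := this i
  simp only [Nat.cast_one] at *
  simp only [genPetersen, SimpleGraph.fromRel_adj, reduceCtorEq, Sum.inl.injEq, false_and,
    and_false, exists_false, or_false, exists_eq_left', ne_eq, and_iff_right_iff_imp]
  rintro h rfl
  tauto

lemma gp_adj_ii (k : ℕ) (hk : 2 ≤ k) (i j : ZMod (2 * k + 1)) :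
    (genPetersen (2 * k + 1) 2).Adj (Sum.inr i) (Sum.inr j) ↔
      (ZMod.val j = ZMod.val i + 2 ∨ ZMod.val j + (2 * k + 1) = ZMod.val i + 2) ∨
      (ZMod.val i = ZMod.val j + 2 ∨ ZMod.val i + (2 * k + 1) = ZMod.val j + 2) := by
  rw [← zmod_eq_add_iff k 2 (by omega), ← zmod_eq_add_iff k 2 (by omega)]
  have : ∀ x : ZMod (2 * k + 1), x ≠ x + ((2 : ℕ) : ZMod (2 * k + 1)) := by
    intro x hx
    rw [zmod_eq_add_iff k 2 (by omega)] at hx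
    omega
  have h2 := this i
  simp only [genPetersen, SimpleGraph.fromRel_adj, reduceCtorEq, Sum.inr.injEq, false_and,
    and_false, exists_false, false_or, exists_eq_left', ne_eq, and_iff_right_iff_imp]
  rintro h rfl
  tauto

lemma gp_adj_oi (k : ℕ) (i j : ZMod (2 * k + 1)) :
    (genPetersen (2 * k + 1) 2).Adj (Sum.inl i) (Sum.inr j) ↔ ZMod.val i = ZMod.val j := by
  rw [(ZMod.val_injective (2 * k + 1)).eq_iff]
  simp [genPetersen, SimpleGraph.fromRel_adj, eq_comm]

lemma gp_adj_io (k : ℕ) (i j : ZMod (2 * k + 1)) :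
    (genPetersen (2 * k + 1) 2).Adj (Sum.inr i) (Sum.inl j) ↔ ZMod.val j = ZMod.val i := by
  rw [SimpleGraph.adj_comm, gp_adj_oi]

lemma odl_match (k : ℕ) (p q : OddDLVert k) :
    (∃ j : Fin 3, oddDLStart k j p ∧ oddDLEnd k (Equiv.swap (0 : Fin 3) 2 j) q) ↔
      ((∃ a : Fin k, p = Sum.inl a ∧ (a : ℕ) = 0) ∧
        (∃ c : Fin (k + 1), q = Sum.inr (Sum.inr c) ∧ (c : ℕ) = k)) ∨
      ((∃ b : Fin (2 * k + 1), p = Sum.inr (Sum.inl b) ∧ (b : ℕ) = 0) ∧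
        (∃ b : Fin (2 * k + 1), q = Sum.inr (Sum.inl b) ∧ (b : ℕ) = 2 * k)) ∨
      ((∃ c : Fin (k + 1), p = Sum.inr (Sum.inr c) ∧ (c : ℕ) = 0) ∧
        (∃ a : Fin k, q = Sum.inl a ∧ (a : ℕ) = k - 1)) := by
  have h0 : Equiv.swap (0 : Fin 3) 2 0 = 2 := by decide
  have h1 : Equiv.swap (0 : Fin 3) 2 1 = 1 := by decide
  have h2 : Equiv.swap (0 : Fin 3) 2 2 = 0 := by decide
  constructor
  · rintro ⟨j, hs, he⟩
    fin_cases j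
    · left; simpa [oddDLStart, oddDLEnd] using And.intro hs he
    · right; left; simpa [oddDLStart, oddDLEnd, h1] using And.intro hs he
    · right; right; simpa [oddDLStart, oddDLEnd] using And.intro hs he
  · rintro (h | h | h)
    · exact ⟨0, by simpa [oddDLStart, oddDLEnd] using h⟩
    · exact ⟨1, by simpa [oddDLStart, oddDLEnd, h1] using h⟩
    · exact ⟨2, by simpa [oddDLStart, oddDLEnd] using h⟩

theorem oddDoubleLadder_iso_genPetersen (k : ℕ) (hk : 2 ≤ k) :
    Nonempty
      (oddDoubleLadder k (Equiv.swap (0 : Fin 3) 2) ≃g genPetersen (2 * k + 1) 2) := by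
  refine ⟨⟨oddDLEquiv k, ?_⟩⟩
  have ea : ∀ a : Fin k, ∃ x : ZMod (2 * k + 1),
      oddDLEquiv k (Sum.inl a) = Sum.inr x ∧ ZMod.val x = 2 * a.1 + 1 :=
    fun a => ⟨_, rfl, rfl⟩
  have eb : ∀ b : Fin (2 * k + 1), ∃ x : ZMod (2 * k + 1),
      oddDLEquiv k (Sum.inr (Sum.inl b)) = Sum.inl x ∧ ZMod.val x = b.1 :=
    fun b => ⟨_, rfl, rfl⟩
  have ec : ∀ c : Fin (k + 1), ∃ x : ZMod (2 * k + 1),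
      oddDLEquiv k (Sum.inr (Sum.inr c)) = Sum.inr x ∧ ZMod.val x = 2 * c.1 :=
    fun c => ⟨_, rfl, rfl⟩
  choose fa ha ha' using ea
  choose fb hb hb' using eb
  choose fc hc hc' using ec
  intro p q
  simp only [oddDoubleLadder, SimpleGraph.fromRel_adj, odl_match]
  rcases p with a | b | c <;> rcases q with a' | b' | c'
  all_goals
    simp only [ha, hb, hc, gp_adj_oo k hk, gp_adj_ii k hk, gp_adj_oi, gp_adj_io, ha', hb', hc']
    clear ha hb hc ha' hb' hc'
    simp only [reduceCtorEq, Sum.inl.injEq, Sum.inr.injEq, false_and, and_false, exists_false,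
      or_false, false_or, exists_eq_left', exists_and_left, ne_eq, not_false_eq_true, true_and]
    try simp only [Fin.ext_iff]
    try omega
end
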